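/- Let A be a central, essential arrangement of hyperplanes in R^d. Then the total number of chambers (connected components of the complement of the union of hyperplanes in A) equals the sum over k of the k-th Betti numbers of the complement of the complexified arrangement, which equals the number of non-broken-circuit sets of the underlying matroid. -/

import Mathlib

open Module Classical

abbrev Hyp (d : ℕ) := Submodule ℝ (Fin d → ℝ)

noncomputable instance (d : ℕ) : DecidableEq (Hyp d) := Classical.decEq _

def IsLinHyp (d : ℕ) (H : Hyp d) : Prop := finrank ℝ H = d - 1

noncomputable def arrRank (d : ℕ) (S : Finset (Hyp d)) : ℕ :=
  d - finrank ℝ (S.inf id : Hyp d)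

def ArrIndep (d : ℕ) (S : Finset (Hyp d)) : Prop := arrRank d S = S.card

def IsCircuit (d : ℕ) (S : Finset (Hyp d)) : Prop :=
  ¬ ArrIndep d S ∧ ∀ H ∈ S, ArrIndep d (S.erase H)

def IsBrokenCircuit (d : ℕ) (A : Finset (Hyp d)) (ord : Hyp d → ℕ)
    (B : Finset (Hyp d)) : Prop :=
  ∃ H ∈ A, H ∉ B ∧ IsCircuit d (insert H B) ∧ ∀ H' ∈ B, ord H < ord H'

def IsNBC (d : ℕ) (A : Finset (Hyp d)) (ord : Hyp d → ℕ) (S : Finset (Hyp d)) : Prop :=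
  S ⊆ A ∧ ArrIndep d S ∧ ∀ B ⊆ S, ¬ IsBrokenCircuit d A ord B

def arrComplement (d : ℕ) (A : Finset (Hyp d)) : Set (Fin d → ℝ) :=
  {x | ∀ H ∈ A, x ∉ (H : Set (Fin d → ℝ))}

noncomputable def numChambers (d : ℕ) (A : Finset (Hyp d)) : ℕ :=
  Nat.card (ConnectedComponents (arrComplement d A))

structure SSFiltration (d : ℕ) (A : Finset (Hyp d)) (𝒜 : ℕ → Finset (Hyp d)) : Prop where
  zero : 𝒜 0 = ∅
  top : 𝒜 d = A
  mono : ∀ i < d, 𝒜 i ⊆ 𝒜 (i + 1)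
  hyp : ∀ H ∈ A, IsLinHyp d H
  rank : ∀ i, 1 ≤ i → i ≤ d → arrRank d (𝒜 i) = i
  ss : ∀ i, 2 ≤ i → i ≤ d → ∀ H ∈ 𝒜 i, ∀ H' ∈ 𝒜 i, H ≠ H' →
    ∃ H'' ∈ 𝒜 (i - 1), H ⊓ H' ≤ H''

def CompatOrder (d : ℕ) (𝒜 : ℕ → Finset (Hyp d)) (ord : Hyp d → ℕ) : Prop :=
  ∀ i j : ℕ, ∀ H ∈ 𝒜 i \ 𝒜 (i - 1), ∀ H' ∈ 𝒜 j \ 𝒜 (j - 1), i < j → ord H < ord H'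

-- complexification
noncomputable def complexify (d : ℕ) (H : Hyp d) : Submodule ℂ (Fin d → ℂ) :=
  Submodule.span ℂ ((fun x : Fin d → ℝ => (fun i => (x i : ℂ))) '' (H : Set (Fin d → ℝ)))

def cxComplement (d : ℕ) (A : Finset (Hyp d)) : Set (Fin d → ℂ) :=
  {z | ∀ H ∈ A, z ∉ (complexify d H : Set (Fin d → ℂ))}

open CategoryTheory

noncomputable def singularChains (R : Type) [CommRing R] (X : Type) [TopologicalSpace X] :
    ChainComplex (ModuleCat R) ℕ :=
  (AlgebraicTopology.alternatingFaceMapComplex (ModuleCat R)).obj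
    (((SimplicialObject.whiskering _ _).obj (ModuleCat.free R)).obj
      (TopCat.toSSet.obj (TopCat.of X)))

noncomputable def betti (X : Type) [TopologicalSpace X] (k : ℕ) : ℕ :=
  finrank ℚ ((singularChains ℚ X).homology k)


/-! ### Affine chains -/

namespace ArrTop

noncomputable section

/-- Formal combinations of `n`-tuples of points. -/
abbrev AC (P : Type) (n : ℕ) := (Fin n → P) →₀ ℚ

/-- extend a function on generators linearly -/
def lift {S : Type} {M : Type} [AddCommGroup M] [Module ℚ M] (f : S → M) : (S →₀ ℚ) →ₗ[ℚ] M :=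
  Finsupp.linearCombination ℚ f

@[simp] lemma lift_single {S : Type} {M : Type} [AddCommGroup M] [Module ℚ M] (f : S → M) (s : S) :
    lift f (Finsupp.single s 1) = f s := by
  simp [lift]

lemma hom_ext1 {S : Type} {M : Type} [AddCommGroup M] [Module ℚ M] {f g : (S →₀ ℚ) →ₗ[ℚ] M}
    (h : ∀ s, f (Finsupp.single s 1) = g (Finsupp.single s 1)) : f = g := by
  apply Finsupp.lhom_ext'
  intro s
  ext
  simpa using h s

lemma hom_ext2 {S : Type} {M : Type} [AddCommGroup M] [Module ℚ M] {f g : (S →₀ ℚ) →ₗ[ℚ] M}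
    (h : ∀ s, f (Finsupp.single s 1) = g (Finsupp.single s 1)) (c : S →₀ ℚ) : f c = g c := by
  rw [hom_ext1 h]

/-- generator -/
abbrev gen {S : Type} (s : S) : S →₀ ℚ := Finsupp.single s 1

/-- boundary of tuples -/
def abd {P : Type} (n : ℕ) : AC P (n+1) →ₗ[ℚ] AC P n :=
  lift (fun w => ∑ i : Fin (n+1), (-1 : ℚ)^(i:ℕ) • gen (w ∘ i.succAbove))

/-- cone on tuples -/
def cone {P : Type} (b : P) (n : ℕ) : AC P n →ₗ[ℚ] AC P (n+1) :=
  lift (fun w => gen (Fin.cons b w : Fin (n+1) → P))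

lemma abd_cone_gen {P : Type} (b : P) (n : ℕ) (w : Fin (n+1) → P) :
    abd (n+1) (cone b (n+1) (gen w)) = gen w - cone b n (abd n (gen w)) := by
  simp only [abd, cone, lift_single, gen]
  rw [Fin.sum_univ_succ]
  simp only [map_sum, map_smul, lift_single]
  rw [sub_eq_add_neg, ← Finset.sum_neg_distrib]
  congr 1
  · simp
  · refine Finset.sum_congr rfl fun i _ => ?_
    rw [Fin.val_succ, pow_succ, mul_neg, mul_one, neg_smul]
    congr 3
    funext j
    refine Fin.cases ?_ (fun j => ?_) j
    · simp
    · simp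

lemma abd_cone {P : Type} (b : P) (n : ℕ) (c : AC P (n+1)) :
    abd (n+1) (cone b (n+1) c) = c - cone b n (abd n c) := by
  have := hom_ext2 (f := abd (n+1) ∘ₗ cone b (n+1)) (g := LinearMap.id - cone b n ∘ₗ abd n)
    (fun s => by simpa using abd_cone_gen b n s) c
  simpa using this

lemma abd_cone0 {P : Type} (b : P) (c : AC P 0) :
    abd 0 (cone b 0 c) = c := by
  have := hom_ext2 (f := abd 0 ∘ₗ cone b 0) (g := LinearMap.id)
    (fun s => by
      simp only [abd, cone, lift_single, gen, LinearMap.comp_apply, Fin.sum_univ_succ]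
      simp) c
  simpa using this

lemma abd_abd {P : Type} (n : ℕ) (c : AC P (n+2)) : abd n (abd (n+1) c) = 0 := by
  induction n with
  | zero =>
    have := hom_ext2 (f := abd 0 ∘ₗ abd (P := P) 1) (g := 0)
      (fun s => by
        have h : gen s = cone (s 0) 1 (gen (Fin.tail s)) := by
          simp [cone, gen]
        simp only [LinearMap.comp_apply, LinearMap.zero_apply]
        change abd 0 (abd 1 (gen s)) = 0
        rw [h, abd_cone, map_sub, abd_cone0, sub_self]) c
    simpa using this
  | succ n ih =>
    have := hom_ext2 (f := abd (n+1) ∘ₗ abd (P := P) (n+2)) (g := 0)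
      (fun s => by
        have h : gen s = cone (s 0) (n+2) (gen (Fin.tail s)) := by
          simp [cone, gen]
        simp only [LinearMap.comp_apply, LinearMap.zero_apply]
        change abd (n+1) (abd (n+2) (gen s)) = 0
        rw [h, abd_cone, map_sub, abd_cone, ih, map_zero, sub_zero, sub_self]) c
    simpa using this

/-- push forward of tuples -/
def push {P Q : Type} (a : P → Q) (n : ℕ) : AC P n →ₗ[ℚ] AC Q n :=
  lift (fun w => gen (a ∘ w))

@[simp] lemma push_gen {P Q : Type} (a : P → Q) (n : ℕ) (w : Fin n → P) :
    push a n (gen w) = gen (a ∘ w) := by simp [push, gen]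

lemma push_abd {P Q : Type} (a : P → Q) (n : ℕ) (c : AC P (n+1)) :
    push a n (abd n c) = abd n (push a (n+1) c) := by
  have := hom_ext2 (f := push a n ∘ₗ abd n) (g := abd n ∘ₗ push a (n+1))
    (fun s => by
      simp only [push, abd, gen, Function.comp_assoc, LinearMap.comp_apply, lift_single, map_sum, map_smul]) c
  simpa using this

lemma push_cone {P Q : Type} (a : P → Q) (b : P) (n : ℕ) (c : AC P n) :
    push a (n+1) (cone b n c) = cone (a b) n (push a n c) := by
  have := hom_ext2 (f := push a (n+1) ∘ₗ cone b n) (g := cone (a b) n ∘ₗ push a n)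
    (fun s => by
      simp only [push, cone, gen, LinearMap.comp_apply, lift_single]
      congr 1
      funext j
      refine Fin.cases ?_ (fun j => ?_) j
      · simp
      · simp) c
  simpa using this

lemma push_push {P Q R : Type} (a : P → Q) (b : Q → R) (n : ℕ) (c : AC P n) :
    push b n (push a n c) = push (b ∘ a) n c := by
  have := hom_ext2 (f := push b n ∘ₗ push a n) (g := push (b ∘ a) n)
    (fun s => by simp [push, gen, Function.comp_assoc]) c
  simpa using this

/-- The generic homotopy between two chain operators. -/
def thom {P Q : Type} (F G : ∀ n, AC P n →ₗ[ℚ] AC Q n) (β : ∀ n, (Fin (n+1) → P) → Q) :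
    ∀ n, AC P n →ₗ[ℚ] AC Q (n+1)
  | 0 => 0
  | n+1 => lift (fun w => cone (β n w) (n+1)
      (F (n+1) (gen w) - G (n+1) (gen w) - thom F G β n (abd n (gen w))))

lemma thom_spec0 {P Q : Type} (F G : ∀ n, AC P n →ₗ[ℚ] AC Q n) (β : ∀ n, (Fin (n+1) → P) → Q) :
    thom F G β 0 = 0 := rfl

lemma thom_gen {P Q : Type} (F G : ∀ n, AC P n →ₗ[ℚ] AC Q n) (β : ∀ n, (Fin (n+1) → P) → Q)
    (n : ℕ) (w : Fin (n+1) → P) : thom F G β (n+1) (gen w) = cone (β n w) (n+1)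
      (F (n+1) (gen w) - G (n+1) (gen w) - thom F G β n (abd n (gen w))) := by
  simp [thom, gen]

lemma thom_spec {P Q : Type} (F G : ∀ n, AC P n →ₗ[ℚ] AC Q n) (β : ∀ n, (Fin (n+1) → P) → Q)
    (hF : ∀ n c, F n (abd n c) = abd n (F (n+1) c))
    (hG : ∀ n c, G n (abd n c) = abd n (G (n+1) c))
    (h0 : F 0 = G 0) (n : ℕ) (c : AC P (n+1)) :
    abd (n+1) (thom F G β (n+1) c) = F (n+1) c - G (n+1) c - thom F G β n (abd n c) := by
  induction n with
  | zero =>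
    have := hom_ext2 (f := abd 1 ∘ₗ thom F G β 1) (g := F 1 - G 1 - thom F G β 0 ∘ₗ abd 0)
      (fun s => by
        change abd 1 (thom F G β 1 (gen s)) = F 1 (gen s) - G 1 (gen s) - thom F G β 0 (abd 0 (gen s))
        rw [thom_gen, abd_cone, thom_spec0]
        simp only [LinearMap.zero_apply, sub_zero, map_sub]
        rw [← hF, ← hG, h0]
        simp) c
    simpa using this
  | succ n ih =>
    have := hom_ext2 (f := abd (n+2) ∘ₗ thom F G β (n+2))
      (g := F (n+2) - G (n+2) - thom F G β (n+1) ∘ₗ abd (n+1))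
      (fun s => by
        change abd (n+2) (thom F G β (n+2) (gen s)) =
          F (n+2) (gen s) - G (n+2) (gen s) - thom F G β (n+1) (abd (n+1) (gen s))
        rw [thom_gen, abd_cone]
        simp only [map_sub]
        rw [ih, abd_abd, ← hF, ← hG]
        simp) c
    simpa using this

lemma thom_push {P Q P' Q' : Type} (F G : ∀ n, AC P n →ₗ[ℚ] AC Q n) (β : ∀ n, (Fin (n+1) → P) → Q)
    (F' G' : ∀ n, AC P' n →ₗ[ℚ] AC Q' n) (β' : ∀ n, (Fin (n+1) → P') → Q')
    (a : P → P') (a' : Q → Q')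
    (hF : ∀ n c, push a' n (F n c) = F' n (push a n c))
    (hG : ∀ n c, push a' n (G n c) = G' n (push a n c))
    (hβ : ∀ n w, a' (β n w) = β' n (a ∘ w)) (n : ℕ) (c : AC P n) :
    push a' (n+1) (thom F G β n c) = thom F' G' β' n (push a n c) := by
  induction n with
  | zero => simp [thom]
  | succ n ih =>
    have := hom_ext2 (f := push a' (n+2) ∘ₗ thom F G β (n+1))
      (g := thom F' G' β' (n+1) ∘ₗ push a (n+1))
      (fun s => by
        change push a' (n+2) (thom F G β (n+1) (gen s)) = thom F' G' β' (n+1) (push a (n+1) (gen s))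
        rw [thom_gen, push_cone, push_gen, thom_gen]
        simp only [map_sub]
        rw [hF, hG, ih, push_abd, push_gen, hβ]) c
    simpa using this

/-- barycentric subdivision w.r.t. a choice of barycenters -/
def subdiv {P : Type} (β : ∀ n, (Fin (n+1) → P) → P) : ∀ n, AC P n →ₗ[ℚ] AC P n
  | 0 => LinearMap.id
  | n+1 => lift (fun w => cone (β n w) n (subdiv β n (abd n (gen w))))

lemma subdiv_gen {P : Type} (β : ∀ n, (Fin (n+1) → P) → P) (n : ℕ) (w : Fin (n+1) → P) :
    subdiv β (n+1) (gen w) = cone (β n w) n (subdiv β n (abd n (gen w))) := by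
  simp [subdiv, gen]

lemma subdiv_abd {P : Type} (β : ∀ n, (Fin (n+1) → P) → P) (n : ℕ) (c : AC P (n+1)) :
    subdiv β n (abd n c) = abd n (subdiv β (n+1) c) := by
  induction n with
  | zero =>
    have := hom_ext2 (f := subdiv β 0 ∘ₗ abd 0) (g := abd 0 ∘ₗ subdiv β 1)
      (fun s => by
        change subdiv β 0 (abd 0 (gen s)) = abd 0 (subdiv β 1 (gen s))
        rw [subdiv_gen, abd_cone0]) c
    simpa using this
  | succ n ih =>
    have := hom_ext2 (f := subdiv β (n+1) ∘ₗ abd (n+1)) (g := abd (n+1) ∘ₗ subdiv β (n+2))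
      (fun s => by
        change subdiv β (n+1) (abd (n+1) (gen s)) = abd (n+1) (subdiv β (n+2) (gen s))
        rw [subdiv_gen, abd_cone, ← ih, abd_abd]
        simp) c
    simpa using this

lemma subdiv_push {P P' : Type} (β : ∀ n, (Fin (n+1) → P) → P) (β' : ∀ n, (Fin (n+1) → P') → P')
    (a : P → P') (hβ : ∀ n w, a (β n w) = β' n (a ∘ w)) (n : ℕ) (c : AC P n) :
    push a n (subdiv β n c) = subdiv β' n (push a n c) := by
  induction n with
  | zero => simp [subdiv]
  | succ n ih =>
    have := hom_ext2 (f := push a (n+1) ∘ₗ subdiv β (n+1)) (g := subdiv β' (n+1) ∘ₗ push a (n+1))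
      (fun s => by
        change push a (n+1) (subdiv β (n+1) (gen s)) = subdiv β' (n+1) (push a (n+1) (gen s))
        rw [subdiv_gen, push_cone, push_gen, subdiv_gen, ih, push_abd, push_gen, hβ]) c
    simpa using this

end

end ArrTop

/-! ### Affine simplices and singular chains -/

namespace ArrTop

noncomputable section

/-- convexity as a class -/
class Cvx {E : Type} [NormedAddCommGroup E] [NormedSpace ℝ E] (K : Set E) : Prop where
  out : Convex ℝ K

/-- the standard simplex with `n` vertices -/
abbrev Sx (n : ℕ) : Set (Fin n → ℝ) := stdSimplex ℝ (Fin n)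

instance (n : ℕ) : Cvx (Sx n) := ⟨convex_stdSimplex ℝ (Fin n)⟩

section aff

variable {E : Type} [NormedAddCommGroup E] [NormedSpace ℝ E] {K : Set E} [Cvx K]
variable {E' : Type} [NormedAddCommGroup E'] [NormedSpace ℝ E'] {K' : Set E'} [Cvx K']

/-- the affine map with given vertices -/
def aff {n : ℕ} (w : Fin n → K) : C(Sx n, K) where
  toFun t := ⟨∑ i, t.1 i • (w i : E),
    Cvx.out.sum_mem (fun i _ => t.2.1 i) t.2.2 (fun i _ => (w i).2)⟩
  continuous_toFun := by
    refine Continuous.subtype_mk ?_ _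
    refine continuous_finsetSum _ fun i _ => ?_
    exact ((continuous_apply i).comp continuous_subtype_val).smul continuous_const

lemma aff_coe {n : ℕ} (w : Fin n → K) (t : Sx n) : (aff w t : E) = ∑ i, t.1 i • (w i : E) := rfl

/-- vertices -/
def vtx (n : ℕ) : Fin n → Sx n := fun i => ⟨Pi.single i 1, single_mem_stdSimplex ℝ i⟩

lemma aff_vtx {n : ℕ} (w : Fin n → K) (i : Fin n) : aff w (vtx n i) = w i := by
  apply Subtype.ext
  rw [aff_coe]
  simp [vtx, Pi.single_apply]

lemma aff_comp_vtx {n : ℕ} (w : Fin n → K) : aff w ∘ vtx n = w := funext (aff_vtx w)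

lemma aff_id (n : ℕ) : aff (vtx n) = ContinuousMap.id _ := by
  ext1 t
  apply Subtype.ext
  rw [aff_coe]
  ext j
  simp [vtx, Pi.single_apply, Finset.sum_apply]

/-- affine maps between convex sets -/
def IsAff (a : K → K') : Prop := ∀ (n : ℕ) (w : Fin n → K) (t : Sx n), a (aff w t) = aff (a ∘ w) t

lemma isAff_aff {n : ℕ} (w : Fin n → K) : IsAff (aff w) := by
  intro m v t
  apply Subtype.ext
  rw [aff_coe, aff_coe]
  simp only [aff_coe, Finset.sum_apply, Pi.smul_apply, Function.comp_apply, Finset.smul_sum,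
    Finset.sum_smul, smul_eq_mul]
  rw [Finset.sum_comm]
  simp only [mul_smul]

/-- barycenter of a tuple -/
def bary (n : ℕ) (w : Fin (n+1) → K) : K := aff w (stdSimplex.barycenter)

lemma bary_aff {a : K → K'} (ha : IsAff a) (n : ℕ) (w : Fin (n+1) → K) :
    a (bary n w) = bary n (a ∘ w) := ha _ _ _

end aff

/-- singular chains with `n` vertices -/
abbrev Chain (X : Type) [TopologicalSpace X] (n : ℕ) := C(Sx n, X) →₀ ℚ

variable {X Y Z : Type} [TopologicalSpace X] [TopologicalSpace Y] [TopologicalSpace Z]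

/-- the `i`-th face inclusion -/
def fc (n : ℕ) (i : Fin (n+1)) : C(Sx n, Sx (n+1)) := aff (vtx (n+1) ∘ i.succAbove)

/-- singular boundary -/
def bd (X : Type) [TopologicalSpace X] (n : ℕ) : Chain X (n+1) →ₗ[ℚ] Chain X n :=
  lift (fun σ => ∑ i : Fin (n+1), (-1 : ℚ)^(i:ℕ) • gen (σ.comp (fc n i)))

/-- functoriality of chains -/
def cmap (f : C(X, Y)) (n : ℕ) : Chain X n →ₗ[ℚ] Chain Y n :=
  lift (fun σ => gen (f.comp σ))

lemma cmap_gen (f : C(X, Y)) (n : ℕ) (σ : C(Sx n, X)) : cmap f n (gen σ) = gen (f.comp σ) := by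
  simp [cmap, gen]

lemma cmap_bd (f : C(X, Y)) (n : ℕ) (c : Chain X (n+1)) :
    cmap f n (bd X n c) = bd Y n (cmap f (n+1) c) := by
  have := hom_ext2 (f := cmap f n ∘ₗ bd X n) (g := bd Y n ∘ₗ cmap f (n+1))
    (fun s => by
      simp only [cmap, bd, gen, LinearMap.comp_apply, lift_single, map_sum, map_smul,
        ContinuousMap.comp_assoc]) c
  simpa using this

lemma cmap_id (n : ℕ) (c : Chain X n) : cmap (ContinuousMap.id X) n c = c := by
  have := hom_ext2 (f := cmap (ContinuousMap.id X) n) (g := LinearMap.id)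
    (fun s => by simp [cmap, gen]) c
  simpa using this

lemma cmap_comp (g : C(Y, Z)) (f : C(X, Y)) (n : ℕ) (c : Chain X n) :
    cmap g n (cmap f n c) = cmap (g.comp f) n c := by
  have := hom_ext2 (f := cmap g n ∘ₗ cmap f n) (g := cmap (g.comp f) n)
    (fun s => by simp [cmap, gen, ContinuousMap.comp_assoc]) c
  simpa using this

section real

variable {E : Type} [NormedAddCommGroup E] [NormedSpace ℝ E] {K : Set E} [Cvx K]
variable {E' : Type} [NormedAddCommGroup E'] [NormedSpace ℝ E'] {K' : Set E'} [Cvx K']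

/-- realization of affine chains along a map on the convex set -/
def real (φ : C(K, X)) (n : ℕ) : AC K n →ₗ[ℚ] Chain X n :=
  lift (fun w => gen (φ.comp (aff w)))

lemma real_gen (φ : C(K, X)) (n : ℕ) (w : Fin n → K) : real φ n (gen w) = gen (φ.comp (aff w)) := by
  simp [real, gen]

lemma aff_face {n : ℕ} (w : Fin (n+1) → K) (i : Fin (n+1)) :
    (aff w).comp (fc n i) = aff (w ∘ i.succAbove) := by
  ext1 t
  rw [ContinuousMap.comp_apply, fc, isAff_aff w, ← Function.comp_assoc, aff_comp_vtx]

lemma real_abd (φ : C(K, X)) (n : ℕ) (c : AC K (n+1)) :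
    real φ n (abd n c) = bd X n (real φ (n+1) c) := by
  have := hom_ext2 (f := real φ n ∘ₗ abd n) (g := bd X n ∘ₗ real φ (n+1))
    (fun s => by
      simp only [real, bd, abd, gen, LinearMap.comp_apply, lift_single, map_sum, map_smul,
        ContinuousMap.comp_assoc, aff_face]) c
  simpa using this

lemma real_push (φ : C(K', X)) (a : C(K, K')) (ha : IsAff a) (n : ℕ) (c : AC K n) :
    real φ n (push a n c) = real (φ.comp a) n c := by
  have := hom_ext2 (f := real φ n ∘ₗ push a n) (g := real (φ.comp a) n)
    (fun s => by
      have : aff (a ∘ s) = a.comp (aff s) := by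
        ext1 t
        exact (ha _ _ _).symm
      simp only [real, push, gen, LinearMap.comp_apply, lift_single, ContinuousMap.comp_assoc, this]) c
  simpa using this

lemma cmap_real (f : C(X, Y)) (φ : C(K, X)) (n : ℕ) (c : AC K n) :
    cmap f n (real φ n c) = real (f.comp φ) n c := by
  have := hom_ext2 (f := cmap f n ∘ₗ real φ n) (g := real (f.comp φ) n)
    (fun s => by
      simp [real, cmap, gen, ContinuousMap.comp_assoc]) c
  simpa using this

lemma gen_eq_real {n : ℕ} (σ : C(Sx n, X)) : gen σ = real σ n (gen (vtx n)) := by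
  rw [real_gen, aff_id, ContinuousMap.comp_id]

end real

lemma bd_bd (n : ℕ) (c : Chain X (n+2)) : bd X n (bd X (n+1) c) = 0 := by
  have := hom_ext2 (f := bd X n ∘ₗ bd X (n+1)) (g := 0)
    (fun s => by
      change bd X n (bd X (n+1) (gen s)) = 0
      rw [gen_eq_real, ← real_abd, ← real_abd, abd_abd, map_zero]) c
  simpa using this

/-! operators from universal elements -/

/-- operator on singular chains from universal affine chains -/
def opr (X : Type) [TopologicalSpace X] {n m : ℕ} (θ : AC (Sx n) m) : Chain X n →ₗ[ℚ] Chain X m :=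
  lift (fun σ => real σ m θ)

lemma opr_gen {n m : ℕ} (θ : AC (Sx n) m) (σ : C(Sx n, X)) : opr X θ (gen σ) = real σ m θ := by
  simp [opr, gen]

lemma cmap_opr (f : C(X, Y)) {n m : ℕ} (θ : AC (Sx n) m) (c : Chain X n) :
    cmap f m (opr X θ c) = opr Y θ (cmap f n c) := by
  have := hom_ext2 (f := cmap f m ∘ₗ opr X θ) (g := opr Y θ ∘ₗ cmap f n)
    (fun s => by
      change cmap f m (opr X θ (gen s)) = opr Y θ (cmap f n (gen s))
      rw [opr_gen, cmap_real, cmap_gen, opr_gen]) c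
  simpa using this

/-- affine-level subdivision -/
abbrev asd {E : Type} [NormedAddCommGroup E] [NormedSpace ℝ E] (K : Set E) [Cvx K] (n : ℕ) :
    AC K n →ₗ[ℚ] AC K n := subdiv (fun n => bary n) n

/-- affine-level homotopy -/
abbrev ath {E : Type} [NormedAddCommGroup E] [NormedSpace ℝ E] (K : Set E) [Cvx K] (n : ℕ) :
    AC K n →ₗ[ℚ] AC K (n+1) := thom (fun _ => LinearMap.id) (fun n => asd K n) (fun n => bary n) n

/-- singular subdivision -/
def sd (X : Type) [TopologicalSpace X] (n : ℕ) : Chain X n →ₗ[ℚ] Chain X n :=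
  opr X (asd (Sx n) n (gen (vtx n)))

/-- singular homotopy from the identity to subdivision -/
def sh (X : Type) [TopologicalSpace X] (n : ℕ) : Chain X n →ₗ[ℚ] Chain X (n+1) :=
  opr X (ath (Sx n) n (gen (vtx n)))

section real

variable {E : Type} [NormedAddCommGroup E] [NormedSpace ℝ E] {K : Set E} [Cvx K]

lemma sd_real (φ : C(K, X)) (n : ℕ) (c : AC K n) : sd X n (real φ n c) = real φ n (asd K n c) := by
  have := hom_ext2 (f := sd X n ∘ₗ real φ n) (g := real φ n ∘ₗ asd K n)
    (fun s => by
      change sd X n (real φ n (gen s)) = real φ n (asd K n (gen s))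
      rw [real_gen, sd, opr_gen, ← real_push _ _ (isAff_aff s),
        subdiv_push _ (fun n => bary n) _ (bary_aff (isAff_aff s)), push_gen, aff_comp_vtx]) c
  simpa using this

lemma sh_real (φ : C(K, X)) (n : ℕ) (c : AC K n) : sh X n (real φ n c) = real φ (n+1) (ath K n c) := by
  have := hom_ext2 (f := sh X n ∘ₗ real φ n) (g := real φ (n+1) ∘ₗ ath K n)
    (fun s => by
      change sh X n (real φ n (gen s)) = real φ (n+1) (ath K n (gen s))
      rw [real_gen, sh, opr_gen, ← real_push _ _ (isAff_aff s),
        thom_push (β' := fun n => bary n) (F' := fun _ => LinearMap.id) (G' := fun n => asd K n)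
          (a := aff s) (hβ := bary_aff (isAff_aff s)), push_gen, aff_comp_vtx]
      · intro n c; rfl
      · intro n c
        exact subdiv_push _ (fun n => bary n) _ (bary_aff (isAff_aff s)) _ _) c
  simpa using this

end real

lemma sd_bd (n : ℕ) (c : Chain X (n+1)) : sd X n (bd X n c) = bd X n (sd X (n+1) c) := by
  have := hom_ext2 (f := sd X n ∘ₗ bd X n) (g := bd X n ∘ₗ sd X (n+1))
    (fun s => by
      change sd X n (bd X n (gen s)) = bd X n (sd X (n+1) (gen s))
      rw [gen_eq_real, ← real_abd, sd_real, sd_real, ← real_abd, subdiv_abd]) c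
  simpa using this

lemma sh_zero : sh X 0 = 0 := by
  apply hom_ext1
  intro s
  change sh X 0 (gen s) = 0
  rw [gen_eq_real, sh_real, ath, thom_spec0]
  simp

lemma sh_spec (n : ℕ) (c : Chain X (n+1)) :
    bd X (n+1) (sh X (n+1) c) = c - sd X (n+1) c - sh X n (bd X n c) := by
  have := hom_ext2 (f := bd X (n+1) ∘ₗ sh X (n+1))
    (g := LinearMap.id - sd X (n+1) - sh X n ∘ₗ bd X n)
    (fun s => by
      change bd X (n+1) (sh X (n+1) (gen s)) = gen s - sd X (n+1) (gen s) - sh X n (bd X n (gen s))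
      rw [gen_eq_real, sh_real, sd_real, ← real_abd, ← real_abd, sh_real, thom_spec]
      · simp
      · intro n c; rfl
      · intro n c; exact subdiv_abd _ _ _
      · rfl) c
  simpa using this

lemma cmap_sd (f : C(X, Y)) (n : ℕ) (c : Chain X n) : cmap f n (sd X n c) = sd Y n (cmap f n c) :=
  cmap_opr f _ c

lemma cmap_sh (f : C(X, Y)) (n : ℕ) (c : Chain X n) :
    cmap f (n+1) (sh X n c) = sh Y n (cmap f n c) :=
  cmap_opr f _ c

/-! homotopy invariance -/

/-- the prism -/
abbrev Pz (n : ℕ) : Set ((Fin n → ℝ) × ℝ) := Sx n ×ˢ Set.Icc (0:ℝ) 1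

instance (n : ℕ) : Cvx (Pz n) := ⟨(convex_stdSimplex ℝ (Fin n)).prod (convex_Icc 0 1)⟩

/-- slices of the prism -/
def slc (n : ℕ) (s : Set.Icc (0:ℝ) 1) : C(Sx n, Pz n) where
  toFun t := ⟨(t.1, s.1), ⟨t.2, s.2⟩⟩
  continuous_toFun := by fun_prop

lemma isAff_slc (n : ℕ) (s : Set.Icc (0:ℝ) 1) : IsAff (slc n s) := by
  intro m w t
  apply Subtype.ext
  apply Prod.ext
  · rw [aff_coe]
    simp [slc, aff_coe, Prod.fst_sum]
  · rw [aff_coe]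
    simp only [slc, ContinuousMap.coe_mk, Function.comp_apply, Prod.snd_sum, Prod.smul_snd]
    rw [← Finset.sum_smul, t.2.2, one_smul]

/-- projection of the prism -/
def pj (n : ℕ) : C(Pz n, Sx n) where
  toFun t := ⟨t.1.1, (Set.mem_prod.1 t.2).1⟩
  continuous_toFun := by fun_prop

lemma isAff_pj (n : ℕ) : IsAff (pj n) := by
  intro m w t
  apply Subtype.ext
  rw [aff_coe]
  simp [pj, aff_coe, Prod.fst_sum]

/-- face inclusions of prisms -/
def pfc (n : ℕ) (i : Fin (n+1)) : C(Pz n, Pz (n+1)) where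
  toFun t := ⟨((fc n i (pj n t)).1, t.1.2), ⟨(fc n i (pj n t)).2, (Set.mem_prod.1 t.2).2⟩⟩
  continuous_toFun := by
    refine Continuous.subtype_mk ?_ _
    refine Continuous.prodMk ?_ (by fun_prop)
    exact continuous_subtype_val.comp ((fc n i).continuous.comp (pj n).continuous)

lemma pfc_slc (n : ℕ) (i : Fin (n+1)) (s : Set.Icc (0:ℝ) 1) :
    (pfc n i).comp (slc n s) = (slc (n+1) s).comp (fc n i) := rfl

lemma isAff_pfc (n : ℕ) (i : Fin (n+1)) : IsAff (pfc n i) := by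
  intro m w t
  apply Subtype.ext
  apply Prod.ext
  · have := isAff_aff (vtx (n+1) ∘ i.succAbove) m (pj n ∘ w) t
    rw [← isAff_pj] at this
    have := congrArg Subtype.val this
    rw [aff_coe (K := Sx (n+1)) (aff (vtx (n+1) ∘ i.succAbove) ∘ pj n ∘ w)] at this
    rw [aff_coe]
    simp only [pfc, ContinuousMap.coe_mk, Function.comp_apply, Prod.fst_sum, Prod.smul_fst]
    exact this
  · rw [aff_coe]
    simp [pfc, aff_coe, Prod.snd_sum]

/-- the affine prism operator -/
abbrev apr (n m : ℕ) : AC (Sx n) m →ₗ[ℚ] AC (Pz n) (m+1) :=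
  thom (fun m => push (slc n ⟨1, by simp⟩) m) (fun m => push (slc n ⟨0, by simp⟩) m)
    (fun m w => slc n ⟨0, by simp⟩ (bary m w)) m

/-- the map on a prism from a homotopy -/
def hmap {f g : C(X, Y)} (h : f.Homotopy g) {n : ℕ} (σ : C(Sx n, X)) : C(Pz n, Y) where
  toFun t := h (⟨t.1.2, t.2.2⟩, σ ⟨t.1.1, t.2.1⟩)
  continuous_toFun := by fun_prop

/-- prism operator -/
def pr {f g : C(X, Y)} (h : f.Homotopy g) (n : ℕ) : Chain X n →ₗ[ℚ] Chain Y (n+1) :=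
  lift (fun σ => real (hmap h σ) (n+1) (apr n n (gen (vtx n))))

lemma pr_zero {f g : C(X, Y)} (h : f.Homotopy g) : pr h 0 = 0 := by
  apply hom_ext1
  intro s
  simp [pr, thom_spec0]

lemma pr_face {f g : C(X, Y)} (h : f.Homotopy g) (n : ℕ) (σ : C(Sx (n+1), X)) (i : Fin (n+1)) :
    pr h n (gen (σ.comp (fc n i))) =
      real (hmap h σ) (n+1) (apr (n+1) n (gen (vtx (n+1) ∘ i.succAbove))) := by
  have e1 : hmap h (σ.comp (fc n i)) = (hmap h σ).comp (pfc n i) := rfl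
  have e2 : (fc n i) ∘ vtx n = vtx (n+1) ∘ i.succAbove := aff_comp_vtx _
  simp only [pr, gen, lift_single]
  rw [e1, ← real_push _ _ (isAff_pfc n i), ← e2]
  congr 1
  rw [thom_push (a := fc n i) (a' := pfc n i)]
  · rw [push_gen]
  · intro m c
    rw [push_push, push_push]; rfl
  · intro m c
    rw [push_push, push_push]; rfl
  · intro m w
    have := bary_aff (isAff_aff (vtx (n+1) ∘ i.succAbove)) m w
    change slc (n+1) ⟨0, by simp⟩ (fc n i (bary m w)) = _
    congr 1

lemma pr_spec {f g : C(X, Y)} (h : f.Homotopy g) (n : ℕ) (c : Chain X (n+1)) :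
    bd Y (n+1) (pr h (n+1) c) = cmap g (n+1) c - cmap f (n+1) c - pr h n (bd X n c) := by
  have := hom_ext2 (f := bd Y (n+1) ∘ₗ pr h (n+1))
    (g := cmap g (n+1) - cmap f (n+1) - pr h n ∘ₗ bd X n)
    (fun s => by
      change bd Y (n+1) (pr h (n+1) (gen s)) =
        cmap g (n+1) (gen s) - cmap f (n+1) (gen s) - pr h n (bd X n (gen s))
      have e : pr h n (bd X n (gen s)) =
          real (hmap h s) (n+1) (apr (n+1) n (abd n (gen (vtx (n+1))))) := by
        simp only [bd, abd, gen, lift_single, map_sum, map_smul]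
        refine Finset.sum_congr rfl fun i _ => ?_
        congr 1
        exact pr_face h n s i
      rw [e]
      have e1 : pr h (n+1) (gen s) = real (hmap h s) (n+2) (apr (n+1) (n+1) (gen (vtx (n+1)))) := by
        simp [pr, gen]
      rw [e1, ← real_abd, thom_spec]
      · simp only [map_sub]
        rw [real_push _ _ (isAff_slc _ _), real_push _ _ (isAff_slc _ _), ← gen_eq_real,
          ← gen_eq_real, cmap_gen, cmap_gen]
        have h1 : (hmap h s).comp (slc (n+1) ⟨1, by simp⟩) = g.comp s := by
          ext t
          exact h.apply_one _
        have h0 : (hmap h s).comp (slc (n+1) ⟨0, by simp⟩) = f.comp s := by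
          ext t
          exact h.apply_zero _
        rw [h1, h0]
      · intro n c; exact push_abd _ _ _
      · intro n c; exact push_abd _ _ _
      · apply hom_ext1
        intro s
        change push _ _ (gen s) = push _ _ (gen s)
        rw [push_gen, push_gen]
        congr 1
        exact Subsingleton.elim _ _) c
  simpa using this

end

end ArrTop

/-! ### Small simplices -/

namespace ArrTop

noncomputable section

lemma supp_lift {S T : Type} (A : Set S) (B : Set T) (f : S → (T →₀ ℚ))
    (h : ∀ s ∈ A, f s ∈ Finsupp.supported ℚ ℚ B) (c : S →₀ ℚ) (hc : c ∈ Finsupp.supported ℚ ℚ A) :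
    lift f c ∈ Finsupp.supported ℚ ℚ B := by
  rw [Finsupp.mem_supported] at hc
  simp only [lift, Finsupp.linearCombination_apply, Finsupp.sum]
  exact Submodule.sum_mem _ fun s hs => Submodule.smul_mem _ _ (h s (hc hs))

lemma supp_map {S T : Type} (A : Set S) (B : Set T) (f : (S →₀ ℚ) →ₗ[ℚ] (T →₀ ℚ))
    (h : ∀ s ∈ A, f (gen s) ∈ Finsupp.supported ℚ ℚ B) (c : S →₀ ℚ)
    (hc : c ∈ Finsupp.supported ℚ ℚ A) :
    f c ∈ Finsupp.supported ℚ ℚ B := by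
  have : f c = lift (fun s => f (gen s)) c := hom_ext2 (fun s => by simp [gen]) c
  rw [this]
  exact supp_lift A B _ h c hc

section mesh

variable {E : Type} [NormedAddCommGroup E] [NormedSpace ℝ E] {K : Set E} [Cvx K]

lemma dist_bary (n : ℕ) (w : Fin (n+1) → K) (D : ℝ) (hD : ∀ i j, dist (w i) (w j) ≤ D)
    (x : E) (hx : x ∈ convexHull ℝ (Set.range fun i => (w i : E))) :
    dist (bary n w : E) x ≤ (n / (n+1) : ℝ) * D := by
  have hsub : convexHull ℝ (Set.range fun i => (w i : E)) ⊆
      Metric.closedBall (bary n w : E) ((n / (n+1) : ℝ) * D) := by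
    apply convexHull_min _ (convex_closedBall _ _)
    rintro _ ⟨j, rfl⟩
    rw [Metric.mem_closedBall, dist_comm]
    have hb : (bary n w : E) = ∑ i, ((n+1:ℝ)⁻¹) • (w i : E) := by
      rw [bary, aff_coe]
      refine Finset.sum_congr rfl fun i _ => ?_
      congr 1
      have := stdSimplex.barycenter_apply (𝕜 := ℝ) (X := Fin (n+1)) i
      rw [Fintype.card_fin] at this
      push_cast at this
      exact this
    have hn : (n+1:ℝ) ≠ 0 := by positivity
    have hj : (w j : E) = ∑ i : Fin (n+1), ((n+1:ℝ)⁻¹) • (w j : E) := by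
      rw [Finset.sum_const, Finset.card_univ, Fintype.card_fin, ← Nat.cast_smul_eq_nsmul ℝ, smul_smul]
      push_cast
      rw [mul_inv_cancel₀ hn, one_smul]
    rw [dist_eq_norm, hb]
    change ‖∑ i, ((n+1:ℝ)⁻¹) • (w i : E) - (w j : E)‖ ≤ _
    nth_rewrite 1 [hj]
    rw [← Finset.sum_sub_distrib]
    have : ∀ i, ‖((n+1:ℝ)⁻¹) • (w i : E) - ((n+1:ℝ)⁻¹) • (w j : E)‖ ≤
        if i = j then 0 else ((n+1:ℝ)⁻¹) * D := by
      intro i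
      split_ifs with h
      · simp [h]
      · rw [← smul_sub, norm_smul, Real.norm_of_nonneg (by positivity)]
        have := hD i j
        rw [Subtype.dist_eq, dist_eq_norm] at this
        gcongr
    refine (norm_sum_le _ _).trans ((Finset.sum_le_sum fun i _ => this i).trans ?_)
    rw [Finset.sum_ite]
    simp only [Finset.sum_const_zero, zero_add, Finset.sum_const, nsmul_eq_mul]
    rw [Finset.filter_ne', Finset.card_erase_of_mem (Finset.mem_univ _), Finset.card_univ,
      Fintype.card_fin]
    simp only [Nat.add_sub_cancel]
    apply le_of_eq
    field_simp
  have := hsub hx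
  rwa [Metric.mem_closedBall, dist_comm] at this

lemma asd_mesh (N : ℕ) (n : ℕ) (hn : n ≤ N+1) (w : Fin n → K) (D : ℝ)
    (hD : ∀ i j, dist (w i) (w j) ≤ D) :
    asd K n (gen w) ∈ Finsupp.supported ℚ ℚ {v : Fin n → K |
      (∀ i, (v i : E) ∈ convexHull ℝ (Set.range fun i => (w i : E))) ∧
      ∀ i j, dist (v i) (v j) ≤ (N / (N+1) : ℝ) * D} := by
  induction n with
  | zero =>
    apply Finsupp.single_mem_supported
    exact ⟨fun i => i.elim0, fun i => i.elim0⟩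
  | succ n ih =>
    have hD0 : 0 ≤ D := le_trans dist_nonneg (hD 0 0)
    rw [asd, subdiv_gen]
    apply supp_lift {v : Fin n → K |
      (∀ i, (v i : E) ∈ convexHull ℝ (Set.range fun i => (w i : E))) ∧
      ∀ i j, dist (v i) (v j) ≤ (N / (N+1) : ℝ) * D}
    · rintro v ⟨hv1, hv2⟩
      apply Finsupp.single_mem_supported
      have hb : ∀ x ∈ convexHull ℝ (Set.range fun i => (w i : E)),
          dist (bary n w : E) x ≤ (N / (N+1) : ℝ) * D := by
        intro x hx
        refine (dist_bary n w D hD x hx).trans ?_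
        have : (n:ℝ) ≤ N := by exact_mod_cast (by omega : n ≤ N)
        have : (n / (n+1) : ℝ) ≤ N / (N+1) := by
          rw [div_le_div_iff₀ (by positivity) (by positivity)]
          nlinarith
        gcongr
      constructor
      · intro i
        refine Fin.cases ?_ (fun i => ?_) i
        · rw [Fin.cons_zero, bary, aff_coe]
          exact (convex_convexHull ℝ _).sum_mem (fun i _ => (stdSimplex.barycenter).2.1 i)
            (stdSimplex.barycenter).2.2 (fun i _ => subset_convexHull ℝ _ ⟨i, rfl⟩)
        · rw [Fin.cons_succ]
          exact hv1 i
      · intro i j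
        refine Fin.cases ?_ (fun i => ?_) i
        · refine Fin.cases ?_ (fun j => ?_) j
          · simp only [dist_self]
            positivity
          · rw [Fin.cons_succ, Fin.cons_zero]
            exact hb _ (hv1 j)
        · refine Fin.cases ?_ (fun j => ?_) j
          · rw [Fin.cons_succ, Fin.cons_zero, dist_comm]
            exact hb _ (hv1 i)
          · rw [Fin.cons_succ, Fin.cons_succ]
            exact hv2 i j
    · simp only [abd, lift_single, gen, map_sum, map_smul]
      refine Submodule.sum_mem _ fun i _ => Submodule.smul_mem _ _ ?_
      refine Finsupp.supported_mono ?_ (ih (by omega) (w ∘ i.succAbove) (fun a b => hD _ _))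
      rintro v ⟨hv1, hv2⟩
      refine ⟨fun j => convexHull_mono ?_ (hv1 j), hv2⟩
      rintro _ ⟨k, rfl⟩
      exact ⟨_, rfl⟩

lemma asd_iter_mesh (n : ℕ) (w : Fin (n+1) → K) (D : ℝ)
    (hD : ∀ i j, dist (w i) (w j) ≤ D) (m : ℕ) :
    ((asd K (n+1))^m) (gen w) ∈ Finsupp.supported ℚ ℚ {v : Fin (n+1) → K |
      ∀ i j, dist (v i) (v j) ≤ (n / (n+1) : ℝ)^m * D} := by
  induction m with
  | zero =>
    apply Finsupp.single_mem_supported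
    simpa using hD
  | succ m ih =>
    rw [pow_succ' (asd K (n+1)), Module.End.mul_apply]
    refine supp_map _ _ _ ?_ _ ih
    intro v hv
    refine Finsupp.supported_mono ?_ (asd_mesh n (n+1) le_rfl v _ hv)
    rintro u ⟨-, hu⟩ i j
    refine (hu i j).trans (le_of_eq ?_)
    ring

lemma aff_dist (n : ℕ) (w : Fin (n+1) → K) (D : ℝ) (hD : ∀ i j, dist (w i) (w j) ≤ D) (t : Sx (n+1)) :
    dist (aff w t) (w 0) ≤ D := by
  have : (aff w t : E) ∈ Metric.closedBall (w 0 : E) D := by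
    rw [aff_coe]
    exact (convex_closedBall _ _).sum_mem (fun i _ => t.2.1 i) t.2.2 (fun i _ => hD i 0)
  exact this

end mesh

variable {X Y : Type} [TopologicalSpace X] [TopologicalSpace Y]

/-- chains supported in a subset -/
def Ch (P : Set X) (n : ℕ) : Submodule ℚ (Chain X n) := Finsupp.supported ℚ ℚ {σ | ∀ t, σ t ∈ P}

lemma real_mem {E : Type} [NormedAddCommGroup E] [NormedSpace ℝ E] {K : Set E} [Cvx K]
    (P : Set X) (φ : C(K, X)) (h : ∀ t, φ t ∈ P) (n : ℕ) (c : AC K n) : real φ n c ∈ Ch P n := by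
  refine supp_lift Set.univ _ _ ?_ _ (by simp)
  intro w _
  apply Finsupp.single_mem_supported
  intro t
  exact h _

lemma opr_mem (P : Set X) {n m : ℕ} (θ : AC (Sx n) m) (c : Chain X n) (hc : c ∈ Ch P n) :
    opr X θ c ∈ Ch P m := by
  refine supp_lift _ _ _ ?_ _ hc
  intro σ hσ
  exact real_mem P σ hσ _ _

lemma sd_mem (P : Set X) (n : ℕ) (c : Chain X n) (hc : c ∈ Ch P n) : sd X n c ∈ Ch P n :=
  opr_mem P _ c hc

lemma sd_pow_mem (P : Set X) (n : ℕ) (c : Chain X n) (hc : c ∈ Ch P n) (m : ℕ) :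
    (sd X n ^ m) c ∈ Ch P n := by
  induction m with
  | zero => simpa using hc
  | succ m ih =>
    rw [pow_succ', Module.End.mul_apply]
    exact sd_mem P n _ ih

lemma sh_mem (P : Set X) (n : ℕ) (c : Chain X n) (hc : c ∈ Ch P n) : sh X n c ∈ Ch P (n+1) :=
  opr_mem P _ c hc

lemma bd_mem (P : Set X) (n : ℕ) (c : Chain X (n+1)) (hc : c ∈ Ch P (n+1)) : bd X n c ∈ Ch P n := by
  refine supp_lift _ _ _ ?_ _ hc
  intro σ hσ
  refine Submodule.sum_mem _ fun i _ => Submodule.smul_mem _ _ ?_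
  apply Finsupp.single_mem_supported
  intro t
  exact hσ _

lemma small_simplex (P Q : Set X) (hP : IsOpen P) (hQ : IsOpen Q) (hPQ : P ∪ Q = Set.univ)
    (n : ℕ) (σ : C(Sx (n+1), X)) : ∃ m0 : ℕ, ∀ m ≥ m0, (sd X (n+1) ^ m) (gen σ) ∈ Ch P (n+1) ⊔ Ch Q (n+1) := by
  obtain ⟨δ, hδ, hL⟩ := lebesgue_number_lemma_of_metric (s := (Set.univ : Set (Sx (n+1))))
    (c := fun b : Bool => if b then σ ⁻¹' P else σ ⁻¹' Q) isCompact_univ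
    (by
      intro b
      cases b
      · simpa using hQ.preimage σ.continuous
      · simpa using hP.preimage σ.continuous)
    (by
      intro x _
      have : σ x ∈ P ∪ Q := by rw [hPQ]; trivial
      rw [Set.mem_iUnion]
      rcases this with h | h
      · exact ⟨true, by simpa using h⟩
      · exact ⟨false, by simpa using h⟩)
  obtain ⟨D, hD⟩ : ∃ D : ℝ, ∀ i j, dist (vtx (n+1) i) (vtx (n+1) j) ≤ D := by
    refine ⟨∑ i, ∑ j, dist (vtx (n+1) i) (vtx (n+1) j), fun i j => ?_⟩
    refine le_trans ?_ (Finset.single_le_sum (f := fun i => ∑ j, dist (vtx (n+1) i) (vtx (n+1) j))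
      (fun i _ => Finset.sum_nonneg fun j _ => dist_nonneg) (Finset.mem_univ i))
    exact Finset.single_le_sum (f := fun j => dist (vtx (n+1) i) (vtx (n+1) j))
      (fun i _ => dist_nonneg) (Finset.mem_univ j)
  have hlim : Filter.Tendsto (fun m : ℕ => (n / (n+1) : ℝ)^m * D) Filter.atTop (nhds (0 * D)) := by
    refine Filter.Tendsto.mul_const _ (tendsto_pow_atTop_nhds_zero_of_lt_one (by positivity) ?_)
    rw [div_lt_one (by positivity)]
    linarith
  rw [zero_mul] at hlim
  obtain ⟨m0, hm0⟩ := Filter.eventually_atTop.1 (hlim.eventually (gt_mem_nhds hδ))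
  refine ⟨m0, fun m hm => ?_⟩
  have e : ∀ m, (sd X (n+1) ^ m) (gen σ) = real σ (n+1) ((asd (Sx (n+1)) (n+1) ^ m) (gen (vtx (n+1)))) := by
    intro m
    induction m with
    | zero => simpa using gen_eq_real σ
    | succ m ih =>
      rw [pow_succ', Module.End.mul_apply, ih, sd_real, pow_succ', Module.End.mul_apply]
  rw [e, Ch, Ch, ← Finsupp.supported_union]
  refine supp_lift _ _ _ ?_ _ (asd_iter_mesh n (vtx (n+1)) D hD m)
  intro w hw
  apply Finsupp.single_mem_supported
  obtain ⟨b, hb⟩ := hL (w 0) trivial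
  have hw' : ∀ t, aff w t ∈ Metric.ball (w 0) δ := fun t =>
    lt_of_le_of_lt (aff_dist n w _ hw t) (hm0 m hm)
  cases b
  · right
    intro t
    have := hb (hw' t)
    simpa using this
  · left
    intro t
    have := hb (hw' t)
    simpa using this

lemma small_chain (P Q : Set X) (hP : IsOpen P) (hQ : IsOpen Q) (hPQ : P ∪ Q = Set.univ)
    (n : ℕ) (c : Chain X (n+1)) : ∃ m0 : ℕ, ∀ m ≥ m0, (sd X (n+1) ^ m) c ∈ Ch P (n+1) ⊔ Ch Q (n+1) := by
  induction c using Finsupp.induction_linear with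
  | zero => exact ⟨0, fun m _ => by simp⟩
  | add f g hf hg =>
    obtain ⟨a, ha⟩ := hf
    obtain ⟨b, hb⟩ := hg
    refine ⟨max a b, fun m hm => ?_⟩
    rw [map_add]
    exact Submodule.add_mem _ (ha m (le_trans (le_max_left _ _) hm))
      (hb m (le_trans (le_max_right _ _) hm))
  | single σ q =>
    obtain ⟨a, ha⟩ := small_simplex P Q hP hQ hPQ n σ
    refine ⟨a, fun m hm => ?_⟩
    have : Finsupp.single σ q = q • gen σ := by simp [gen]
    rw [this, map_smul]
    exact Submodule.smul_mem _ _ (ha m hm)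

/-- iterated homotopy -/
def shm (X : Type) [TopologicalSpace X] (n : ℕ) : ℕ → (Chain X n →ₗ[ℚ] Chain X (n+1))
  | 0 => 0
  | m+1 => shm X n m + sh X n ∘ₗ (sd X n ^ m)

lemma sd_pow_bd (n m : ℕ) (c : Chain X (n+1)) :
    (sd X n ^ m) (bd X n c) = bd X n ((sd X (n+1) ^ m) c) := by
  induction m with
  | zero => simp
  | succ m ih => rw [pow_succ', Module.End.mul_apply, ih, sd_bd, pow_succ', Module.End.mul_apply]

lemma shm_spec (n m : ℕ) (c : Chain X (n+1)) :
    bd X (n+1) (shm X (n+1) m c) = c - (sd X (n+1) ^ m) c - shm X n m (bd X n c) := by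
  induction m with
  | zero => simp [shm]
  | succ m ih =>
    simp only [shm, LinearMap.add_apply, LinearMap.comp_apply, map_add]
    rw [ih, sh_spec, sd_pow_bd, pow_succ', Module.End.mul_apply]
    abel

lemma shm_zero (m : ℕ) : shm X 0 m = 0 := by
  induction m with
  | zero => rfl
  | succ m ih => simp [shm, ih, sh_zero]

lemma shm_mem (P : Set X) (n m : ℕ) (c : Chain X n) (hc : c ∈ Ch P n) : shm X n m c ∈ Ch P (n+1) := by
  induction m with
  | zero => simp [shm]
  | succ m ih => exact Submodule.add_mem _ ih (sh_mem P n _ (sd_pow_mem P n c hc m))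

end

end ArrTop

/-! ### Homology and the Mayer-Vietoris sequence -/

namespace ArrTop

noncomputable section

variable {X Y Z : Type} [TopologicalSpace X] [TopologicalSpace Y] [TopologicalSpace Z]

/-- unreduced boundary -/
def dd (X : Type) [TopologicalSpace X] : (k : ℕ) → (Chain X (k+1) →ₗ[ℚ] Chain X k)
  | 0 => 0
  | k+1 => bd X (k+1)

lemma dd_zero (c : Chain X 1) : dd X 0 c = 0 := rfl

lemma dd_bd (k : ℕ) (c : Chain X (k+1+1)) : dd X k (bd X (k+1) c) = 0 := by
  cases k with
  | zero => rfl
  | succ k => exact bd_bd _ _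

lemma cmap_dd (f : C(X, Y)) (k : ℕ) (c : Chain X (k+1)) :
    cmap f k (dd X k c) = dd Y k (cmap f (k+1) c) := by
  cases k with
  | zero => simp [dd]
  | succ k => exact cmap_bd _ _ _

/-- singular homology -/
abbrev H (X : Type) [TopologicalSpace X] (k : ℕ) : Type :=
  LinearMap.ker (dd X k) ⧸ (LinearMap.range (bd X (k+1))).comap (LinearMap.ker (dd X k)).subtype

/-- cycle classes -/
def cls {k : ℕ} (z : Chain X (k+1)) (hz : dd X k z = 0) : H X k := Submodule.Quotient.mk ⟨z, hz⟩

lemma exists_cls {k : ℕ} (x : H X k) : ∃ z hz, x = cls z hz := by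
  obtain ⟨⟨z, hz⟩, rfl⟩ := Submodule.Quotient.mk_surjective _ x
  exact ⟨z, hz, rfl⟩

lemma cls_eq {k : ℕ} {z z' : Chain X (k+1)} (hz : dd X k z = 0) (hz' : dd X k z' = 0)
    (b : Chain X (k+1+1)) (h : bd X (k+1) b = z - z') : cls z hz = cls z' hz' := by
  rw [cls, cls, Submodule.Quotient.eq]
  exact ⟨b, h⟩

lemma cls_eq_iff {k : ℕ} {z z' : Chain X (k+1)} (hz : dd X k z = 0) (hz' : dd X k z' = 0) :
    cls z hz = cls z' hz' ↔ ∃ b, bd X (k+1) b = z - z' := by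
  rw [cls, cls, Submodule.Quotient.eq]
  rfl

lemma cls_eq_zero_iff {k : ℕ} {z : Chain X (k+1)} (hz : dd X k z = 0) :
    cls z hz = 0 ↔ ∃ b, bd X (k+1) b = z := by
  rw [cls, Submodule.Quotient.mk_eq_zero]
  rfl

lemma cls_add {k : ℕ} {z z' : Chain X (k+1)} (hz : dd X k z = 0) (hz' : dd X k z' = 0) :
    cls z hz + cls z' hz' = cls (z + z') (by rw [map_add, hz, hz', add_zero]) := rfl

lemma cls_smul {k : ℕ} {z : Chain X (k+1)} (hz : dd X k z = 0) (a : ℚ) :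
    a • cls z hz = cls (a • z) (by rw [map_smul, hz, smul_zero]) := rfl

lemma cls_congr {k : ℕ} {z z' : Chain X (k+1)} (hz : dd X k z = 0) (h : z = z') :
    cls z hz = cls z' (h ▸ hz) := by subst h; rfl

/-- functoriality of homology -/
def Hm (f : C(X, Y)) (k : ℕ) : H X k →ₗ[ℚ] H Y k :=
  Submodule.mapQ _ _ ((cmap f (k+1)).restrict (p := LinearMap.ker (dd X k))
    (q := LinearMap.ker (dd Y k))
    (fun z hz => by
      rw [LinearMap.mem_ker] at hz ⊢
      rw [← cmap_dd, hz, map_zero])) (by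
    rintro ⟨z, hz⟩ ⟨b, hb⟩
    refine ⟨cmap f (k+1+1) b, ?_⟩
    rw [← cmap_bd, hb]
    rfl)

lemma Hm_cls (f : C(X, Y)) {k : ℕ} (z : Chain X (k+1)) (hz : dd X k z = 0) :
    Hm f k (cls z hz) = cls (cmap f (k+1) z) (by rw [← cmap_dd, hz, map_zero]) := rfl

lemma Hm_id (k : ℕ) (x : H X k) : Hm (ContinuousMap.id X) k x = x := by
  obtain ⟨z, hz, rfl⟩ := exists_cls x
  rw [Hm_cls]
  exact cls_congr _ (cmap_id _ _)

lemma Hm_comp (g : C(Y, Z)) (f : C(X, Y)) (k : ℕ) (x : H X k) :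
    Hm g k (Hm f k x) = Hm (g.comp f) k x := by
  obtain ⟨z, hz, rfl⟩ := exists_cls x
  rw [Hm_cls, Hm_cls, Hm_cls]
  exact cls_congr _ (cmap_comp _ _ _ _)

lemma bd_of_dd {M : Type} [AddCommGroup M] [Module ℚ M] {k : ℕ} (f : Chain X k →ₗ[ℚ] M)
    (h0 : k = 0 → f = 0) (z : Chain X (k+1)) (hz : dd X k z = 0) : f (bd X k z) = 0 := by
  cases k with
  | zero => rw [h0 rfl]; rfl
  | succ k =>
    have : bd X (k+1) z = 0 := hz
    rw [this, map_zero]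

lemma pr_of_dd {f g : C(X, Y)} (h : f.Homotopy g) {k : ℕ} (z : Chain X (k+1)) (hz : dd X k z = 0) :
    bd Y (k+1) (pr h (k+1) z) = cmap g (k+1) z - cmap f (k+1) z := by
  rw [pr_spec, bd_of_dd (pr h k) (fun h => by subst h; exact pr_zero _) z hz, sub_zero]

lemma shm_of_dd (m : ℕ) {k : ℕ} (z : Chain X (k+1)) (hz : dd X k z = 0) :
    bd X (k+1) (shm X (k+1) m z) = z - (sd X (k+1) ^ m) z := by
  rw [shm_spec, bd_of_dd (shm X k m) (fun h => by subst h; exact shm_zero _) z hz, sub_zero]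

lemma Hm_homotopic {f g : C(X, Y)} (h : f.Homotopic g) (k : ℕ) (x : H X k) : Hm f k x = Hm g k x := by
  obtain ⟨h⟩ := h
  obtain ⟨z, hz, rfl⟩ := exists_cls x
  rw [Hm_cls, Hm_cls]
  symm
  exact cls_eq _ _ _ (pr_of_dd h z hz)

/-- homotopy equivalences induce isomorphisms -/
def Hequiv (e : ContinuousMap.HomotopyEquiv X Y) (k : ℕ) : H X k ≃ₗ[ℚ] H Y k :=
  LinearEquiv.ofLinearMap (Hm e.toFun k) (Hm e.invFun k)
    (by
      refine LinearMap.ext fun x => ?_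
      rw [LinearMap.comp_apply, Hm_comp, Hm_homotopic e.right_inv, Hm_id]; rfl)
    (by
      refine LinearMap.ext fun x => ?_
      rw [LinearMap.comp_apply, Hm_comp, Hm_homotopic e.left_inv, Hm_id]; rfl)

lemma Hequiv_apply (e : ContinuousMap.HomotopyEquiv X Y) (k : ℕ) (x : H X k) :
    Hequiv e k x = Hm e.toFun k x := rfl

lemma H_empty [IsEmpty X] (k : ℕ) (x : H X k) : x = 0 := by
  obtain ⟨z, hz, rfl⟩ := exists_cls x
  have : z = 0 := by
    ext σ
    exact (IsEmpty.false (σ (vtx (k+1) 0))).elim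
  subst this
  rfl

/-! homology of a point -/

lemma bd_unit (n : ℕ) (c : Chain Unit (n+1)) (σ : C(Sx n, Unit)) (τ : C(Sx (n+1), Unit)) :
    bd Unit n c σ = (if Even n then 1 else 0) * c τ := by
  have hu : c = (c τ) • gen τ := by
    ext τ'
    have : τ' = τ := by ext
    subst this
    simp [gen]
  have h1 : bd Unit n (gen τ) σ = (if Even n then 1 else 0) := by
    have : bd Unit n (gen τ) = ∑ i : Fin (n+1), (-1 : ℚ)^(i:ℕ) • gen σ := by
      simp only [bd, gen, lift_single]
      refine Finset.sum_congr rfl fun i _ => ?_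
      congr 1
    rw [this, ← Finset.sum_smul, Fin.sum_neg_one_pow]
    simp only [gen, Finsupp.smul_apply, Finsupp.single_eq_same, smul_eq_mul, mul_one]
    rcases Nat.even_or_odd n with h | h
    · simp [h, Nat.even_add_one]
    · simp [Nat.not_even_iff_odd.2 h, Nat.even_add_one]
  rw [hu, map_smul, Finsupp.smul_apply, h1]
  simp [gen, mul_comm]

lemma H_unit_succ (k : ℕ) (x : H Unit (k+1)) : x = 0 := by
  obtain ⟨z, hz, rfl⟩ := exists_cls x
  have hz' : bd Unit (k+1) z = 0 := hz
  rw [cls_eq_zero_iff]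
  let t : ∀ n, C(Sx n, Unit) := fun n => ⟨fun _ => (), continuous_const⟩
  rcases Nat.even_or_odd k with h | h
  · refine ⟨gen (t _) |> fun g => (z (t _)) • g, ?_⟩
    ext σ
    rw [bd_unit _ _ _ (t _)]
    have : σ = t _ := by ext
    rw [this]
    have hk : Even (k+1+1) := by rw [Nat.even_add_one, Nat.even_add_one]; simpa using h
    simp [hk, gen]
  · refine ⟨0, ?_⟩
    rw [map_zero]
    ext σ
    have := bd_unit (k+1) z (t _) σ
    rw [hz'] at this
    have hk : Even (k+1) := by rw [Nat.even_add_one]; exact Nat.not_even_iff_odd.2 h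
    simpa [hk] using this

/-- degree zero homology of a point -/
def H_unit_zero : H Unit 0 ≃ₗ[ℚ] ℚ := by
  let t : ∀ n, C(Sx n, Unit) := fun n => ⟨fun _ => (), continuous_const⟩
  refine LinearEquiv.ofBijective (Submodule.liftQ _ ((Finsupp.lapply (t 1) : Chain Unit 1 →ₗ[ℚ] ℚ) ∘ₗ
    (LinearMap.ker (dd Unit 0)).subtype) ?_) ⟨?_, ?_⟩
  · rintro ⟨z, hz⟩ ⟨b, hb⟩
    have hb : bd Unit 1 b = z := hb
    have := bd_unit 1 b (t 1) (t 2)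
    rw [hb] at this
    simpa using this
  · rw [← LinearMap.ker_eq_bot, Submodule.ker_liftQ_eq_bot']
    apply le_antisymm
    · rintro ⟨z, hz⟩ ⟨b, hb⟩
      have hb : bd Unit 1 b = z := hb
      have := bd_unit 1 b (t 1) (t 2)
      rw [hb] at this
      simpa using this
    · rintro ⟨z, hz⟩ h
      have h : z (t 1) = 0 := h
      refine ⟨0, ?_⟩
      rw [map_zero]
      ext σ
      have : σ = t _ := by ext
      rw [this]
      exact h.symm
  · intro q
    exact ⟨cls (Finsupp.single (t 1) q) rfl, by simp [cls]⟩

/-! chains and embeddings -/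

lemma cmap_inj {f : C(X, Y)} (hf : Function.Injective f) (n : ℕ) : Function.Injective (cmap f n) := by
  have : ⇑(cmap f n) = Finsupp.mapDomain (fun σ => f.comp σ) := by
    ext1 c
    have := hom_ext2 (f := cmap f n) (g := Finsupp.lmapDomain ℚ ℚ (fun σ : C(Sx n, X) => f.comp σ))
      (fun s => by simp [cmap, gen]) c
    exact this
  rw [this]
  apply Finsupp.mapDomain_injective
  intro σ τ h
  ext t
  exact hf (DFunLike.congr_fun h t)

lemma cmap_mem (f : C(X, Y)) (n : ℕ) (c : Chain X n) : cmap f n c ∈ Ch (Set.range f) n := by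
  refine supp_lift Set.univ _ _ ?_ _ (by simp)
  intro σ _
  apply Finsupp.single_mem_supported
  intro t
  exact ⟨_, rfl⟩

lemma cmap_surj {f : C(X, Y)} (hf : Topology.IsEmbedding f) (n : ℕ) (c : Chain Y n)
    (hc : c ∈ Ch (Set.range f) n) : ∃ b, cmap f n b = c := by
  rw [Ch, Finsupp.supported_eq_span_single] at hc
  induction hc using Submodule.span_induction with
  | mem x h =>
    obtain ⟨σ, hσ, rfl⟩ := h
    choose g hg using hσ
    have hgc : Continuous g := by
      rw [hf.continuous_iff]
      have : f ∘ g = σ := funext hg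
      rw [this]
      exact σ.continuous
    refine ⟨gen ⟨g, hgc⟩, ?_⟩
    rw [cmap_gen]
    simp only [gen]
    congr 1
    ext t
    exact hg t
  | zero => exact ⟨0, map_zero _⟩
  | add x y _ _ hx hy =>
    obtain ⟨a, rfl⟩ := hx
    obtain ⟨b, rfl⟩ := hy
    exact ⟨a + b, map_add _ _ _⟩
  | smul q x _ hx =>
    obtain ⟨a, rfl⟩ := hx
    exact ⟨q • a, map_smul _ _ _⟩

lemma cls_sum {P Q R : Type} [TopologicalSpace P] [TopologicalSpace Q]
    [TopologicalSpace R] {jP : C(P, R)} {jQ : C(Q, R)} (k : ℕ) (p : Chain P (k+1)) (q : Chain Q (k+1)) (h1 : dd P (k) p = 0) (h2 : dd Q (k) q = 0)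
  (z : Chain R (k+1)) (h3 : z = cmap jP (k+1) p + cmap jQ (k+1) q) (h4 : dd R (k) z = 0) :
   cls z h4 = Hm jP (k) (cls p h1) + Hm jQ (k) (cls q h2) := by
  subst h3
  rfl

/-- Mayer-Vietoris squares -/
structure MV {W P Q R : Type} [TopologicalSpace W] [TopologicalSpace P] [TopologicalSpace Q]
    [TopologicalSpace R] (iP : C(W, P)) (iQ : C(W, Q)) (jP : C(P, R)) (jQ : C(Q, R)) : Prop where
  comm : jP.comp iP = jQ.comp iQ
  emb : Topology.IsEmbedding iP
  openP : Topology.IsOpenEmbedding jP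
  openQ : Topology.IsOpenEmbedding jQ
  cover : Set.range jP ∪ Set.range jQ = Set.univ
  pull : ∀ p q, jP p = jQ q → ∃ w, iP w = p

section MV

variable {W P Q R : Type} [TopologicalSpace W] [TopologicalSpace P] [TopologicalSpace Q]
    [TopologicalSpace R] {iP : C(W, P)} {iQ : C(W, Q)} {jP : C(P, R)} {jQ : C(Q, R)}

namespace MV


lemma inj_iP (h : MV iP iQ jP jQ) (n : ℕ) : Function.Injective (cmap iP n) := cmap_inj h.emb.injective n
lemma inj_jP (h : MV iP iQ jP jQ) (n : ℕ) : Function.Injective (cmap jP n) := cmap_inj h.openP.injective n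
lemma inj_jQ (h : MV iP iQ jP jQ) (n : ℕ) : Function.Injective (cmap jQ n) := cmap_inj h.openQ.injective n

lemma ccomm (h : MV iP iQ jP jQ) (n : ℕ) (c : Chain W n) : cmap jP n (cmap iP n c) = cmap jQ n (cmap iQ n c) := by
  rw [cmap_comp, cmap_comp, h.comm]

lemma Hcomm (h : MV iP iQ jP jQ) (k : ℕ) (c : H W k) : Hm jP k (Hm iP k c) = Hm jQ k (Hm iQ k c) := by
  rw [Hm_comp, Hm_comp, h.comm]

lemma cpull (h : MV iP iQ jP jQ) (n : ℕ) (p : Chain P n) (q : Chain Q n) (e : cmap jP n p = cmap jQ n q) :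
    ∃ w, cmap iP n w = p ∧ cmap iQ n w = q := by
  have hm : cmap jP n p ∈ Ch (Set.range (jP.comp iP)) n := by
    have h1 := cmap_mem jP n p
    have h2 := cmap_mem jQ n q
    rw [← e] at h2
    have h3 := Submodule.mem_inf.2 ⟨h1, h2⟩
    rw [Ch, Ch, ← Finsupp.supported_inter] at h3
    refine Finsupp.supported_mono ?_ h3
    rintro σ ⟨h4, h5⟩ t
    obtain ⟨a, ha⟩ := h4 t
    obtain ⟨b, hb⟩ := h5 t
    obtain ⟨w, hw⟩ := h.pull a b (ha.trans hb.symm)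
    refine ⟨w, ?_⟩
    rw [ContinuousMap.comp_apply, hw, ha]
  obtain ⟨w, hw⟩ := cmap_surj (f := jP.comp iP) (h.openP.isEmbedding.comp h.emb) n _ hm
  rw [← cmap_comp] at hw
  have hp := h.inj_jP n hw
  refine ⟨w, hp, ?_⟩
  apply h.inj_jQ n
  rw [← h.ccomm, hp, e]

lemma small (h : MV iP iQ jP jQ) (n : ℕ) (c : Chain R (n+1)) :
    ∃ m p q, (sd R (n+1) ^ m) c = cmap jP (n+1) p + cmap jQ (n+1) q := by
  obtain ⟨m, hm⟩ := small_chain _ _ h.openP.isOpen_range h.openQ.isOpen_range h.cover n c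
  obtain ⟨a, ha, b, hb, e⟩ := Submodule.mem_sup.1 (hm m le_rfl)
  obtain ⟨p, rfl⟩ := cmap_surj h.openP.isEmbedding _ a ha
  obtain ⟨q, rfl⟩ := cmap_surj h.openQ.isEmbedding _ b hb
  exact ⟨m, p, q, e.symm⟩

end MV

lemma cmap_sd_pow (f : C(X, Y)) (n m : ℕ) (c : Chain X n) :
    cmap f n ((sd X n ^ m) c) = (sd Y n ^ m) (cmap f n c) := by
  induction m with
  | zero => simp
  | succ m ih => rw [pow_succ', Module.End.mul_apply, cmap_sd, ih, pow_succ', Module.End.mul_apply]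

lemma dd_inj {f : C(X, Y)} (hf : ∀ n, Function.Injective (cmap f n)) (k : ℕ) (w : Chain X (k+1))
    (h : dd Y k (cmap f (k+1) w) = 0) : dd X k w = 0 := by
  apply hf k
  rw [cmap_dd, h, map_zero]

lemma dd_sd (k m : ℕ) (w : Chain X (k+1)) (h : dd X k w = 0) : dd X k ((sd X (k+1) ^ m) w) = 0 := by
  cases k with
  | zero => rfl
  | succ k =>
    change bd X (k+1) _ = 0
    have h : bd X (k+1) w = 0 := h
    rw [← sd_pow_bd, h, map_zero]

/-- the connecting relation -/
def Conn (iP : C(W, P)) (iQ : C(W, Q)) (jP : C(P, R)) (jQ : C(Q, R)) (k : ℕ)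
    (x : H R (k+1)) (c : H W k) : Prop :=
  ∃ (p : Chain P (k+1+1)) (q : Chain Q (k+1+1)) (w : Chain W (k+1)) (hw : dd W k w = 0)
    (hx : dd R (k+1) (cmap jP (k+1+1) p + cmap jQ (k+1+1) q) = 0),
    x = cls _ hx ∧ c = cls w hw ∧ bd P (k+1) p = cmap iP (k+1) w ∧ bd Q (k+1) q = - cmap iQ (k+1) w

namespace Conn

lemma add {k : ℕ} {x y : H R (k+1)} {c d : H W k} (h1 : Conn iP iQ jP jQ k x c)
    (h2 : Conn iP iQ jP jQ k y d) : Conn iP iQ jP jQ k (x+y) (c+d) := by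
  obtain ⟨p, q, w, hw, hx, rfl, rfl, hp, hq⟩ := h1
  obtain ⟨p', q', w', hw', hx', rfl, rfl, hp', hq'⟩ := h2
  refine ⟨p + p', q + q', w + w', by rw [map_add, hw, hw', add_zero], ?_, ?_, ?_, ?_, ?_⟩
  · rw [map_add (cmap jP _), map_add (cmap jQ _), add_add_add_comm, map_add, hx, hx', add_zero]
  · rw [cls_add]
    apply cls_congr
    rw [map_add (cmap jP _), map_add (cmap jQ _), add_add_add_comm]
  · rw [cls_add]
  · rw [map_add, map_add, hp, hp']
  · rw [map_add, map_add, hq, hq', neg_add]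

lemma smul {k : ℕ} {x : H R (k+1)} {c : H W k} (h1 : Conn iP iQ jP jQ k x c) (a : ℚ) :
    Conn iP iQ jP jQ k (a • x) (a • c) := by
  obtain ⟨p, q, w, hw, hx, rfl, rfl, hp, hq⟩ := h1
  refine ⟨a • p, a • q, a • w, by rw [map_smul, hw, smul_zero], ?_, ?_, ?_, ?_, ?_⟩
  · rw [map_smul (cmap jP _), map_smul (cmap jQ _), ← smul_add, map_smul, hx, smul_zero]
  · rw [cls_smul]
    apply cls_congr
    rw [map_smul (cmap jP _), map_smul (cmap jQ _), ← smul_add]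
  · rw [cls_smul]
  · rw [map_smul, map_smul, hp]
  · rw [map_smul, map_smul, hq, smul_neg]

end Conn

namespace MV


lemma conn_total (h : MV iP iQ jP jQ) (k : ℕ) (x : H R (k+1)) : ∃ c, Conn iP iQ jP jQ k x c := by
  obtain ⟨z, hz, rfl⟩ := exists_cls x
  obtain ⟨m, p, q, e⟩ := h.small _ z
  have hz' : bd R (k+1) z = 0 := hz
  have e1 : bd R (k+1) (cmap jP (k+1+1) p) = - bd R (k+1) (cmap jQ (k+1+1) q) := by
    rw [eq_neg_iff_add_eq_zero, ← map_add, ← e, ← sd_pow_bd, hz', map_zero]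
  obtain ⟨w, hw1, hw2⟩ := h.cpull (k+1) (bd P (k+1) p) (- bd Q (k+1) q) (by
    rw [cmap_bd, e1, map_neg, cmap_bd])
  have hw : dd W k w = 0 := by
    apply dd_inj h.inj_iP
    rw [hw1, dd_bd]
  refine ⟨cls w hw, p, q, w, hw, ?_, ?_, rfl, hw1.symm, ?_⟩
  · change bd R (k+1) _ = 0
    rw [map_add, e1, neg_add_cancel]
  · refine cls_eq _ _ (shm R (k+1+1) m z) ?_
    rw [shm_of_dd m z hz, e]
  · rw [hw2, neg_neg]

lemma conn_zero (h : MV iP iQ jP jQ) (k : ℕ) (c : H W k) (hc : Conn iP iQ jP jQ k 0 c) : c = 0 := by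
  obtain ⟨p, q, w, hw, hx, e0, rfl, hp, hq⟩ := hc
  obtain ⟨z, hz⟩ := (cls_eq_zero_iff _).1 e0.symm
  obtain ⟨m, a, b, e⟩ := h.small _ z
  obtain ⟨v, hv1, hv2⟩ := h.cpull (k+1+1) ((sd P (k+1+1) ^ m) p - bd P (k+1+1) a)
    (bd Q (k+1+1) b - (sd Q (k+1+1) ^ m) q) (by
      rw [map_sub, map_sub, cmap_sd_pow, cmap_sd_pow, cmap_bd, cmap_bd, sub_eq_sub_iff_add_eq_add,
        ← map_add, ← hz, sd_pow_bd, e, map_add]; exact add_comm _ _)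
  rw [cls_eq_zero_iff]
  refine ⟨shm W (k+1) m w + v, ?_⟩
  have : bd W (k+1) v = (sd W (k+1) ^ m) w := by
    apply h.inj_iP
    rw [cmap_bd, hv1, map_sub, bd_bd, sub_zero, ← sd_pow_bd, hp, cmap_sd_pow]
  rw [map_add, shm_of_dd m w hw, this, sub_add_cancel]

lemma conn_unique (h : MV iP iQ jP jQ) (k : ℕ) {x : H R (k+1)} {c d : H W k} (hc : Conn iP iQ jP jQ k x c)
    (hd : Conn iP iQ jP jQ k x d) : c = d := by
  have := hc.add (hd.smul (-1))
  rw [neg_one_smul, neg_one_smul, add_neg_cancel] at this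
  have := h.conn_zero k _ this
  rwa [← sub_eq_add_neg, sub_eq_zero] at this

/-- connecting homomorphism -/
def del (h : MV iP iQ jP jQ) (k : ℕ) : H R (k+1) →ₗ[ℚ] H W k where
  toFun x := (h.conn_total k x).choose
  map_add' x y := h.conn_unique k (h.conn_total k _).choose_spec
    ((h.conn_total k x).choose_spec.add (h.conn_total k y).choose_spec)
  map_smul' a x := h.conn_unique k (h.conn_total k _).choose_spec
    ((h.conn_total k x).choose_spec.smul a)

lemma del_spec (h : MV iP iQ jP jQ) (k : ℕ) (x : H R (k+1)) : Conn iP iQ jP jQ k x (h.del k x) :=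
  (h.conn_total k x).choose_spec

lemma del_eq (h : MV iP iQ jP jQ) (k : ℕ) {x : H R (k+1)} {c : H W k} (hc : Conn iP iQ jP jQ k x c) : h.del k x = c :=
  h.conn_unique k (h.del_spec k x) hc

lemma iP_del (h : MV iP iQ jP jQ) (k : ℕ) (x : H R (k+1)) : Hm iP k (h.del k x) = 0 := by
  obtain ⟨p, q, w, hw, hx, -, e, hp, hq⟩ := h.del_spec k x
  rw [e, Hm_cls, cls_eq_zero_iff]
  exact ⟨p, hp⟩

lemma iQ_del (h : MV iP iQ jP jQ) (k : ℕ) (x : H R (k+1)) : Hm iQ k (h.del k x) = 0 := by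
  obtain ⟨p, q, w, hw, hx, -, e, hp, hq⟩ := h.del_spec k x
  rw [e, Hm_cls, cls_eq_zero_iff]
  exact ⟨-q, by rw [map_neg, hq, neg_neg]⟩

lemma del_surj (h : MV iP iQ jP jQ) (k : ℕ) (c : H W k) (h1 : Hm iP k c = 0) (h2 : Hm iQ k c = 0) :
    ∃ x, h.del k x = c := by
  obtain ⟨w, hw, rfl⟩ := exists_cls c
  rw [Hm_cls, cls_eq_zero_iff] at h1 h2
  obtain ⟨p, hp⟩ := h1
  obtain ⟨q, hq⟩ := h2
  have hx : dd R (k+1) (cmap jP (k+1+1) p + cmap jQ (k+1+1) (-q)) = 0 := by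
    change bd R (k+1) _ = 0
    rw [map_add, ← cmap_bd, ← cmap_bd, map_neg, map_neg, hp, hq, h.ccomm, add_neg_cancel]
  exact ⟨cls _ hx, h.del_eq k ⟨p, -q, w, hw, hx, rfl, rfl, hp, by rw [map_neg, hq]⟩⟩

lemma del_jP (h : MV iP iQ jP jQ) (k : ℕ) (a : H P (k+1)) : h.del k (Hm jP (k+1) a) = 0 := by
  obtain ⟨z, hz, rfl⟩ := exists_cls a
  have hz' : bd P (k+1) z = 0 := hz
  apply h.del_eq
  refine ⟨z, 0, 0, map_zero _, ?_, ?_, rfl, by rw [hz', map_zero], by simp⟩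
  · change bd R (k+1) _ = 0
    rw [map_zero, add_zero, ← cmap_bd, hz', map_zero]
  · rw [Hm_cls]
    apply cls_congr
    simp

lemma del_jQ (h : MV iP iQ jP jQ) (k : ℕ) (a : H Q (k+1)) : h.del k (Hm jQ (k+1) a) = 0 := by
  obtain ⟨z, hz, rfl⟩ := exists_cls a
  have hz' : bd Q (k+1) z = 0 := hz
  apply h.del_eq
  refine ⟨0, z, 0, map_zero _, ?_, ?_, rfl, by simp, by rw [hz', map_zero, neg_zero]⟩
  · change bd R (k+1) _ = 0
    rw [map_zero, zero_add, ← cmap_bd, hz', map_zero]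
  · rw [Hm_cls]
    apply cls_congr
    simp

lemma del_ker (h : MV iP iQ jP jQ) (k : ℕ) (x : H R (k+1)) (hx : h.del k x = 0) :
    ∃ a b, x = Hm jP (k+1) a + Hm jQ (k+1) b := by
  obtain ⟨p, q, w, hw, hx', e, e0, hp, hq⟩ := h.del_spec k x
  rw [hx] at e0
  obtain ⟨v, hv⟩ := (cls_eq_zero_iff hw).1 e0.symm
  have h1 : dd P (k+1) (p - cmap iP (k+1+1) v) = 0 := by
    change bd P (k+1) _ = 0
    rw [map_sub, ← cmap_bd, hv, hp, sub_self]
  have h2 : dd Q (k+1) (q + cmap iQ (k+1+1) v) = 0 := by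
    change bd Q (k+1) _ = 0
    rw [map_add, ← cmap_bd, hv, hq, neg_add_cancel]
  refine ⟨cls _ h1, cls _ h2, ?_⟩
  rw [e]
  apply cls_sum
  rw [map_sub, map_add, h.ccomm]; abel

lemma middle (h : MV iP iQ jP jQ) (k : ℕ) (a : H P k) (b : H Q k) (e : Hm jP k a = Hm jQ k b) :
    ∃ c, Hm iP k c = a ∧ Hm iQ k c = b := by
  obtain ⟨p, hp, rfl⟩ := exists_cls a
  obtain ⟨q, hq, rfl⟩ := exists_cls b
  rw [Hm_cls, Hm_cls, cls_eq_iff] at e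
  obtain ⟨z, hz⟩ := e
  obtain ⟨m, a', b', e⟩ := h.small _ z
  obtain ⟨w, hw1, hw2⟩ := h.cpull (k+1) ((sd P (k+1) ^ m) p - bd P (k+1) a')
    ((sd Q (k+1) ^ m) q + bd Q (k+1) b') (by
      rw [map_sub, map_add, cmap_sd_pow, cmap_sd_pow, cmap_bd, cmap_bd, sub_eq_iff_eq_add,
        add_assoc, ← sub_eq_iff_eq_add', ← map_sub, ← hz, sd_pow_bd, e, map_add]; exact add_comm _ _)
  have hw : dd W k w = 0 := by
    apply dd_inj h.inj_iP
    rw [hw1, map_sub, dd_bd, dd_sd k m p hp, sub_zero]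
  refine ⟨cls w hw, ?_, ?_⟩
  · rw [Hm_cls]
    symm
    refine cls_eq _ _ (shm P (k+1) m p + a') ?_
    rw [map_add, shm_of_dd m p hp, hw1]
    abel
  · rw [Hm_cls]
    symm
    refine cls_eq _ _ (shm Q (k+1) m q - b') ?_
    rw [map_sub, shm_of_dd m q hq, hw2]
    abel

lemma surj_zero (h : MV iP iQ jP jQ) (x : H R 0) : ∃ a b, x = Hm jP 0 a + Hm jQ 0 b := by
  obtain ⟨z, hz, rfl⟩ := exists_cls x
  obtain ⟨m, p, q, e⟩ := h.small _ z
  refine ⟨cls p (dd_zero p), cls q (dd_zero q), ?_⟩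
  rw [Hm_cls, Hm_cls, cls_add]
  refine cls_eq _ _ (shm R 1 m z) ?_
  rw [shm_of_dd m z hz, e]

lemma del_nat (h : MV iP iQ jP jQ) {W' P' Q' R' : Type} [TopologicalSpace W'] [TopologicalSpace P'] [TopologicalSpace Q']
    [TopologicalSpace R'] {iP' : C(W', P')} {iQ' : C(W', Q')} {jP' : C(P', R')} {jQ' : C(Q', R')}
    (h' : MV iP' iQ' jP' jQ') (fW : C(W, W')) (fP : C(P, P')) (fQ : C(Q, Q')) (fR : C(R, R'))
    (e1 : fP.comp iP = iP'.comp fW) (e2 : fQ.comp iQ = iQ'.comp fW)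
    (e3 : fR.comp jP = jP'.comp fP) (e4 : fR.comp jQ = jQ'.comp fQ) (k : ℕ) (x : H R (k+1)) :
    h'.del k (Hm fR (k+1) x) = Hm fW k (h.del k x) := by
  apply h'.del_eq
  obtain ⟨p, q, w, hw, hx, e, e', hp, hq⟩ := h.del_spec k x
  have e5 : cmap fR (k+1+1) (cmap jP (k+1+1) p + cmap jQ (k+1+1) q) =
      cmap jP' (k+1+1) (cmap fP _ p) + cmap jQ' (k+1+1) (cmap fQ _ q) := by
    rw [map_add, cmap_comp, cmap_comp, e3, e4, cmap_comp, cmap_comp]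
  refine ⟨cmap fP _ p, cmap fQ _ q, cmap fW _ w, by rw [← cmap_dd, hw, map_zero],
    by rw [← e5, ← cmap_dd, hx, map_zero], ?_, ?_, ?_, ?_⟩
  · rw [e, Hm_cls]
    exact cls_congr _ e5
  · rw [e', Hm_cls]
  · rw [← cmap_bd, hp, cmap_comp, cmap_comp, e1]
  · rw [← cmap_bd, hq, map_neg, cmap_comp, cmap_comp, e2]

end MV

end MV

end

end ArrTop

/-! ### Product with the punctured plane -/

namespace ArrTop

noncomputable section

/-- inclusion of subsets -/
def incl {E : Type} [TopologicalSpace E] {s t : Set E} (h : s ⊆ t) : C(s, t) :=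
  ⟨Set.inclusion h, continuous_inclusion h⟩

lemma incl_open {E : Type} [TopologicalSpace E] {s t : Set E} (h : s ⊆ t) (hs : IsOpen s) :
    Topology.IsOpenEmbedding (incl h) := by
  refine ⟨Topology.IsEmbedding.inclusion h, ?_⟩
  have : Set.range (incl h) = (Subtype.val : t → E) ⁻¹' s := by
    ext x
    constructor
    · rintro ⟨y, rfl⟩
      exact y.2
    · intro hx
      exact ⟨⟨x.1, hx⟩, rfl⟩
  rw [this]
  exact hs.preimage continuous_subtype_val

lemma mv_set {E : Type} [TopologicalSpace E] {w p q r : Set E} (hp : IsOpen p) (hq : IsOpen q)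
    (hwp : w ⊆ p) (hwq : w ⊆ q) (hpr : p ⊆ r) (hqr : q ⊆ r) (hw : ∀ x, x ∈ p → x ∈ q → x ∈ w)
    (hr : ∀ x ∈ r, x ∈ p ∨ x ∈ q) : MV (incl hwp) (incl hwq) (incl hpr) (incl hqr) where
  comm := rfl
  emb := Topology.IsEmbedding.inclusion hwp
  openP := incl_open _ hp
  openQ := incl_open _ hq
  cover := by
    rw [Set.eq_univ_iff_forall]
    intro x
    rcases hr x.1 x.2 with h | h
    · left; exact ⟨⟨x.1, h⟩, rfl⟩
    · right; exact ⟨⟨x.1, h⟩, rfl⟩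
  pull := by
    intro a b e
    have e' : (a : E) = b := congrArg Subtype.val e
    exact ⟨⟨a.1, hw _ a.2 (e' ▸ b.2)⟩, rfl⟩

lemma mv_prod (Y : Type) [TopologicalSpace Y] {W P Q R : Type} [TopologicalSpace W]
    [TopologicalSpace P] [TopologicalSpace Q] [TopologicalSpace R] {iP : C(W, P)} {iQ : C(W, Q)}
    {jP : C(P, R)} {jQ : C(Q, R)} (h : MV iP iQ jP jQ) :
    MV ((ContinuousMap.id Y).prodMap iP) ((ContinuousMap.id Y).prodMap iQ)
      ((ContinuousMap.id Y).prodMap jP) ((ContinuousMap.id Y).prodMap jQ) where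
  comm := by
    ext1 x
    exact Prod.ext rfl (DFunLike.congr_fun h.comm x.2)
  emb := Topology.IsEmbedding.id.prodMap h.emb
  openP := Topology.IsOpenEmbedding.id.prodMap h.openP
  openQ := Topology.IsOpenEmbedding.id.prodMap h.openQ
  cover := by
    rw [Set.eq_univ_iff_forall]
    rintro ⟨y, x⟩
    have := Set.eq_univ_iff_forall.1 h.cover x
    rcases this with ⟨a, ha⟩ | ⟨a, ha⟩
    · left; exact ⟨(y, a), Prod.ext rfl ha⟩
    · right; exact ⟨(y, a), Prod.ext rfl ha⟩
  pull := by
    rintro ⟨y, a⟩ ⟨y', b⟩ e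
    obtain ⟨w, hw⟩ := h.pull a b (congrArg Prod.snd e)
    exact ⟨(y, w), Prod.ext rfl hw⟩

/-- punctured plane -/
abbrev cX : Set ℂ := {z | z ≠ 0}
/-- slit plane -/
abbrev cS : Set ℂ := Complex.slitPlane
/-- negative slit plane -/
abbrev cN : Set ℂ := {z | -z ∈ Complex.slitPlane}
/-- non-real numbers -/
abbrev cW : Set ℂ := {z | z.im ≠ 0}
/-- upper half plane -/
abbrev cU : Set ℂ := {z | 0 < z.im}
/-- lower half plane -/
abbrev cL : Set ℂ := {z | z.im < 0}

instance : ContractibleSpace cS :=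
  Complex.starConvex_one_slitPlane.contractibleSpace ⟨1, by simp [cS, Complex.mem_slitPlane_iff]⟩

instance : ContractibleSpace cN := by
  have h := StarConvex.linear_preimage (𝕜 := ℝ) (x := (-1:ℂ)) (s := Complex.slitPlane)
    (-LinearMap.id : ℂ →ₗ[ℝ] ℂ) (by simpa using Complex.starConvex_one_slitPlane)
  exact h.contractibleSpace ⟨-1, by simp [Complex.mem_slitPlane_iff]⟩

instance : ContractibleSpace cU := (convex_halfSpace_im_gt 0).contractibleSpace ⟨Complex.I, by simp⟩

instance : ContractibleSpace cL := (convex_halfSpace_im_lt 0).contractibleSpace ⟨-Complex.I, by simp⟩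

lemma hWS : cW ⊆ cS := fun _ h => Complex.mem_slitPlane_iff.2 (Or.inr h)
lemma hWN : cW ⊆ cN := fun _ h => Complex.mem_slitPlane_iff.2 (Or.inr (by simpa using h))
lemma hSX : cS ⊆ cX := fun _ h => Complex.slitPlane_ne_zero h
lemma hNX : cN ⊆ cX := fun _ h => by simpa using Complex.slitPlane_ne_zero h
lemma hUW : cU ⊆ cW := fun _ h => ne_of_gt h
lemma hLW : cL ⊆ cW := fun _ h => ne_of_lt h

lemma mvX : MV (incl hWS) (incl hWN) (incl hSX) (incl hNX) := by
  apply mv_set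
  · exact Complex.isOpen_slitPlane
  · exact Complex.isOpen_slitPlane.preimage continuous_neg
  · intro x h1 h2
    rcases Complex.mem_slitPlane_iff.1 h1 with h | h
    · rcases Complex.mem_slitPlane_iff.1 h2 with h' | h'
      · simp at h'; linarith
      · simpa using h'
    · exact h
  · intro x hx
    by_cases h : x.im = 0
    · have : x.re ≠ 0 := fun h' => hx (Complex.ext h' h)
      rcases lt_or_gt_of_ne this with h' | h'
      · right
        exact Complex.mem_slitPlane_iff.2 (Or.inl (by simpa using h'))
      · left
        exact Complex.mem_slitPlane_iff.2 (Or.inl h')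
    · left
      exact Complex.mem_slitPlane_iff.2 (Or.inr h)

lemma mvW : MV (incl (Set.empty_subset cU)) (incl (Set.empty_subset cL)) (incl hUW) (incl hLW) := by
  apply mv_set
  · exact isOpen_lt continuous_const Complex.continuous_im
  · exact isOpen_lt Complex.continuous_im continuous_const
  · intro x (h1 : 0 < x.im) (h2 : x.im < 0)
    exact absurd h1 (not_lt.2 h2.le)
  · intro x hx
    rcases lt_or_gt_of_ne hx with h | h
    · exact Or.inr h
    · exact Or.inl h

variable {Y Z D : Type} [TopologicalSpace Y] [TopologicalSpace Z] [TopologicalSpace D]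

/-- section of a product -/
def sec (Y : Type) [TopologicalSpace Y] {D : Type} [TopologicalSpace D] (d : D) : C(Y, Y × D) :=
  (ContinuousMap.id Y).prodMk (ContinuousMap.const Y d)

/-- product map on the first factor -/
abbrev fmap (g : C(Z, Y)) (D : Type) [TopologicalSpace D] : C(Z × D, Y × D) :=
  g.prodMap (ContinuousMap.id D)

lemma fst_sec (d : D) (k : ℕ) (a : H Y k) :
    Hm (ContinuousMap.fst : C(Y × D, Y)) k (Hm (sec Y d) k a) = a := by
  rw [Hm_comp]
  exact Hm_id k a

lemma contr_fst_inj [ContractibleSpace D] (k : ℕ) {x y : H (Y × D) k}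
    (h : Hm (ContinuousMap.fst : C(Y × D, Y)) k x = Hm (ContinuousMap.fst : C(Y × D, Y)) k y) :
    x = y := by
  obtain ⟨d0, hd⟩ := id_nullhomotopic D
  have key : ∀ x : H (Y × D) k, Hm (sec Y d0) k (Hm (ContinuousMap.fst : C(Y × D, Y)) k x) = x := by
    intro x
    rw [Hm_comp]
    have := (ContinuousMap.Homotopic.refl (ContinuousMap.id Y)).prodMap hd.symm
    have h2 := Hm_homotopic this k x
    have e1 : (ContinuousMap.id Y).prodMap (ContinuousMap.id D) = ContinuousMap.id (Y × D) := rfl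
    have e2 : (ContinuousMap.id Y).prodMap (ContinuousMap.const D d0) =
      (sec Y d0).comp (ContinuousMap.fst : C(Y × D, Y)) := rfl
    rw [e1, Hm_id, e2] at h2
    exact h2
  rw [← key x, h, key]

lemma contr_eq [ContractibleSpace D] (d : D) (k : ℕ) (x : H (Y × D) k) :
    Hm (sec Y d) k (Hm (ContinuousMap.fst : C(Y × D, Y)) k x) = x := by
  apply contr_fst_inj
  rw [fst_sec]

/-- base points -/
def pI : cW := ⟨Complex.I, by simp⟩
/-- base points -/
def pJ : cW := ⟨-Complex.I, by simp⟩
/-- base points -/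
def p1 : cX := ⟨1, by simp⟩

lemma W_split (k : ℕ) (c : H (Y × cW) k) :
    ∃ a b, c = Hm (sec Y pI) k a + Hm (sec Y pJ) k b := by
  have h := mv_prod Y mvW
  have h1 : ∃ a b, c = Hm ((ContinuousMap.id Y).prodMap (incl hUW)) k a +
      Hm ((ContinuousMap.id Y).prodMap (incl hLW)) k b := by
    cases k with
    | zero => exact h.surj_zero c
    | succ k => exact h.del_ker k c (H_empty k _)
  obtain ⟨a, b, rfl⟩ := h1
  refine ⟨Hm ContinuousMap.fst k a, Hm ContinuousMap.fst k b, ?_⟩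
  congr 1
  · conv_lhs => rw [← contr_eq ⟨Complex.I, by simp⟩ k a, Hm_comp]
    rfl
  · conv_lhs => rw [← contr_eq ⟨-Complex.I, by simp⟩ k b, Hm_comp]
    rfl

lemma W_inj (k : ℕ) (a b : H Y k) (e : Hm (sec Y pI) k a = Hm (sec Y pJ) k b) : a = 0 := by
  have h := mv_prod Y mvW
  obtain ⟨c, hc, -⟩ := h.middle k (Hm (sec Y ⟨Complex.I, by simp⟩) k a)
    (Hm (sec Y ⟨-Complex.I, by simp⟩) k b) (by
      rw [Hm_comp, Hm_comp]
      exact e)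
  rw [H_empty k c, map_zero] at hc
  rw [← fst_sec (D := cU) ⟨Complex.I, by simp⟩ k a, ← hc, map_zero]

/-- Mayer-Vietoris square for the product with the punctured plane -/
lemma kmv (Y : Type) [TopologicalSpace Y] :
    MV ((ContinuousMap.id Y).prodMap (incl hWS)) ((ContinuousMap.id Y).prodMap (incl hWN))
      ((ContinuousMap.id Y).prodMap (incl hSX)) ((ContinuousMap.id Y).prodMap (incl hNX)) :=
  mv_prod Y mvX

lemma S_zero (k : ℕ) (a b : H Y k) :
    Hm ((ContinuousMap.id Y).prodMap (incl hWS)) k (Hm (sec Y pI) k a + Hm (sec Y pJ) k b) = 0 ↔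
      a + b = 0 := by
  have : Hm (ContinuousMap.fst : C(Y × cS, Y)) k
    (Hm ((ContinuousMap.id Y).prodMap (incl hWS)) k (Hm (sec Y pI) k a + Hm (sec Y pJ) k b)) =
      a + b := by
    rw [Hm_comp, map_add, Hm_comp, Hm_comp]
    exact congrArg₂ (· + ·) (Hm_id k a) (Hm_id k b)
  constructor
  · intro h
    rw [← this, h, map_zero]
  · intro h
    apply contr_fst_inj
    rw [this, h, map_zero]

lemma N_zero (k : ℕ) (a b : H Y k) :
    Hm ((ContinuousMap.id Y).prodMap (incl hWN)) k (Hm (sec Y pI) k a + Hm (sec Y pJ) k b) = 0 ↔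
      a + b = 0 := by
  have : Hm (ContinuousMap.fst : C(Y × cN, Y)) k
    (Hm ((ContinuousMap.id Y).prodMap (incl hWN)) k (Hm (sec Y pI) k a + Hm (sec Y pJ) k b)) =
      a + b := by
    rw [Hm_comp, map_add, Hm_comp, Hm_comp]
    exact congrArg₂ (· + ·) (Hm_id k a) (Hm_id k b)
  constructor
  · intro h
    rw [← this, h, map_zero]
  · intro h
    apply contr_fst_inj
    rw [this, h, map_zero]

lemma kD_ex (k : ℕ) (x : H (Y × cX) (k+1)) :
    ∃ a, (kmv Y).del k x = Hm (sec Y pI) k a - Hm (sec Y pJ) k a := by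
  obtain ⟨a, b, e⟩ := W_split k ((kmv Y).del k x)
  have h := (kmv Y).iP_del k x
  rw [e, S_zero] at h
  refine ⟨a, ?_⟩
  rw [e, eq_neg_of_add_eq_zero_right h, map_neg, sub_eq_add_neg]

lemma kD_uniq (k : ℕ) {x : H (Y × cW) k} {a b : H Y k}
    (ha : x = Hm (sec Y pI) k a - Hm (sec Y pJ) k a)
    (hb : x = Hm (sec Y pI) k b - Hm (sec Y pJ) k b) : a = b := by
  have : Hm (sec Y pI) k (a - b) = Hm (sec Y pJ) k (a - b) := by
    rw [map_sub, map_sub, sub_eq_sub_iff_sub_eq_sub, ← ha, ← hb]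
  exact sub_eq_zero.1 (W_inj k _ _ this)

/-- the residue map -/
def kD (Y : Type) [TopologicalSpace Y] (k : ℕ) : H (Y × cX) (k+1) →ₗ[ℚ] H Y k where
  toFun x := (kD_ex k x).choose
  map_add' x y := by
    refine kD_uniq k (kD_ex k (x+y)).choose_spec ?_
    have hx := (kD_ex k x).choose_spec
    have hy := (kD_ex k y).choose_spec
    have e : (kmv Y).del k (x + y) = (kmv Y).del k x + (kmv Y).del k y := map_add _ _ _
    refine (e.trans (congrArg₂ (· + ·) hx hy)).trans ?_
    rw [map_add, map_add]
    exact sub_add_sub_comm _ _ _ _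
  map_smul' a x := by
    refine kD_uniq k (kD_ex k (a • x)).choose_spec ?_
    have hx := (kD_ex k x).choose_spec
    have e : (kmv Y).del k (a • x) = a • (kmv Y).del k x := map_smul _ _ _
    refine (e.trans (congrArg (a • ·) hx)).trans ?_
    rw [RingHom.id_apply, map_smul, map_smul]
    exact smul_sub _ _ _

lemma kD_spec (k : ℕ) (x : H (Y × cX) (k+1)) :
    (kmv Y).del k x = Hm (sec Y pI) k (kD Y k x) - Hm (sec Y pJ) k (kD Y k x) :=
  (kD_ex k x).choose_spec

lemma kD_nat (g : C(Z, Y)) (k : ℕ) (x : H (Z × cX) (k+1)) :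
    kD Y k (Hm (fmap g cX) (k+1) x) = Hm g k (kD Z k x) := by
  refine kD_uniq k (kD_spec k _) ?_
  rw [(kmv Z).del_nat (kmv Y) (fmap g cW) (fmap g cS) (fmap g cN) (fmap g cX) rfl rfl rfl rfl,
    kD_spec, map_sub, Hm_comp, Hm_comp, Hm_comp, Hm_comp]
  rfl

lemma kD_surj (k : ℕ) (a : H Y k) : ∃ x, kD Y k x = a := by
  obtain ⟨x, hx⟩ := (kmv Y).del_surj k (Hm (sec Y pI) k a + Hm (sec Y pJ) k (-a))
    ((S_zero k _ _).2 (add_neg_cancel a)) ((N_zero k _ _).2 (add_neg_cancel a))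
  refine ⟨x, kD_uniq k (kD_spec k x) ?_⟩
  rw [hx, map_neg, sub_eq_add_neg]

lemma sec_S (k : ℕ) (a : H (Y × cS) k) :
    Hm ((ContinuousMap.id Y).prodMap (incl hSX)) k a = Hm (sec Y p1) k (Hm ContinuousMap.fst k a) := by
  conv_lhs => rw [← contr_eq ⟨1, by simp [Complex.mem_slitPlane_iff]⟩ k a, Hm_comp]
  rfl

lemma sec_N (k : ℕ) (a : H (Y × cN) k) :
    Hm ((ContinuousMap.id Y).prodMap (incl hNX)) k a = Hm (sec Y p1) k (Hm ContinuousMap.fst k a) := by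
  conv_lhs => rw [← contr_eq ⟨Complex.I, by simp [Complex.mem_slitPlane_iff]⟩ k a, Hm_comp]
  have h := sec_S k (Hm (sec Y (⟨Complex.I, by simp [Complex.mem_slitPlane_iff]⟩ : cS)) k
    (Hm ContinuousMap.fst k a))
  rw [fst_sec, Hm_comp] at h
  exact h

lemma kD_ker (k : ℕ) (x : H (Y × cX) (k+1)) (hx : kD Y k x = 0) :
    ∃ a, x = Hm (sec Y p1) (k+1) a := by
  obtain ⟨a, b, rfl⟩ := (kmv Y).del_ker k x (by rw [kD_spec, hx, map_zero, map_zero, sub_zero])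
  rw [sec_S, sec_N, ← map_add]
  exact ⟨_, rfl⟩

lemma kD_sec (k : ℕ) (a : H Y (k+1)) : kD Y k (Hm (sec Y p1) (k+1) a) = 0 := by
  have h := sec_S (k+1) (Hm (sec Y (⟨1, by simp [Complex.mem_slitPlane_iff]⟩ : cS)) (k+1) a)
  rw [fst_sec] at h
  refine kD_uniq k (kD_spec k _) ?_
  rw [← h, (kmv Y).del_jP, map_zero, map_zero, sub_zero]

lemma k_zero (x : H (Y × cX) 0) : ∃ a, x = Hm (sec Y p1) 0 a := by
  obtain ⟨a, b, rfl⟩ := (kmv Y).surj_zero x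
  rw [sec_S, sec_N, ← map_add]
  exact ⟨_, rfl⟩

lemma sec_inj (d : D) (k : ℕ) : Function.Injective (Hm (sec Y d) k) :=
  Function.LeftInverse.injective (fst_sec d k)

lemma k_dim_zero : finrank ℚ (H (Y × cX) 0) = finrank ℚ (H Y 0) :=
  (LinearEquiv.finrank_eq (LinearEquiv.ofBijective (Hm (sec Y p1) 0)
    ⟨sec_inj _ _, fun x => by obtain ⟨a, ha⟩ := k_zero x; exact ⟨a, ha.symm⟩⟩)).symm

lemma k_range (k : ℕ) : LinearMap.range (Hm (sec Y p1) (k+1)) = LinearMap.ker (kD Y k) := by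
  ext x
  constructor
  · rintro ⟨a, rfl⟩
    exact kD_sec k a
  · intro h
    obtain ⟨a, ha⟩ := kD_ker k x h
    exact ⟨a, ha.symm⟩

lemma k_fin (h : ∀ k, FiniteDimensional ℚ (H Y k)) (k : ℕ) : FiniteDimensional ℚ (H (Y × cX) k) := by
  cases k with
  | zero =>
    have := h 0
    exact Module.Finite.of_surjective (Hm (sec Y p1) 0)
      (fun x => by obtain ⟨a, ha⟩ := k_zero x; exact ⟨a, ha.symm⟩)
  | succ k =>
    have := h k
    have := h (k+1)
    have h1 : FiniteDimensional ℚ (LinearMap.ker (kD Y k)) := by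
      rw [← k_range]; infer_instance
    have h2 : FiniteDimensional ℚ (H (Y × cX) (k+1) ⧸ LinearMap.ker (kD Y k)) :=
      Module.Finite.equiv (kD Y k).quotKerEquivRange.symm
    exact Module.Finite.of_submodule_quotient (LinearMap.ker (kD Y k))

lemma k_dim_succ (h : ∀ k, FiniteDimensional ℚ (H Y k)) (k : ℕ) :
    finrank ℚ (H (Y × cX) (k+1)) = finrank ℚ (H Y (k+1)) + finrank ℚ (H Y k) := by
  have := k_fin h (k+1)
  rw [← LinearMap.finrank_range_add_finrank_ker (kD Y k), ← k_range,
    LinearMap.finrank_range_of_inj (sec_inj _ _), LinearMap.range_eq_top.2 (kD_surj k), finrank_top,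
    add_comm]

/-- spanning in products with the punctured plane -/
lemma k_span (G : ∀ (Z : Type) [TopologicalSpace Z], C(Z, Y) → Prop)
    (hG : ∀ (k : ℕ) (x : H Y k), x ∈ Submodule.span ℚ {y | ∃ (Z : Type) (_ : TopologicalSpace Z)
      (g : C(Z, Y)) (z : H Z k), G Z g ∧ y = Hm g k z})
    (k : ℕ) (S : Submodule ℚ (H (Y × cX) k))
    (hS : ∀ (Z : Type) [TopologicalSpace Z] (g : C(Z, Y)) (x : H (Z × cX) k), G Z g →
      Hm (fmap g cX) k x ∈ S) (x : H (Y × cX) k) : x ∈ S := by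
  have key : ∀ a : H Y k, Hm (sec Y p1) k a ∈ S := by
    intro a
    have := hG k a
    induction this using Submodule.span_induction with
    | mem y hy =>
      obtain ⟨Z, _, g, z, hg, rfl⟩ := hy
      have := hS Z g (Hm (sec Z p1) k z) hg
      rw [Hm_comp] at this ⊢
      exact this
    | zero => rw [map_zero]; exact S.zero_mem
    | add a b _ _ h1 h2 => rw [map_add]; exact S.add_mem h1 h2
    | smul q a _ h1 => rw [map_smul]; exact S.smul_mem _ h1
  cases k with
  | zero =>
    obtain ⟨a, rfl⟩ := k_zero x
    exact key a
  | succ k =>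
    have h2 : ∀ a : H Y k, ∃ y ∈ S, kD Y k y = a := by
      intro a
      have := hG k a
      induction this using Submodule.span_induction with
      | mem y hy =>
        obtain ⟨Z, _, g, z, hg, rfl⟩ := hy
        obtain ⟨x, rfl⟩ := kD_surj k z
        exact ⟨_, hS Z g x hg, kD_nat g k x⟩
      | zero => exact ⟨0, S.zero_mem, map_zero _⟩
      | add a b _ _ h1 h2 =>
        obtain ⟨y, hy, rfl⟩ := h1
        obtain ⟨y', hy', rfl⟩ := h2
        exact ⟨y + y', S.add_mem hy hy', map_add _ _ _⟩
      | smul q a _ h1 =>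
        obtain ⟨y, hy, rfl⟩ := h1
        exact ⟨q • y, S.smul_mem _ hy, map_smul _ _ _⟩
    obtain ⟨y, hy, e⟩ := h2 (kD Y k x)
    obtain ⟨a, ha⟩ := kD_ker k (x - y) (by rw [map_sub, e, sub_self])
    have := S.add_mem (key a) hy
    rwa [← ha, sub_add_cancel] at this

end

end ArrTop

/-! ### Tori in arrangement complements -/

namespace ArrTop

noncomputable section

open Filter Topology

variable {V : Type} [NormedAddCommGroup V] [NormedSpace ℂ V]
variable {Z : Type} [TopologicalSpace Z]

/-- complement of a list of hyperplanes in a subspace -/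
def M (K : Submodule ℂ V) (A : List (V →L[ℂ] ℂ)) : Set V := {z | z ∈ K ∧ ∀ β ∈ A, β z ≠ 0}

/-- torus map -/
def F : List (C(Z, ℂ) × V) → ℝ → Z → V
  | [], _, _ => 0
  | p :: L, e, z => p.1 z • p.2 + (e : ℂ) • F L e z

lemma F_append (L : List (C(Z, ℂ) × V)) (u : C(Z, ℂ)) (w : V) (e : ℝ) (z : Z) :
    F (L ++ [(u, w)]) e z = F L e z + ((e : ℂ) ^ L.length * u z) • w := by
  induction L with
  | nil => simp [F]
  | cons p L ih =>
    simp only [List.cons_append, F, ih, List.length_cons, smul_add, smul_smul, pow_succ']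
    rw [mul_assoc, add_assoc]

lemma F_cont (L : List (C(Z, ℂ) × V)) : Continuous (fun q : ℝ × Z => F L q.1 q.2) := by
  induction L with
  | nil => exact continuous_const
  | cons p L ih =>
    simp only [F]
    fun_prop

lemma F_pull {Z' : Type} [TopologicalSpace Z'] (f : C(Z', Z)) (L : List (C(Z, ℂ) × V)) (e : ℝ)
    (z : Z') : F (L.map (fun p => (p.1.comp f, p.2))) e z = F L e (f z) := by
  induction L with
  | nil => rfl
  | cons p L ih => simp only [List.map_cons, F, ih]; rfl

/-- unitarity -/
def Unit1 (K : Submodule ℂ V) (L : List (C(Z, ℂ) × V)) : Prop :=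
  ∀ p ∈ L, p.2 ∈ K ∧ ∀ z, ‖p.1 z‖ = 1

lemma F_memK {K : Submodule ℂ V} {L : List (C(Z, ℂ) × V)} (h : Unit1 K L) (e : ℝ) (z : Z) :
    F L e z ∈ K := by
  induction L with
  | nil => exact K.zero_mem
  | cons p L ih =>
    exact K.add_mem (K.smul_mem _ (h p (by simp)).1)
      (K.smul_mem _ (ih (fun q hq => h q (List.mem_cons_of_mem _ hq))))

lemma F_bound {K : Submodule ℂ V} {L : List (C(Z, ℂ) × V)} (h : Unit1 K L) (β : V →L[ℂ] ℂ) :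
    ∃ B : ℝ, 0 ≤ B ∧ ∀ e, 0 < e → e ≤ 1 → ∀ z, ‖β (F L e z)‖ ≤ B := by
  induction L with
  | nil => exact ⟨0, le_rfl, fun e _ _ z => by simp [F]⟩
  | cons p L ih =>
    obtain ⟨B, hB, hh⟩ := ih (fun q hq => h q (List.mem_cons_of_mem _ hq))
    refine ⟨‖β p.2‖ + B, by positivity, fun e h0 h1 z => ?_⟩
    simp only [F, map_add, map_smul, smul_eq_mul]
    refine (norm_add_le _ _).trans ?_
    rw [norm_mul, norm_mul, (h p (by simp)).2 z, one_mul, Complex.norm_real, Real.norm_eq_abs,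
      abs_of_pos h0]
    have := hh e h0 h1 z
    have := norm_nonneg (β (F L e z))
    nlinarith

lemma F_ev {K : Submodule ℂ V} {L : List (C(Z, ℂ) × V)} (h : Unit1 K L) (β : V →L[ℂ] ℂ)
    (hβ : ∃ p ∈ L, β p.2 ≠ 0) (C : ℝ) :
    ∀ᶠ e in 𝓝[>] (0:ℝ), ∀ z, C * e ^ L.length < ‖β (F L e z)‖ := by
  induction L with
  | nil => simp at hβ
  | cons p L ih =>
    have h' : Unit1 K L := fun q hq => h q (List.mem_cons_of_mem _ hq)
    by_cases hp : β p.2 = 0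
    · have : ∃ p ∈ L, β p.2 ≠ 0 := by
        obtain ⟨q, hq, hq'⟩ := hβ
        rcases List.mem_cons.1 hq with rfl | hq
        · exact absurd hp hq'
        · exact ⟨q, hq, hq'⟩
      filter_upwards [ih h' this, self_mem_nhdsWithin] with e he h0 z
      have h0 : 0 < e := h0
      have := he z
      simp only [F, map_add, map_smul, hp, smul_eq_mul, mul_zero, zero_add, norm_mul,
        Complex.norm_real, Real.norm_eq_abs, abs_of_pos h0, List.length_cons, pow_succ']
      nlinarith
    · obtain ⟨B, hB, hh⟩ := F_bound h' β
      have hpos : 0 < ‖β p.2‖ := norm_pos_iff.2 hp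
      have hm : 0 < min 1 (‖β p.2‖ / (B + |C| + 1)) := by positivity
      filter_upwards [Ioo_mem_nhdsGT hm] with e he z
      have h0 : 0 < e := he.1
      have h1 : e ≤ 1 := (he.2.trans_le (min_le_left _ _)).le
      have h2 : e * (B + |C| + 1) < ‖β p.2‖ :=
        (lt_div_iff₀ (by positivity)).1 (he.2.trans_le (min_le_right _ _))
      simp only [F, map_add, map_smul, smul_eq_mul]
      have a1 : ‖p.1 z * β p.2‖ = ‖β p.2‖ := by
        rw [norm_mul, (h p (by simp)).2 z, one_mul]
      have a2 : ‖(e:ℂ) * β (F L e z)‖ ≤ e * B := by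
        rw [norm_mul, Complex.norm_real, Real.norm_eq_abs, abs_of_pos h0]
        exact mul_le_mul_of_nonneg_left (hh e h0 h1 z) h0.le
      have a3 := norm_sub_le_norm_add (p.1 z * β p.2) ((e:ℂ) * β (F L e z))
      have a4 : C * e ^ (p :: L).length ≤ |C| * e := by
        rw [List.length_cons]
        have : e ^ (L.length + 1) ≤ e := by
          rw [pow_succ]
          exact mul_le_of_le_one_left h0.le (pow_le_one₀ h0.le h1)
        calc C * e ^ (L.length + 1) ≤ |C| * e ^ (L.length + 1) :=
              mul_le_mul_of_nonneg_right (le_abs_self C) (by positivity)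
          _ ≤ |C| * e := mul_le_mul_of_nonneg_left this (abs_nonneg C)
      nlinarith

/-- Good torus data -/
def Good (K : Submodule ℂ V) (A : List (V →L[ℂ] ℂ)) (L : List (C(Z, ℂ) × V)) : Prop :=
  Unit1 K L ∧ ∀ β ∈ A, ∃ p ∈ L, β p.2 ≠ 0

lemma good_ev {K : Submodule ℂ V} {A : List (V →L[ℂ] ℂ)} {L : List (C(Z, ℂ) × V)}
    (h : Good K A L) (C : (V →L[ℂ] ℂ) → ℝ) :
    ∀ᶠ e in 𝓝[>] (0:ℝ), ∀ β ∈ A, ∀ z, C β * e ^ L.length < ‖β (F L e z)‖ := by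
  have := (Filter.eventually_all_finite (l := 𝓝[>] (0:ℝ)) (List.finite_toSet A)
    (p := fun β e => ∀ z, C β * e ^ L.length < ‖β (F L e z)‖)).2
    (fun β hβ => F_ev h.1 β (h.2 β hβ) (C β))
  exact this

lemma good_valid {K : Submodule ℂ V} {A : List (V →L[ℂ] ℂ)} {L : List (C(Z, ℂ) × V)}
    (h : Good K A L) : ∃ e0 > 0, ∀ e, 0 < e → e ≤ e0 → ∀ z, F L e z ∈ M K A := by
  obtain ⟨e0, h0, hh⟩ := mem_nhdsGT_iff_exists_Ioc_subset.1 (good_ev h (fun _ => 0))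
  refine ⟨e0, h0, fun e he1 he2 z => ⟨F_memK h.1 e z, fun β hβ => ?_⟩⟩
  have := hh ⟨he1, he2⟩ β hβ z
  rw [zero_mul] at this
  exact norm_pos_iff.1 this

lemma homot {E : Type} [TopologicalSpace E] {S : Set E} {f g : C(Z, S)} (h : ℝ × Z → E)
    (hc : Continuous h)
    (hS : ∀ t, 0 ≤ t → t ≤ 1 → ∀ z, h (t, z) ∈ S) (h0 : ∀ z, h (0, z) = f z)
    (h1 : ∀ z, h (1, z) = g z) : f.Homotopic g :=
  ⟨{ toFun := fun p => ⟨h (p.1, p.2), hS _ p.1.2.1 p.1.2.2 _⟩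
     continuous_toFun := by
       apply Continuous.subtype_mk
       exact hc.comp (by fun_prop)
     map_zero_left := fun z => Subtype.ext (h0 z)
     map_one_left := fun z => Subtype.ext (h1 z) }⟩

/-- the torus map as a continuous map -/
def tm (L : List (C(Z, ℂ) × V)) (e : ℝ) {S : Set V} (h : ∀ z, F L e z ∈ S) : C(Z, S) :=
  ⟨fun z => ⟨F L e z, h z⟩, Continuous.subtype_mk
    ((F_cont L).comp (by fun_prop : Continuous (fun z : Z => ((e, z) : ℝ × Z)))) _⟩

/-- torus maps -/
def G (K : Submodule ℂ V) (A : List (V →L[ℂ] ℂ)) (Z : Type) [TopologicalSpace Z]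
    (g : C(Z, M K A)) : Prop :=
  ∃ (L : List (C(Z, ℂ) × V)) (e : ℝ), Good K A L ∧ 0 < e ∧
    (∀ e', 0 < e' → e' ≤ e → ∀ z, F L e' z ∈ M K A) ∧ ∀ z, (g z : V) = F L e z

lemma G_shrink {K : Submodule ℂ V} {A : List (V →L[ℂ] ℂ)} {L : List (C(Z, ℂ) × V)} {e : ℝ}
    (he : 0 < e) (hv : ∀ e', 0 < e' → e' ≤ e → ∀ z, F L e' z ∈ M K A) {g : C(Z, M K A)}
    (hg : ∀ z, (g z : V) = F L e z) {e' : ℝ} (h0 : 0 < e') (h1 : e' ≤ e) :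
    g.Homotopic (tm L e' (hv e' h0 h1)) := by
  refine homot (fun q => F L ((1 - q.1) * e + q.1 * e') q.2) ?_ ?_ ?_ ?_
  · exact (F_cont L).comp (by fun_prop :
      Continuous (fun q : ℝ × Z => (((1 - q.1) * e + q.1 * e', q.2) : ℝ × Z)))
  · intro t ht0 ht1 z
    refine hv _ ?_ ?_ z
    · rcases eq_or_lt_of_le ht1 with rfl | h
      · simpa using h0
      · have : 0 < (1 - t) * e := mul_pos (by linarith) he
        have : 0 ≤ t * e' := by positivity
        linarith
    · nlinarith
  · intro z
    simp [hg z]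
  · intro z
    simp [tm]

/-- span of torus classes -/
def Tor (K : Submodule ℂ V) (A : List (V →L[ℂ] ℂ)) (k : ℕ) : Submodule ℚ (H (M K A) k) :=
  Submodule.span ℚ {y | ∃ (Z : Type) (_ : TopologicalSpace Z)
      (g : C(Z, M K A)) (z : H Z k), G K A Z g ∧ y = Hm g k z}

lemma M_cons_sub (K : Submodule ℂ V) (α : V →L[ℂ] ℂ) (A : List (V →L[ℂ] ℂ)) :
    M K (α :: A) ⊆ M K A := fun _ h => ⟨h.1, fun β hβ => h.2 β (List.mem_cons_of_mem _ hβ)⟩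

lemma torus_lift {K : Submodule ℂ V} {α : V →L[ℂ] ℂ} {A : List (V →L[ℂ] ℂ)} {w : V} (hw : w ∈ K)
    (hα : α w = 1) (g : C(Z, M K A)) (hg : G K A Z g) :
    ∃ g' : C(Z, M K (α :: A)), G K (α :: A) Z g' ∧
      g.Homotopic ((incl (M_cons_sub K α A)).comp g') := by
  obtain ⟨L, e, hL, he, hv, hge⟩ := hg
  by_cases hp : ∃ p ∈ L, α p.2 ≠ 0
  · have hL' : Good K (α :: A) L := ⟨hL.1, fun β hβ => by
      rcases List.mem_cons.1 hβ with rfl | hβ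
      · exact hp
      · exact hL.2 β hβ⟩
    obtain ⟨e0, h0, hh⟩ := good_valid hL'
    have hm : 0 < min e e0 := lt_min he h0
    refine ⟨tm L (min e e0) (hh _ hm (min_le_right _ _)), ⟨L, min e e0, hL', hm, ?_, ?_⟩, ?_⟩
    · intro e' h1 h2 z
      exact hh e' h1 (h2.trans (min_le_right _ _)) z
    · intro z; rfl
    · exact G_shrink he hv hge hm (min_le_left _ _)
  · set L' := L ++ [((ContinuousMap.const Z 1 : C(Z, ℂ)), w)] with hL'
    have hU : Unit1 K L' := by
      intro p hp
      rcases List.mem_append.1 hp with hp | hp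
      · exact hL.1 p hp
      · rw [List.mem_singleton] at hp
        subst hp
        exact ⟨hw, fun z => by simp⟩
    have hG : Good K (α :: A) L' := by
      refine ⟨hU, fun β hβ => ?_⟩
      rcases List.mem_cons.1 hβ with rfl | hβ
      · exact ⟨_, List.mem_append_right _ (List.mem_singleton.2 rfl), by simp [hα]⟩
      · obtain ⟨p, hp, hp'⟩ := hL.2 β hβ
        exact ⟨p, List.mem_append_left _ hp, hp'⟩
    obtain ⟨e0, h0, hh⟩ := good_valid hG
    have hm : 0 < min e e0 := lt_min he h0
    obtain ⟨e1, he1, h2⟩ := ((good_ev hL (fun β => ‖β w‖)).and (Ioc_mem_nhdsGT hm)).exists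
    have hv1 := hv e1 h2.1 (h2.2.trans (min_le_left _ _))
    refine ⟨tm L' e1 (hh _ h2.1 (h2.2.trans (min_le_right _ _))), ⟨L', e1, hG, h2.1, ?_, ?_⟩, ?_⟩
    · intro e' h3 h4 z
      exact hh e' h3 (h4.trans (h2.2.trans (min_le_right _ _))) z
    · intro z; rfl
    · refine (G_shrink he hv hge h2.1 (h2.2.trans (min_le_left _ _))).trans ?_
      refine homot (fun q => F L e1 q.2 + ((q.1 : ℂ) * (e1:ℂ) ^ L.length) • w) ?_ ?_ ?_ ?_
      · have := (F_cont L).comp (by fun_prop : Continuous (fun q : ℝ × Z => ((e1, q.2) : ℝ × Z)))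
        have h3 : Continuous (fun q : ℝ × Z => F L e1 q.2) := this
        fun_prop
      · intro t ht0 ht1 z
        refine ⟨K.add_mem (hv1 z).1 (K.smul_mem _ hw), fun β hβ => ?_⟩
        have h3 := he1 β hβ z
        intro h4
        rw [map_add, map_smul, smul_eq_mul] at h4
        have h5 : ‖β (F L e1 z)‖ = ‖(t:ℂ) * (e1:ℂ)^L.length * β w‖ := by
          rw [eq_neg_of_add_eq_zero_left h4, norm_neg]
        rw [norm_mul, norm_mul, norm_pow, Complex.norm_real, Complex.norm_real, Real.norm_eq_abs,
          Real.norm_eq_abs, abs_of_nonneg ht0, abs_of_pos h2.1] at h5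
        have h6 : 0 ≤ ‖β w‖ * e1 ^ L.length := by have := h2.1; positivity
        nlinarith
      · intro z
        simp [tm]
      · intro z
        show _ = F L' e1 z
        rw [hL', F_append]
        simp

end

end ArrTop

/-! ### Deletion-restriction -/

namespace ArrTop

noncomputable section

open Filter Topology

lemma incl_open' {E : Type} [TopologicalSpace E] {s t : Set E} (h : s ⊆ t) {o : Set E}
    (ho : IsOpen o) (hs : ∀ x ∈ t, x ∈ s ↔ x ∈ o) :
    Topology.IsOpenEmbedding (incl h) := by
  refine ⟨Topology.IsEmbedding.inclusion h, ?_⟩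
  have : Set.range (incl h) = (Subtype.val : t → E) ⁻¹' o := by
    ext x
    constructor
    · rintro ⟨y, rfl⟩
      exact (hs _ (h y.2)).1 y.2
    · intro hx
      exact ⟨⟨x.1, (hs _ x.2).2 hx⟩, rfl⟩
  rw [this]
  exact ho.preimage continuous_subtype_val

lemma mv_set' {E : Type} [TopologicalSpace E] {w p q r : Set E} {op oq : Set E}
    (hop : IsOpen op) (hoq : IsOpen oq) (hp : ∀ x ∈ r, x ∈ p ↔ x ∈ op) (hq : ∀ x ∈ r, x ∈ q ↔ x ∈ oq)
    (hwp : w ⊆ p) (hwq : w ⊆ q) (hpr : p ⊆ r) (hqr : q ⊆ r) (hw : ∀ x, x ∈ p → x ∈ q → x ∈ w)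
    (hr : ∀ x ∈ r, x ∈ p ∨ x ∈ q) : MV (incl hwp) (incl hwq) (incl hpr) (incl hqr) where
  comm := rfl
  emb := Topology.IsEmbedding.inclusion hwp
  openP := incl_open' _ hop hp
  openQ := incl_open' _ hoq hq
  cover := by
    rw [Set.eq_univ_iff_forall]
    intro x
    rcases hr x.1 x.2 with h | h
    · left; exact ⟨⟨x.1, h⟩, rfl⟩
    · right; exact ⟨⟨x.1, h⟩, rfl⟩
  pull := by
    intro a b e
    have e' : (a : E) = b := congrArg Subtype.val e
    exact ⟨⟨a.1, hw _ a.2 (e' ▸ b.2)⟩, rfl⟩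

variable {V : Type} [NormedAddCommGroup V] [NormedSpace ℂ V]

/-- projection -/
def hpj (α : V →L[ℂ] ℂ) (w : V) (z : V) : V := z - α z • w

/-- tube around a hyperplane -/
def Nb (K : Submodule ℂ V) (α : V →L[ℂ] ℂ) (w : V) (A : List (V →L[ℂ] ℂ)) : Set V :=
  {z | z ∈ K ∧ ∀ β ∈ A, ‖α z‖ * ‖β w‖ < ‖β (hpj α w z)‖}

/-- punctured tube -/
def Wb (K : Submodule ℂ V) (α : V →L[ℂ] ℂ) (w : V) (A : List (V →L[ℂ] ℂ)) : Set V :=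
  {z | z ∈ Nb K α w A ∧ α z ≠ 0}

/-- kernel -/
abbrev kr (K : Submodule ℂ V) (α : V →L[ℂ] ℂ) : Submodule ℂ V := K ⊓ LinearMap.ker α.toLinearMap

section

variable {K : Submodule ℂ V} {α : V →L[ℂ] ℂ} {A : List (V →L[ℂ] ℂ)} {w : V}

lemma α_hpj (hα : α w = 1) (z : V) : α (hpj α w z) = 0 := by simp [hpj, hα]

lemma hpj_add (z : V) : hpj α w z + α z • w = z := by simp [hpj]

lemma hpj_mem (hw : w ∈ K) (hα : α w = 1) {z : V} (hz : z ∈ K) : hpj α w z ∈ kr K α :=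
  ⟨K.sub_mem hz (K.smul_mem _ hw), α_hpj hα z⟩

lemma hpj_cont : Continuous (hpj α w) := by unfold hpj; fun_prop

lemma α_Y {y : V} (hy : y ∈ M (kr K α) A) : α y = 0 := hy.1.2

lemma α_at (hα : α w = 1) {y : V} (hy : α y = 0) (c : ℂ) : α (y + c • w) = c := by
  simp [hy, hα]

lemma hpj_at (hα : α w = 1) {y : V} (hy : α y = 0) (c : ℂ) : hpj α w (y + c • w) = y := by
  rw [hpj, α_at hα hy]; simp

lemma at_Nb (hw : w ∈ K) (hα : α w = 1) {y : V} (hy : y ∈ M (kr K α) A) {c : ℂ}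
    (hc : ∀ β ∈ A, ‖c‖ * ‖β w‖ < ‖β y‖) : y + c • w ∈ Nb K α w A := by
  refine ⟨K.add_mem hy.1.1 (K.smul_mem _ hw), fun β hβ => ?_⟩
  rw [hpj_at hα (α_Y hy), α_at hα (α_Y hy)]
  exact hc β hβ

lemma at_Wb (hw : w ∈ K) (hα : α w = 1) {y : V} (hy : y ∈ M (kr K α) A) {c : ℂ} (h0 : c ≠ 0)
    (hc : ∀ β ∈ A, ‖c‖ * ‖β w‖ < ‖β y‖) : y + c • w ∈ Wb K α w A := by
  refine ⟨at_Nb hw hα hy hc, ?_⟩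
  rwa [α_at hα (α_Y hy)]

lemma hpj_Y (hw : w ∈ K) (hα : α w = 1) {z : V} (hz : z ∈ Nb K α w A) :
    hpj α w z ∈ M (kr K α) A := by
  refine ⟨hpj_mem hw hα hz.1, fun β hβ h => ?_⟩
  have := hz.2 β hβ
  rw [h, norm_zero] at this
  exact absurd this (not_lt.2 (by positivity))

lemma Wb_sub_Nb : Wb K α w A ⊆ Nb K α w A := fun _ h => h.1

lemma Nb_sub_M : Nb K α w A ⊆ M K A := by
  intro z hz
  refine ⟨hz.1, fun β hβ h => ?_⟩
  have h1 := hz.2 β hβ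
  have : β (hpj α w z) = - (α z * β w) := by
    simp [hpj, h]
  rw [this, norm_neg, norm_mul] at h1
  exact lt_irrefl _ h1

lemma Wb_sub_M : Wb K α w A ⊆ M K (α :: A) := by
  intro z hz
  refine ⟨hz.1.1, fun β hβ => ?_⟩
  rcases List.mem_cons.1 hβ with rfl | hβ
  · exact hz.2
  · exact (Nb_sub_M hz.1).2 β hβ

lemma mvM : MV (incl (Wb_sub_Nb (K := K) (α := α) (w := w) (A := A))) (incl Wb_sub_M)
    (incl Nb_sub_M) (incl (M_cons_sub K α A)) := by
  apply mv_set' (op := {z | ∀ β ∈ A, ‖α z‖ * ‖β w‖ < ‖β (hpj α w z)‖}) (oq := {z | α z ≠ 0})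
  · have : {z | ∀ β ∈ A, ‖α z‖ * ‖β w‖ < ‖β (hpj α w z)‖} =
        ⋂ β ∈ {β | β ∈ A}, {z | ‖α z‖ * ‖β w‖ < ‖β (hpj α w z)‖} := by
      ext z; simp
    rw [this]
    refine (List.finite_toSet A).isOpen_biInter (fun β _ => ?_)
    have := hpj_cont (α := α) (w := w)
    exact isOpen_lt (by fun_prop) (by fun_prop)
  · exact isOpen_ne_fun (by fun_prop) (by fun_prop)
  · intro x hx
    exact ⟨fun h => h.2, fun h => ⟨hx.1, h⟩⟩
  · intro x hx
    refine ⟨fun h => h.2 α (by simp), fun h => ⟨hx.1, fun β hβ => ?_⟩⟩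
    rcases List.mem_cons.1 hβ with rfl | hβ
    · exact h
    · exact hx.2 β hβ
  · intro x h1 h2
    exact ⟨h1, h2.2 α (by simp)⟩
  · intro x hx
    by_cases h : α x = 0
    · left
      refine ⟨hx.1, fun β hβ => ?_⟩
      simp only [hpj, h, zero_smul, sub_zero, norm_zero, zero_mul]
      exact norm_pos_iff.2 (hx.2 β hβ)
    · right
      refine ⟨hx.1, fun β hβ => ?_⟩
      rcases List.mem_cons.1 hβ with rfl | hβ
      · exact h
      · exact hx.2 β hβ

lemma Y_sub_Nb (hw : w ∈ K) (hα : α w = 1) : M (kr K α) A ⊆ Nb K α w A := by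
  intro y hy
  have := at_Nb hw hα hy (c := 0) (fun β hβ => by simpa using hy.2 β hβ)
  simpa using this

/-- the tube retracts to the hyperplane -/
def eqN (hw : w ∈ K) (hα : α w = 1) :
    ContinuousMap.HomotopyEquiv (Nb K α w A) (M (kr K α) A) where
  toFun := ⟨fun z => ⟨hpj α w z, hpj_Y hw hα z.2⟩,
    Continuous.subtype_mk (hpj_cont.comp continuous_subtype_val) _⟩
  invFun := ⟨fun y => ⟨y, Y_sub_Nb hw hα y.2⟩,
    Continuous.subtype_mk continuous_subtype_val (fun y => Y_sub_Nb hw hα y.2)⟩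
  left_inv := by
    refine homot (fun q => hpj α w q.2 + ((q.1 : ℂ) * α q.2) • w) ?_ ?_ ?_ ?_
    · have := (hpj_cont (α := α) (w := w)).comp
        (by fun_prop : Continuous (fun q : ℝ × Nb K α w A => (q.2 : V)))
      have h3 : Continuous (fun q : ℝ × Nb K α w A => hpj α w q.2) := this
      fun_prop
    · intro t h0 h1 z
      refine at_Nb hw hα (hpj_Y hw hα z.2) (fun β hβ => ?_)
      have := z.2.2 β hβ
      refine lt_of_le_of_lt ?_ this
      rw [norm_mul, Complex.norm_real, Real.norm_eq_abs, abs_of_nonneg h0]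
      gcongr
      exact mul_le_of_le_one_left (norm_nonneg _) h1
    · intro z; simp
    · intro z; simp [hpj]
  right_inv := by
    have : ∀ f : C(M (kr K α) A, M (kr K α) A), (∀ y, (f y : V) = y) →
        f.Homotopic (ContinuousMap.id _) := by
      intro f hf
      have : f = ContinuousMap.id _ := by ext1 y; exact Subtype.ext (hf y)
      rw [this]
    apply this
    intro y
    show hpj α w y = y
    rw [hpj, α_Y y.2]; simp

/-- radius function -/
def rad (w : V) (A : List (V →L[ℂ] ℂ)) (y : V) : ℝ :=
  1 / (1 + (A.map (fun β => ‖β w‖ / ‖β y‖)).sum)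

lemma sum_nn (w : V) (A : List (V →L[ℂ] ℂ)) (y : V) :
    0 ≤ (A.map (fun β => ‖β w‖ / ‖β y‖)).sum := by
  apply List.sum_nonneg
  intro x hx
  obtain ⟨β, -, rfl⟩ := List.mem_map.1 hx
  positivity

lemma rad_pos (w : V) (A : List (V →L[ℂ] ℂ)) (y : V) : 0 < rad w A y := by
  have := sum_nn w A y
  unfold rad; positivity

lemma rad_lt {y : V} (hy : y ∈ M K A) {β : V →L[ℂ] ℂ} (hβ : β ∈ A) :
    rad w A y * ‖β w‖ < ‖β y‖ := by
  have h0 : 0 < ‖β y‖ := norm_pos_iff.2 (hy.2 β hβ)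
  have h1 : ‖β w‖ / ‖β y‖ ≤ (A.map (fun β => ‖β w‖ / ‖β y‖)).sum := by
    apply List.single_le_sum
    · intro x hx
      obtain ⟨β, -, rfl⟩ := List.mem_map.1 hx
      positivity
    · exact List.mem_map.2 ⟨β, hβ, rfl⟩
  have := sum_nn w A y
  rw [rad, div_mul_eq_mul_div, one_mul, div_lt_iff₀ (by positivity)]
  rw [div_le_iff₀ h0] at h1
  nlinarith

lemma rad_cont : Continuous (fun y : M K A => rad w A y) := by
  unfold rad
  refine continuous_const.div (continuous_const.add ?_) (fun y => ?_)
  · refine continuous_list_sum _ (fun β hβ => ?_)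
    refine continuous_const.div (by fun_prop) (fun y => ?_)
    exact norm_ne_zero_iff.2 (y.2.2 β hβ)
  · have := sum_nn w A y
    positivity

/-- coefficient -/
def cf (w : V) (A : List (V →L[ℂ] ℂ)) (y : V) (l : ℂ) : ℝ := rad w A y / (1 + ‖l‖)

lemma cf_pos (w : V) (A : List (V →L[ℂ] ℂ)) (y : V) (l : ℂ) : 0 < cf w A y l := by
  have := rad_pos w A y
  unfold cf; positivity

lemma cf_lt {y : V} (hy : y ∈ M K A) (l : ℂ) {β : V →L[ℂ] ℂ} (hβ : β ∈ A) :
    cf w A y l * ‖l‖ * ‖β w‖ < ‖β y‖ := by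
  refine lt_of_le_of_lt ?_ (rad_lt (w := w) hy hβ)
  gcongr
  rw [cf, div_mul_eq_mul_div, div_le_iff₀ (by positivity)]
  have := rad_pos w A y
  nlinarith [norm_nonneg l]

lemma cf_cont : Continuous (fun q : M K A × cX => cf w A q.1 q.2) := by
  unfold cf
  refine Continuous.div (rad_cont.comp continuous_fst) (by fun_prop) (fun q => by positivity)

/-- a positive coefficient keeps us in the punctured tube -/
lemma at_W (hw : w ∈ K) (hα : α w = 1) {y : V} (hy : y ∈ M (kr K α) A) {l : ℂ} (hl : l ≠ 0) {c : ℝ}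
    (hc : 0 < c) (h : ∀ β ∈ A, c * ‖l‖ * ‖β w‖ < ‖β y‖) : y + ((c : ℂ) * l) • w ∈ Wb K α w A := by
  apply at_Wb hw hα hy
  · exact mul_ne_zero (by exact_mod_cast hc.ne') hl
  · intro β hβ
    rw [norm_mul, Complex.norm_real, Real.norm_eq_abs, abs_of_pos hc]
    exact h β hβ

/-- parametrization of the punctured tube -/
def phi (hw : w ∈ K) (hα : α w = 1) : C(M (kr K α) A × cX, Wb K α w A) where
  toFun q := ⟨q.1 + ((cf w A q.1 q.2 : ℂ) * q.2) • w,
    at_W hw hα q.1.2 q.2.2 (cf_pos _ _ _ _) (fun _ hβ => cf_lt q.1.2 _ hβ)⟩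
  continuous_toFun := by
    apply Continuous.subtype_mk
    have := cf_cont (K := kr K α) (A := A) (w := w)
    fun_prop

lemma conv_pos {a b t : ℝ} (ha : 0 < a) (hb : 0 < b) (h0 : 0 ≤ t) (h1 : t ≤ 1) :
    0 < (1 - t) * a + t * b := by
  rcases eq_or_lt_of_le h0 with rfl | h
  · simpa using ha
  · have := mul_pos h hb
    have := mul_nonneg (sub_nonneg.2 h1) ha.le
    linarith

lemma conv_lt {a b t s B : ℝ} (ha : a * s < B) (hb : b * s < B) (h0 : 0 ≤ t) (h1 : t ≤ 1) :
    ((1 - t) * a + t * b) * s < B := by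
  have := conv_pos (sub_pos.2 ha) (sub_pos.2 hb) h0 h1
  nlinarith

/-- punctured tube is a product up to homotopy -/
def eqW (hw : w ∈ K) (hα : α w = 1) :
    ContinuousMap.HomotopyEquiv (M (kr K α) A × cX) (Wb K α w A) where
  toFun := phi hw hα
  invFun := ⟨fun z => (⟨hpj α w z, hpj_Y hw hα z.2.1⟩, ⟨α z, z.2.2⟩), by
    have := (hpj_cont (α := α) (w := w)).comp
        (by fun_prop : Continuous (fun q : Wb K α w A => (q : V)))
    exact (Continuous.subtype_mk this _).prodMk (Continuous.subtype_mk (by fun_prop) _)⟩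
  left_inv := by
    refine ⟨⟨⟨fun q => (q.2.1, ⟨(((1 - q.1.1) * cf w A q.2.1 q.2.2 + q.1.1 * 1 : ℝ) : ℂ) * q.2.2,
      mul_ne_zero ?_ q.2.2.2⟩), ?_⟩, ?_, ?_⟩⟩
    · exact_mod_cast (conv_pos (cf_pos w A q.2.1 q.2.2) one_pos q.1.2.1 q.1.2.2).ne'
    · refine Continuous.prodMk (by fun_prop) (Continuous.subtype_mk ?_ _)
      have h1 := (cf_cont (K := kr K α) (A := A) (w := w)).comp (by fun_prop :
        Continuous (fun q : unitInterval × (M (kr K α) A × cX) => q.2))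
      have h2 : Continuous (fun q : unitInterval × (M (kr K α) A × cX) => cf w A q.2.1 q.2.2) := h1
      fun_prop
    · rintro ⟨y, l⟩
      refine Prod.ext (Subtype.ext ?_) (Subtype.ext ?_)
      · exact (hpj_at hα (α_Y y.2) _).symm
      · refine Eq.trans ?_ (α_at hα (α_Y y.2) _).symm
        simp
    · rintro ⟨y, l⟩
      refine Prod.ext rfl (Subtype.ext ?_)
      simp
  right_inv := by
    refine homot (fun q => hpj α w q.2 +
      ((((1 - q.1) * cf w A (hpj α w q.2) (α q.2) + q.1 * 1 : ℝ) : ℂ) * α q.2) • w) ?_ ?_ ?_ ?_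
    · have h0 := (hpj_cont (α := α) (w := w)).comp
        (by fun_prop : Continuous (fun q : ℝ × Wb K α w A => (q.2 : V)))
      have h1 := (cf_cont (K := kr K α) (A := A) (w := w)).comp ((Continuous.subtype_mk h0
        (fun q => hpj_Y hw hα q.2.2.1)).prodMk (Continuous.subtype_mk (by fun_prop :
          Continuous (fun q : ℝ × Wb K α w A => α q.2)) (fun q => q.2.2.2)))
      have h2 : Continuous (fun q : ℝ × Wb K α w A => cf w A (hpj α w q.2) (α q.2)) := h1
      have h3 : Continuous (fun q : ℝ × Wb K α w A => hpj α w q.2) := h0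
      fun_prop
    · intro t h0 h1 z
      refine at_W hw hα (hpj_Y hw hα z.2.1) z.2.2 (conv_pos (cf_pos _ _ _ _) one_pos h0 h1)
        (fun β hβ => ?_)
      rw [mul_assoc]
      refine conv_lt ?_ ?_ h0 h1
      · rw [← mul_assoc]
        exact cf_lt (hpj_Y hw hα z.2.1) _ hβ
      · rw [one_mul]
        exact z.2.1.2 β hβ
    · intro z
      simp [phi]
    · intro z
      simp [hpj]

/-- tori in the punctured tube -/
lemma torus_tube (hw : w ∈ K) (hα : α w = 1) {Z : Type} [TopologicalSpace Z]
    (g : C(Z, M (kr K α) A)) (hg : G (kr K α) A Z g) :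
    ∃ g' : C(Z × cX, M K (α :: A)), G K (α :: A) (Z × cX) g' ∧
      ((incl Wb_sub_M).comp ((phi hw hα).comp (fmap g cX))).Homotopic g' := by
  obtain ⟨L, e, hL, he, hv, hge⟩ := hg
  set u : C(Z × cX, ℂ) := ⟨fun q => (((‖(q.2 : ℂ)‖)⁻¹ : ℝ) : ℂ) * q.2, by
    have : Continuous (fun q : Z × cX => (‖(q.2 : ℂ)‖)⁻¹) :=
      Continuous.inv₀ (by fun_prop) (fun q => norm_ne_zero_iff.2 q.2.2)
    fun_prop⟩ with hu
  set L1 : List (C(Z × cX, ℂ) × V) := L.map (fun p => (p.1.comp ContinuousMap.fst, p.2)) with hL1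
  set L' := L1 ++ [(u, w)] with hL'
  have hU : Unit1 K L' := by
    intro p hp
    rcases List.mem_append.1 hp with hp | hp
    · obtain ⟨q, hq, rfl⟩ := List.mem_map.1 hp
      exact ⟨(hL.1 q hq).1.1, fun z => (hL.1 q hq).2 z.1⟩
    · rw [List.mem_singleton] at hp
      subst hp
      refine ⟨hw, fun z => ?_⟩
      have : ‖(z.2 : ℂ)‖ ≠ 0 := norm_ne_zero_iff.2 z.2.2
      simp [hu, this]
  have hG : Good K (α :: A) L' := by
    refine ⟨hU, fun β hβ => ?_⟩
    rcases List.mem_cons.1 hβ with rfl | hβ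
    · exact ⟨_, List.mem_append_right _ (List.mem_singleton.2 rfl), by simp [hα]⟩
    · obtain ⟨p, hp, hp'⟩ := hL.2 β hβ
      exact ⟨_, List.mem_append_left _ (List.mem_map.2 ⟨p, hp, rfl⟩), hp'⟩
  obtain ⟨e0, h0, hh⟩ := good_valid hG
  have hm : 0 < min e e0 := lt_min he h0
  obtain ⟨e1, he1, h2⟩ := ((good_ev hL (fun β => ‖β w‖)).and (Ioc_mem_nhdsGT hm)).exists
  have hv1 := hv e1 h2.1 (h2.2.trans (min_le_left _ _))
  refine ⟨tm L' e1 (hh _ h2.1 (h2.2.trans (min_le_right _ _))), ⟨L', e1, hG, h2.1, ?_, ?_⟩, ?_⟩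
  · intro e' h3 h4 z
    exact hh e' h3 (h4.trans (h2.2.trans (min_le_right _ _))) z
  · intro z; rfl
  · have hs := G_shrink he hv hge h2.1 (h2.2.trans (min_le_left _ _))
    have hs2 := hs.prodMap (ContinuousMap.Homotopic.refl (ContinuousMap.id cX))
    have hs3 := (ContinuousMap.Homotopic.refl ((incl Wb_sub_M).comp
      (phi (A := A) hw hα))).comp hs2
    refine ContinuousMap.Homotopic.trans hs3 ?_
    refine homot (fun q => F L e1 q.2.1 + ((((1 - q.1) * cf w A (F L e1 q.2.1) q.2.2 +
      q.1 * (e1 ^ L.length * ‖(q.2.2 : ℂ)‖⁻¹) : ℝ) : ℂ) * q.2.2) • w) ?_ ?_ ?_ ?_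
    · have h3 : Continuous (fun q : ℝ × (Z × cX) => F L e1 q.2.1) := (F_cont L).comp
        (by fun_prop : Continuous (fun q : ℝ × (Z × cX) => ((e1, q.2.1) : ℝ × Z)))
      have h1 := (cf_cont (K := kr K α) (A := A) (w := w)).comp ((Continuous.subtype_mk h3
        (fun q => hv1 q.2.1)).prodMk
          (by fun_prop : Continuous (fun q : ℝ × (Z × cX) => q.2.2)))
      have h2 : Continuous (fun q : ℝ × (Z × cX) => cf w A (F L e1 q.2.1) q.2.2) := h1
      have h4 : Continuous (fun q : ℝ × (Z × cX) => (‖(q.2.2 : ℂ)‖)⁻¹) :=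
        Continuous.inv₀ (by fun_prop) (fun q => norm_ne_zero_iff.2 q.2.2.2)
      fun_prop
    · intro t ht0 ht1 z
      have hz : 0 < ‖(z.2 : ℂ)‖ := norm_pos_iff.2 z.2.2
      refine Wb_sub_M (at_W hw hα (hv1 z.1) z.2.2 (conv_pos (cf_pos _ _ _ _) ?_ ht0 ht1)
        (fun β hβ => ?_))
      · have := h2.1; positivity
      · rw [mul_assoc]
        refine conv_lt ?_ ?_ ht0 ht1
        · rw [← mul_assoc]
          exact cf_lt (hv1 z.1) _ hβ
        · have := he1 β hβ z.1
          rw [← mul_assoc, mul_assoc (e1 ^ _), inv_mul_cancel₀ hz.ne', mul_one, mul_comm]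
          exact this
    · intro z
      simp [phi, incl, tm]
    · intro z
      show _ = F L' e1 z
      rw [hL', F_append, hL1, F_pull, List.length_map]
      simp [hu, mul_assoc]

end

end

end ArrTop

/-! ### The recursion for Betti numbers -/

namespace ArrTop

noncomputable section

variable {V : Type} [NormedAddCommGroup V] [NormedSpace ℂ V]

/-- Betti number -/
def bt (X : Type) [TopologicalSpace X] (k : ℕ) : ℕ := finrank ℚ (H X k)

/-- inductive property -/
def PP (K : Submodule ℂ V) (A : List (V →L[ℂ] ℂ)) : Prop :=
  ∀ k, FiniteDimensional ℚ (H (M K A) k) ∧ ∀ x : H (M K A) k, x ∈ Tor K A k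

section step

variable {K : Submodule ℂ V} {α : V →L[ℂ] ℂ} {A : List (V →L[ℂ] ℂ)} {w : V}

lemma jQ_lift (hw : w ∈ K) (hα : α w = 1) (h1 : PP K A) (k : ℕ) (x : H (M K A) k) :
    ∃ t ∈ Tor K (α :: A) k, Hm (incl (M_cons_sub K α A)) k t = x := by
  have := (h1 k).2 x
  unfold Tor at this
  induction this using Submodule.span_induction with
  | mem y hy =>
    obtain ⟨Z, _, g, z, hg, rfl⟩ := hy
    obtain ⟨g', hg', hh⟩ := torus_lift hw hα g hg
    refine ⟨Hm g' k z, Submodule.subset_span ⟨Z, _, g', z, hg', rfl⟩, ?_⟩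
    rw [Hm_comp, Hm_homotopic hh]
  | zero => exact ⟨0, Submodule.zero_mem _, map_zero _⟩
  | add a b _ _ ha hb =>
    obtain ⟨y, hy, rfl⟩ := ha
    obtain ⟨y', hy', rfl⟩ := hb
    exact ⟨y + y', Submodule.add_mem _ hy hy', map_add _ _ _⟩
  | smul q a _ ha =>
    obtain ⟨y, hy, rfl⟩ := ha
    exact ⟨q • y, Submodule.smul_mem _ _ hy, map_smul _ _ _⟩

lemma W_Tor (hw : w ∈ K) (hα : α w = 1) (h2 : PP (kr K α) A) (k : ℕ) (c : H (Wb K α w A) k) :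
    Hm (incl Wb_sub_M) k c ∈ Tor K (α :: A) k := by
  obtain ⟨c', rfl⟩ := (Hequiv (eqW (A := A) hw hα) k).surjective c
  have := k_span (fun Z _ g => G (kr K α) A Z g) (fun k x => (h2 k).2 x) k
    ((Tor K (α :: A) k).comap ((Hm (incl Wb_sub_M) k).comp (Hm (phi hw hα) k))) ?_ c'
  · rw [Hequiv_apply]
    exact this
  · intro Z _ g x hg
    obtain ⟨g', hg', hh⟩ := torus_tube hw hα g hg
    rw [Submodule.mem_comap, LinearMap.comp_apply, Hm_comp, Hm_comp, ContinuousMap.comp_assoc,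
      Hm_homotopic hh]
    exact Submodule.subset_span ⟨_, _, g', x, hg', rfl⟩

lemma ker_jQ (k : ℕ) (x : H (M K (α :: A)) k) (hx : Hm (incl (M_cons_sub K α A)) k x = 0) :
    ∃ c : H (Wb K α w A) k, Hm (incl Wb_sub_Nb) k c = 0 ∧ Hm (incl Wb_sub_M) k c = x :=
  (mvM (K := K) (α := α) (w := w) (A := A)).middle k 0 x (by rw [map_zero, hx])

lemma W_inj2 (hw : w ∈ K) (hα : α w = 1) (h1 : PP K A) (k : ℕ) (c : H (Wb K α w A) k)
    (ha : Hm (incl Wb_sub_Nb) k c = 0) (hb : Hm (incl Wb_sub_M) k c = 0) : c = 0 := by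
  obtain ⟨x, rfl⟩ := (mvM (K := K) (α := α) (w := w) (A := A)).del_surj k c ha hb
  obtain ⟨t, -, rfl⟩ := jQ_lift hw hα h1 (k+1) x
  exact (mvM (K := K) (α := α) (w := w) (A := A)).del_jQ k t

lemma finW (hw : w ∈ K) (hα : α w = 1) (h2 : PP (kr K α) A) (k : ℕ) :
    FiniteDimensional ℚ (H (Wb K α w A) k) := by
  have := k_fin (fun k => (h2 k).1) k
  exact Module.Finite.equiv (Hequiv (eqW (A := A) hw hα) k)

lemma finN (hw : w ∈ K) (hα : α w = 1) (h2 : PP (kr K α) A) (k : ℕ) :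
    FiniteDimensional ℚ (H (Nb K α w A) k) := by
  have := (h2 k).1
  exact Module.Finite.equiv (Hequiv (eqN (A := A) hw hα) k).symm

lemma PP_step (hw : w ∈ K) (hα : α w = 1) (h1 : PP K A) (h2 : PP (kr K α) A) :
    PP K (α :: A) := by
  intro k
  constructor
  · have := finW hw hα h2 k
    have := (h1 k).1
    set j := Hm (incl (M_cons_sub K α A)) k with hj
    have a1 : FiniteDimensional ℚ (LinearMap.ker j) := by
      have : LinearMap.ker j ≤ LinearMap.range (Hm (incl (Wb_sub_M (K := K) (α := α) (w := w)
          (A := A))) k) := by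
        intro x hx
        obtain ⟨c, -, hc⟩ := ker_jQ (w := w) k x hx
        exact ⟨c, hc⟩
      exact Submodule.finiteDimensional_of_le this
    have a2 : FiniteDimensional ℚ (H (M K (α :: A)) k ⧸ LinearMap.ker j) :=
      Module.Finite.equiv j.quotKerEquivRange.symm
    exact Module.Finite.of_submodule_quotient (LinearMap.ker j)
  · intro x
    obtain ⟨t, ht, e⟩ := jQ_lift hw hα h1 k (Hm (incl (M_cons_sub K α A)) k x)
    obtain ⟨c, -, hc⟩ := ker_jQ (w := w) k (x - t) (by rw [map_sub, e, sub_self])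
    have := Submodule.add_mem _ (W_Tor hw hα h2 k c) ht
    rwa [hc, sub_add_cancel] at this

lemma dim_step (hw : w ∈ K) (hα : α w = 1) (h1 : PP K A) (h2 : PP (kr K α) A) (k : ℕ) :
    bt (M (kr K α) A × cX) k + bt (M K A) k = bt (M (kr K α) A) k + bt (M K (α :: A)) k := by
  have i1 := finW hw hα h2 k
  have i2 := finN hw hα h2 k
  have i3 := (PP_step hw hα h1 h2 k).1
  have i4 := (h1 k).1
  set iP := Hm (incl (Wb_sub_Nb (K := K) (α := α) (w := w) (A := A))) k with hiP
  set iQ := Hm (incl (Wb_sub_M (K := K) (α := α) (w := w) (A := A))) k with hiQ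
  set jP := Hm (incl (Nb_sub_M (K := K) (α := α) (w := w) (A := A))) k with hjP
  set jQ := Hm (incl (M_cons_sub K α A)) k with hjQ
  set f := iP.prod iQ with hf
  set g := jP.coprod (-jQ) with hg
  have e1 : Function.Injective f := by
    rw [← LinearMap.ker_eq_bot, LinearMap.ker_eq_bot']
    intro c hc
    exact W_inj2 hw hα h1 k c (congrArg Prod.fst hc) (congrArg Prod.snd hc)
  have e2 : Function.Surjective g := by
    intro x
    obtain ⟨t, -, e⟩ := jQ_lift hw hα h1 k x
    refine ⟨(0, -t), ?_⟩
    rw [hg, LinearMap.coprod_apply, map_zero, LinearMap.neg_apply, map_neg, neg_neg, zero_add]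
    exact e
  have e3 : LinearMap.ker g = LinearMap.range f := by
    ext ⟨a, b⟩
    rw [LinearMap.mem_ker, hg, LinearMap.coprod_apply, LinearMap.neg_apply, ← sub_eq_add_neg,
      sub_eq_zero]
    constructor
    · intro h
      obtain ⟨c, h1, h2⟩ := (mvM (K := K) (α := α) (w := w) (A := A)).middle k a b h
      exact ⟨c, Prod.ext h1 h2⟩
    · rintro ⟨c, hc⟩
      have h1 : iP c = a := congrArg Prod.fst hc
      have h2 : iQ c = b := congrArg Prod.snd hc
      rw [← h1, ← h2]
      exact (mvM (K := K) (α := α) (w := w) (A := A)).Hcomm k c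
  have e4 := LinearMap.finrank_range_add_finrank_ker g
  rw [e3, LinearMap.range_eq_top.2 e2, finrank_top, LinearMap.finrank_range_of_inj e1,
    Module.finrank_prod] at e4
  have e5 := (Hequiv (eqW (A := A) hw hα) k).finrank_eq
  have e6 := (Hequiv (eqN (A := A) hw hα) k).finrank_eq
  unfold bt
  rw [e5, ← e6]
  omega

end step

lemma M_empty {K : Submodule ℂ V} {α : V →L[ℂ] ℂ} {A : List (V →L[ℂ] ℂ)}
    (h : ∀ w ∈ K, α w = 0) : IsEmpty (M K (α :: A)) :=
  ⟨fun z => z.2.2 α (by simp) (h _ z.2.1)⟩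

lemma nil_eq (K : Submodule ℂ V) : Nonempty (ContinuousMap.HomotopyEquiv Unit (M K [])) := by
  refine ⟨⟨ContinuousMap.const _ ⟨0, K.zero_mem, by simp⟩, ContinuousMap.const _ (), ?_, ?_⟩⟩
  · exact ContinuousMap.Homotopic.refl _
  · refine homot (fun q => (q.1 : ℂ) • (q.2 : V)) (by fun_prop) ?_ ?_ ?_
    · intro t _ _ z
      exact ⟨K.smul_mem _ z.2.1, by simp⟩
    · intro z; simp
    · intro z; simp

lemma PP_nil (K : Submodule ℂ V) : PP K [] := by
  intro k
  obtain ⟨e⟩ := nil_eq K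
  have hf : FiniteDimensional ℚ (H Unit k) := by
    cases k with
    | zero => exact Module.Finite.equiv H_unit_zero.symm
    | succ k =>
      have : Subsingleton (H Unit (k+1)) := ⟨fun a b => by rw [H_unit_succ k a, H_unit_succ k b]⟩
      infer_instance
  refine ⟨Module.Finite.equiv (Hequiv e k), fun x => ?_⟩
  refine Submodule.subset_span ⟨M K [], inferInstance, ContinuousMap.const _ ⟨0, K.zero_mem, by simp⟩,
    x, ⟨[], 1, ⟨by simp [Unit1], by simp⟩, one_pos, ?_, ?_⟩, ?_⟩
  · intro e' _ _ z
    exact ⟨K.zero_mem, by simp⟩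
  · intro z; rfl
  · have : (ContinuousMap.const _ ⟨0, K.zero_mem, by simp⟩ : C(M K [], M K [])).Homotopic
        (ContinuousMap.id _) := by
      refine homot (fun q => (q.1 : ℂ) • (q.2 : V)) (by fun_prop) ?_ ?_ ?_
      · intro t _ _ z
        exact ⟨K.smul_mem _ z.2.1, by simp⟩
      · intro z; simp
      · intro z; simp
    rw [Hm_homotopic this, Hm_id]

lemma norm_w {K : Submodule ℂ V} {α : V →L[ℂ] ℂ} (h : ∃ w ∈ K, α w ≠ 0) : ∃ w ∈ K, α w = 1 := by
  obtain ⟨w, hw, h⟩ := h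
  exact ⟨(α w)⁻¹ • w, K.smul_mem _ hw, by simp [h]⟩

theorem PP_all (A : List (V →L[ℂ] ℂ)) : ∀ K : Submodule ℂ V, PP K A := by
  induction A with
  | nil => exact PP_nil
  | cons α A ih =>
    intro K
    by_cases h : ∃ w ∈ K, α w ≠ 0
    · obtain ⟨w, hw, hα⟩ := norm_w h
      exact PP_step hw hα (ih K) (ih _)
    · push Not at h
      have := M_empty (A := A) h
      intro k
      have hs : ∀ x : H (M K (α :: A)) k, x = 0 := H_empty k
      have : Subsingleton (H (M K (α :: A)) k) := ⟨fun a b => by rw [hs a, hs b]⟩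
      exact ⟨inferInstance, fun x => by rw [hs x]; exact Submodule.zero_mem _⟩

theorem bt_cons_zero {K : Submodule ℂ V} {α : V →L[ℂ] ℂ} (A : List (V →L[ℂ] ℂ))
    (h : ∃ w ∈ K, α w ≠ 0) : bt (M K (α :: A)) 0 = bt (M K A) 0 := by
  obtain ⟨w, hw, hα⟩ := norm_w h
  have h1 := dim_step hw hα (PP_all A K) (PP_all A _) 0
  have h2 : bt (M (kr K α) A × cX) 0 = bt (M (kr K α) A) 0 := k_dim_zero
  omega

theorem bt_cons_succ {K : Submodule ℂ V} {α : V →L[ℂ] ℂ} (A : List (V →L[ℂ] ℂ))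
    (h : ∃ w ∈ K, α w ≠ 0) (k : ℕ) :
    bt (M K (α :: A)) (k+1) = bt (M K A) (k+1) + bt (M (kr K α) A) k := by
  obtain ⟨w, hw, hα⟩ := norm_w h
  have h1 := dim_step hw hα (PP_all A K) (PP_all A _) (k+1)
  have h2 : bt (M (kr K α) A × cX) (k+1) = bt (M (kr K α) A) (k+1) + bt (M (kr K α) A) k :=
    k_dim_succ (fun k => (PP_all A _ k).1) k
  omega

theorem bt_cons_empty {K : Submodule ℂ V} {α : V →L[ℂ] ℂ} (A : List (V →L[ℂ] ℂ))
    (h : ∀ w ∈ K, α w = 0) (k : ℕ) : bt (M K (α :: A)) k = 0 := by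
  have := M_empty (A := A) h
  have hs : ∀ x : H (M K (α :: A)) k, x = 0 := H_empty k
  have : Subsingleton (H (M K (α :: A)) k) := ⟨fun a b => by rw [hs a, hs b]⟩
  exact Module.finrank_zero_of_subsingleton

theorem bt_nil_zero (K : Submodule ℂ V) : bt (M K []) 0 = 1 := by
  obtain ⟨e⟩ := nil_eq K
  unfold bt
  rw [← (Hequiv e 0).finrank_eq, H_unit_zero.finrank_eq, Module.finrank_self]

theorem bt_nil_succ (K : Submodule ℂ V) (k : ℕ) : bt (M K []) (k+1) = 0 := by
  obtain ⟨e⟩ := nil_eq K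
  unfold bt
  rw [← (Hequiv e (k+1)).finrank_eq]
  have : Subsingleton (H Unit (k+1)) := ⟨fun a b => by rw [H_unit_succ k a, H_unit_succ k b]⟩
  exact Module.finrank_zero_of_subsingleton

/-- the total Betti number satisfies deletion-restriction -/
theorem bsum_cons {K : Submodule ℂ V} {α : V →L[ℂ] ℂ} (A : List (V →L[ℂ] ℂ))
    (h : ∃ w ∈ K, α w ≠ 0) (d : ℕ) :
    ∑ k ∈ Finset.range (d + 2), bt (M K (α :: A)) k =
      ∑ k ∈ Finset.range (d + 2), bt (M K A) k + ∑ k ∈ Finset.range (d + 1), bt (M (kr K α) A) k := by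
  rw [Finset.sum_range_succ', Finset.sum_range_succ' (fun k => bt (M K A) k), bt_cons_zero A h]
  simp only [bt_cons_succ A h, Finset.sum_add_distrib]
  omega

end

end ArrTop

/-! ### Comparison with categorical singular homology -/

namespace ArrTop

noncomputable section

open Opposite Simplicial

lemma quot_dim {A B C B' A' C' : Type} [AddCommGroup A] [AddCommGroup B] [AddCommGroup C]
    [AddCommGroup A'] [AddCommGroup B'] [AddCommGroup C'] [Module ℚ A] [Module ℚ B] [Module ℚ C]
    [Module ℚ A'] [Module ℚ B'] [Module ℚ C'] (f : A →ₗ[ℚ] B) (g : B →ₗ[ℚ] C) (f' : A' →ₗ[ℚ] B')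
    (g' : B' →ₗ[ℚ] C') (eA : A ≃ₗ[ℚ] A') (eB : B ≃ₗ[ℚ] B') (h1 : ∀ a, eB (f a) = f' (eA a))
    (h2 : ∀ b, g b = 0 ↔ g' (eB b) = 0) (hf : ∀ a, f a ∈ LinearMap.ker g) :
    finrank ℚ (LinearMap.ker g ⧸ LinearMap.range (f.codRestrict _ hf)) =
      finrank ℚ (LinearMap.ker g' ⧸ (LinearMap.range f').comap (LinearMap.ker g').subtype) := by
  have hk : LinearMap.ker g' = (LinearMap.ker g).map (eB : B →ₗ[ℚ] B') := by
    ext b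
    rw [Submodule.mem_map]
    constructor
    · intro hb
      refine ⟨eB.symm b, (h2 _).2 ?_, ?_⟩
      · simpa using hb
      · simp
    · rintro ⟨b, hb, rfl⟩
      exact (h2 b).1 hb
  let e : LinearMap.ker g ≃ₗ[ℚ] LinearMap.ker g' :=
    (eB.submoduleMap (LinearMap.ker g)).trans (LinearEquiv.ofEq _ _ hk.symm)
  have he : ∀ x, (e x : B') = eB x := fun x => rfl
  refine (Submodule.Quotient.equiv _ _ e ?_).finrank_eq
  ext ⟨b, hb⟩
  rw [Submodule.mem_map]
  constructor
  · rintro ⟨x, ⟨a, rfl⟩, hx⟩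
    refine ⟨eA a, ?_⟩
    rw [← h1]
    exact congrArg Subtype.val hx
  · rintro ⟨a, ha⟩
    refine ⟨_, ⟨eA.symm a, rfl⟩, Subtype.ext ?_⟩
    show eB (f (eA.symm a)) = b
    rw [h1]
    simpa using ha

/-- comparison of chains -/
def ce (X : Type) [TopologicalSpace X] (n : ℕ) :
    (singularChains ℚ X).X n ≃ₗ[ℚ] Chain X (n+1) :=
  Finsupp.domLCongr (TopCat.toSSetObjEquiv (TopCat.of X) (op ⦋n⦌))

lemma fc_eq (n : ℕ) (i : Fin (n+1)) (z : Sx n) : fc n i z = stdSimplex.map i.succAbove z := by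
  apply Subtype.ext
  funext j
  have h1 : (fc n i z).1 j = ∑ l, z.1 l * (Pi.single (i.succAbove l) (1:ℝ) : Fin (n+1) → ℝ) j := by
    rw [fc, aff_coe]
    simp [vtx]
  rw [h1]
  show _ = FunOnFinite.linearMap ℝ ℝ i.succAbove z.1 j
  rw [FunOnFinite.linearMap_apply_apply]
  simp [Pi.single_apply, Finset.sum_filter, eq_comm]

lemma ce_gen (X : Type) [TopologicalSpace X] (n : ℕ)
    (σ : (TopCat.toSSet.obj (TopCat.of X)).obj (op ⦋n⦌)) :
    ce X n (ModuleCat.freeMk (R := ℚ) σ) = gen (TopCat.toSSetObjEquiv (TopCat.of X) (op ⦋n⦌) σ) :=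
  Finsupp.domLCongr_single _ _ _

lemma d_gen (X : Type) [TopologicalSpace X] (n : ℕ)
    (σ : (TopCat.toSSet.obj (TopCat.of X)).obj (op ⦋n+1⦌)) :
    ((singularChains ℚ X).d (n+1) n).hom (ModuleCat.freeMk (R := ℚ) σ) =
      ∑ i : Fin (n+2), (-1 : ℤ) ^ (i:ℕ) •
        (ModuleCat.freeMk (R := ℚ) ((TopCat.toSSet.obj (TopCat.of X)).δ i σ) :
          (ModuleCat.free ℚ).obj _) := by
  unfold singularChains
  rw [AlgebraicTopology.alternatingFaceMapComplex_obj_d]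
  unfold AlgebraicTopology.AlternatingFaceMapComplex.objD
  rw [ModuleCat.hom_sum]
  refine (LinearMap.sum_apply _ _ _).trans ?_
  refine Finset.sum_congr rfl (fun i _ => ?_)
  rw [ModuleCat.hom_zsmul]
  refine (LinearMap.smul_apply _ _ _).trans ?_
  congr 1
  exact ModuleCat.free_map_apply _ _

lemma ce_d (X : Type) [TopologicalSpace X] (n : ℕ) (c : (singularChains ℚ X).X (n+1)) :
    ce X n (((singularChains ℚ X).d (n+1) n).hom c) = bd X (n+1) (ce X (n+1) c) := by
  have : (ce X n).toLinearMap ∘ₗ ((singularChains ℚ X).d (n+1) n).hom =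
      (bd X (n+1)) ∘ₗ (ce X (n+1)).toLinearMap := by
    apply Finsupp.lhom_ext'
    intro σ
    apply LinearMap.ext_ring
    show ce X n (((singularChains ℚ X).d (n+1) n).hom (ModuleCat.freeMk (R := ℚ) σ)) =
      bd X (n+1) (ce X (n+1) (ModuleCat.freeMk (R := ℚ) σ))
    rw [d_gen, ce_gen, bd, lift_single]
    refine (map_sum (ce X n) _ _).trans ?_
    refine Finset.sum_congr rfl (fun i _ => ?_)
    refine (map_zsmul (ce X n) _ _).trans ?_
    rw [ce_gen]
    have e1 : (TopCat.toSSetObjEquiv (TopCat.of X) (op ⦋n⦌))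
        ((TopCat.toSSet.obj (TopCat.of X)).δ i σ) =
        ((TopCat.toSSetObjEquiv (TopCat.of X) (op ⦋n+1⦌) σ).comp (fc (n+1) i) :
          C(Sx (n+1), X)) := by
      ext z
      show _ = (TopCat.toSSetObjEquiv (TopCat.of X) (op ⦋n+1⦌) σ) (fc (n+1) i z)
      rw [fc_eq]
      rfl
    rw [e1, ← Int.cast_smul_eq_zsmul ℚ]
    push_cast
    rfl
  exact LinearMap.congr_fun this c

theorem betti_eq (X : Type) [TopologicalSpace X] (k : ℕ) : betti X k = bt X k := by
  unfold betti bt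
  have key : ∀ (j : ℕ) (hj : (ComplexShape.down ℕ).next k = j)
      (h2 : ∀ b, ((singularChains ℚ X).d k j).hom b = 0 ↔ dd X k (ce X k b) = 0),
      finrank ℚ ((singularChains ℚ X).homology k) = finrank ℚ (H X k) := by
    intro j hj h2
    have hi : (ComplexShape.down ℕ).prev k = k + 1 := by simp
    have e1 := ((singularChains ℚ X).homologyIsoSc' (k+1) k j hi hj).toLinearEquiv.finrank_eq
    have e2 := (((singularChains ℚ X).sc' (k+1) k j).moduleCatHomologyIso).toLinearEquiv.finrank_eq
    rw [e1, e2]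
    exact quot_dim _ _ (bd X (k+1)) (dd X k) (ce X (k+1)) (ce X k) (ce_d X k) h2 _
  cases k with
  | zero =>
    refine key 0 (by simp) (fun b => ?_)
    rw [(singularChains ℚ X).shape 0 0 (by simp), dd_zero]
    exact ⟨fun _ => rfl, fun _ => rfl⟩
  | succ k =>
    refine key k (by simp) (fun b => ?_)
    have h : dd X (k+1) = bd X (k+1) := rfl
    rw [h, ← ce_d]
    exact (LinearEquiv.map_eq_zero_iff _).symm

end

end ArrTop

/-! ### Combinatorics -/

namespace ArrFin

noncomputable section

variable {d : ℕ}

/-- the common recursion -/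
def fcount : List (Hyp d) → Hyp d → ℕ
  | [], _ => 1
  | α :: L, K => if K ≤ α then 0 else fcount L K + fcount L (K ⊓ α)

lemma exists_fun (H : Hyp d) (h : IsLinHyp d H) :
    ∃ φ : (Fin d → ℝ) →ₗ[ℝ] ℝ, LinearMap.ker φ = H := by
  by_cases ht : H = ⊤
  · exact ⟨0, by rw [ht]; simp⟩
  · have hlt : H < ⊤ := lt_top_iff_ne_top.2 ht
    obtain ⟨φ, h0, hφ⟩ := Submodule.exists_le_ker_of_lt_top H hlt
    refine ⟨φ, (Submodule.eq_of_le_of_finrank_le hφ ?_).symm⟩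
    have h1 := Module.Dual.finrank_ker_add_one_of_ne_zero h0
    unfold IsLinHyp at h
    simp at h1
    omega

/-- the functional -/
def fn (H : Hyp d) : (Fin d → ℝ) →ₗ[ℝ] ℝ :=
  if h : IsLinHyp d H then (exists_fun H h).choose else 0

lemma ker_fn {H : Hyp d} (h : IsLinHyp d H) : LinearMap.ker (fn H) = H := by
  unfold fn; rw [dif_pos h]; exact (exists_fun H h).choose_spec

lemma fn_eq_zero {H : Hyp d} (h : IsLinHyp d H) (x : Fin d → ℝ) : fn H x = 0 ↔ x ∈ H := by
  rw [← LinearMap.mem_ker, ker_fn h]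

lemma finrank_inf {H : Hyp d} (h : IsLinHyp d H) (K : Hyp d) (hK : ¬ K ≤ H) :
    finrank ℝ (K ⊓ H : Hyp d) + 1 = finrank ℝ K := by
  have h0 : (fn H).domRestrict K ≠ 0 := by
    intro h1
    apply hK
    intro x hx
    rw [← fn_eq_zero h]
    have := LinearMap.congr_fun h1 ⟨x, hx⟩
    simpa using this
  have h1 := Module.Dual.finrank_ker_add_one_of_ne_zero (f := (fn H).domRestrict K) h0
  rw [← h1]
  congr 1
  have h2 : (LinearMap.ker ((fn H).domRestrict K)).map K.subtype = K ⊓ H := by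
    ext x
    simp [fn_eq_zero h]
    tauto
  rw [← h2, Submodule.finrank_map_subtype_eq]

/-! nbc sets -/

/-- span form of the nbc condition -/
def CC (ord : Hyp d → ℕ) (K : Hyp d) (L : List (Hyp d)) (S : Finset (Hyp d)) : Prop :=
  (∀ s ∈ S, s ∈ L) ∧ ∀ x ∈ L, ¬ (K ⊓ (S.filter (fun s => ord x < ord s)).inf id ≤ x)

lemma CC_fin (ord : Hyp d → ℕ) (K : Hyp d) (L : List (Hyp d)) : {S | CC ord K L S}.Finite := by
  refine (L.toFinset.powerset.finite_toSet).subset ?_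
  intro S hS
  simp only [Finset.coe_powerset, Set.mem_preimage, Set.mem_powerset_iff]
  intro s hs
  simpa using hS.1 s hs

lemma CC_cons_not_mem (ord : Hyp d → ℕ) (K α : Hyp d) (L : List (Hyp d)) (S : Finset (Hyp d))
    (hα : α ∉ S) (hL : ∀ x ∈ L, ord x < ord α) :
    CC ord K (α :: L) S ↔ ¬ K ≤ α ∧ CC ord K L S := by
  have key : (∀ s ∈ S, s ∈ L) → S.filter (fun s => ord α < ord s) = ∅ := by
    intro h
    apply Finset.filter_eq_empty_iff.2
    intro s hs
    have := hL s (h s hs)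
    omega
  unfold CC
  constructor
  · rintro ⟨h1, h2⟩
    have h3 : ∀ s ∈ S, s ∈ L := by
      intro s hs
      rcases List.mem_cons.1 (h1 s hs) with h | h
      · exact absurd (h ▸ hs) hα
      · exact h
    refine ⟨?_, h3, fun x hx => h2 x (List.mem_cons_of_mem _ hx)⟩
    have := h2 α List.mem_cons_self
    rw [key h3] at this
    simpa using this
  · rintro ⟨h0, h1, h2⟩
    refine ⟨fun s hs => List.mem_cons_of_mem _ (h1 s hs), ?_⟩
    intro x hx
    rcases List.mem_cons.1 hx with rfl | hx
    · rw [key h1]; simpa using h0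
    · exact h2 x hx

lemma CC_cons_insert (ord : Hyp d → ℕ) (K α : Hyp d) (L : List (Hyp d)) (T : Finset (Hyp d))
    (hα : α ∉ T) (hL : ∀ x ∈ L, ord x < ord α) :
    CC ord K (α :: L) (insert α T) ↔ ¬ K ≤ α ∧ CC ord (K ⊓ α) L T := by
  have key : (∀ s ∈ T, s ∈ L) → (insert α T).filter (fun s => ord α < ord s) = ∅ := by
    intro h
    apply Finset.filter_eq_empty_iff.2
    intro s hs
    rcases Finset.mem_insert.1 hs with rfl | hs
    · omega
    have := hL s (h s hs)
    omega
  have key2 : ∀ x ∈ L, K ⊓ ((insert α T).filter (fun s => ord x < ord s)).inf id =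
      K ⊓ α ⊓ (T.filter (fun s => ord x < ord s)).inf id := by
    intro x hx
    rw [Finset.filter_insert, if_pos (hL x hx), Finset.inf_insert, inf_assoc]
    rfl
  unfold CC
  constructor
  · rintro ⟨h1, h2⟩
    have h3 : ∀ s ∈ T, s ∈ L := by
      intro s hs
      rcases List.mem_cons.1 (h1 s (Finset.mem_insert_of_mem hs)) with h | h
      · exact absurd (h ▸ hs) hα
      · exact h
    refine ⟨?_, h3, fun x hx => ?_⟩
    · have := h2 α List.mem_cons_self
      rw [key h3] at this
      simpa using this
    · rw [← key2 x hx]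
      exact h2 x (List.mem_cons_of_mem _ hx)
  · rintro ⟨h0, h1, h2⟩
    refine ⟨fun s hs => ?_, ?_⟩
    · rcases Finset.mem_insert.1 hs with rfl | hs
      · exact List.mem_cons_self
      · exact List.mem_cons_of_mem _ (h1 s hs)
    intro x hx
    rcases List.mem_cons.1 hx with rfl | hx
    · rw [key h1]; simpa using h0
    · rw [key2 x hx]; exact h2 x hx

lemma nbc_count (ord : Hyp d → ℕ) (L : List (Hyp d)) (hL : L.Pairwise (fun a b => ord b < ord a)) :
    ∀ K : Hyp d, {S | CC ord K L S}.ncard = fcount L K := by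
  induction L with
  | nil =>
    intro K
    have : {S | CC ord K [] S} = {∅} := by
      ext S
      simp [CC, Finset.eq_empty_iff_forall_notMem]
    rw [this, Set.ncard_singleton]; rfl
  | cons α L ih =>
    intro K
    rw [List.pairwise_cons] at hL
    obtain ⟨hα, hL⟩ := hL
    have hn : ∀ K' S, CC ord K' L S → α ∉ S := by
      intro K' S h hs
      have := hα α (h.1 α hs)
      omega
    unfold fcount
    split_ifs with hK
    · have : {S | CC ord K (α :: L) S} = ∅ := by
        ext S
        simp only [Set.mem_ofPred_eq, Set.mem_empty_iff_false, iff_false]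
        intro h
        exact h.2 α List.mem_cons_self (inf_le_left.trans hK)
      rw [this, Set.ncard_empty]
    · have : {S | CC ord K (α :: L) S} = {S | CC ord K L S} ∪
          (insert α) '' {S | CC ord (K ⊓ α) L S} := by
        ext S
        simp only [Set.mem_ofPred_eq, Set.mem_union, Set.mem_image]
        by_cases hs : α ∈ S
        · constructor
          · intro h
            right
            refine ⟨S.erase α, ?_, Finset.insert_erase hs⟩
            rw [← Finset.insert_erase hs, CC_cons_insert ord K α L _ (Finset.notMem_erase _ _) hα] at h
            exact h.2
          · rintro (h | ⟨T, hT, rfl⟩)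
            · exact absurd hs (hn _ _ h)
            · exact (CC_cons_insert ord K α L _ (hn _ _ hT) hα).2 ⟨hK, hT⟩
        · rw [CC_cons_not_mem ord K α L S hs hα]
          constructor
          · exact fun h => Or.inl h.2
          · rintro (h | ⟨T, hT, rfl⟩)
            · exact ⟨hK, h⟩
            · exact absurd (Finset.mem_insert_self _ _) hs
      rw [this, Set.ncard_union_eq ?_ (CC_fin _ _ _) ((CC_fin _ _ _).image _), Set.InjOn.ncard_image,
        ih hL, ih hL]
      · intro S hS T hT hST
        have h1 := hn _ _ hS
        have h2 := hn _ _ hT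
        rw [← Finset.erase_insert h1, hST, Finset.erase_insert h2]
      · rw [Set.disjoint_left]
        rintro S hS ⟨T, hT, rfl⟩
        exact hn _ _ hS (Finset.mem_insert_self _ _)

/-! independence -/

lemma indep_iff (S : Finset (Hyp d)) :
    ArrIndep d S ↔ finrank ℝ (S.inf id : Hyp d) + S.card = d := by
  unfold ArrIndep arrRank
  have : finrank ℝ (S.inf id : Hyp d) ≤ d := by
    simpa using Submodule.finrank_le (S.inf id : Hyp d)
  omega

lemma rank_ge (S : Finset (Hyp d)) (hS : ∀ H ∈ S, IsLinHyp d H) :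
    d ≤ finrank ℝ (S.inf id : Hyp d) + S.card := by
  induction S using Finset.induction_on with
  | empty => rw [Finset.inf_empty, finrank_top]; simp
  | insert H T hH ih =>
    have h1 := ih (fun x hx => hS x (Finset.mem_insert_of_mem hx))
    rw [Finset.inf_insert, Finset.card_insert_of_notMem hH, inf_comm]
    have hl := hS H (Finset.mem_insert_self _ _)
    by_cases h : T.inf id ≤ H
    · have : T.inf id ⊓ id H = T.inf id := inf_eq_left.2 h
      rw [this]; omega
    · have := finrank_inf hl _ h
      simp only [id] at *
      omega

lemma indep_insert {H : Hyp d} {T : Finset (Hyp d)} (hT : ∀ H ∈ T, IsLinHyp d H)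
    (hl : IsLinHyp d H) (hH : H ∉ T) :
    ArrIndep d (insert H T) ↔ ArrIndep d T ∧ ¬ T.inf id ≤ H := by
  rw [indep_iff, indep_iff, Finset.inf_insert, Finset.card_insert_of_notMem hH, inf_comm]
  have h1 := rank_ge T hT
  by_cases h : T.inf id ≤ H
  · have : T.inf id ⊓ id H = T.inf id := inf_eq_left.2 h
    rw [this]
    simp only [h, not_true, and_false, iff_false]
    omega
  · have := finrank_inf hl _ h
    simp only [id, h, not_false_iff, and_true] at *
    omega

lemma indep_subset {S T : Finset (Hyp d)} (hS : ∀ H ∈ S, IsLinHyp d H) (hTS : T ⊆ S)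
    (h : ArrIndep d S) : ArrIndep d T := by
  induction S using Finset.induction_on generalizing T with
  | empty => rwa [Finset.subset_empty.1 hTS]
  | insert H S hH ih =>
    have hS' : ∀ H ∈ S, IsLinHyp d H := fun x hx => hS x (Finset.mem_insert_of_mem hx)
    have hl := hS H (Finset.mem_insert_self _ _)
    obtain ⟨h1, h2⟩ := (indep_insert hS' hl hH).1 h
    by_cases hT : H ∈ T
    · rw [← Finset.insert_erase hT]
      have hsub : T.erase H ⊆ S := by
        intro x hx
        obtain ⟨a, b⟩ := Finset.mem_erase.1 hx
        exact (Finset.mem_insert.1 (hTS b)).resolve_left a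
      refine (indep_insert (fun x hx => hS' x (hsub hx)) hl (Finset.notMem_erase _ _)).2
        ⟨ih hS' hsub h1, fun h3 => h2 ((Finset.inf_mono hsub).trans h3)⟩
    · refine ih hS' ?_ h1
      intro x hx
      exact (Finset.mem_insert.1 (hTS hx)).resolve_left (fun e => hT (e ▸ hx))

lemma nbc_iff (A : Finset (Hyp d)) (ord : Hyp d → ℕ) (hhyp : ∀ H ∈ A, IsLinHyp d H)
    (hord : Set.InjOn ord (A : Set (Hyp d))) (L : List (Hyp d)) (hL : ∀ x, x ∈ L ↔ x ∈ A)
    (S : Finset (Hyp d)) : IsNBC d A ord S ↔ CC ord ⊤ L S := by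
  unfold IsNBC CC
  simp only [hL, top_inf_eq]
  constructor
  · rintro ⟨hSA, hi, hb⟩
    refine ⟨fun s hs => hSA hs, fun x hx hle => ?_⟩
    have hS' : ∀ H ∈ S, IsLinHyp d H := fun H hH => hhyp H (hSA hH)
    let P : Finset (Hyp d) → Prop := fun T => T ⊆ S.filter (fun s => ord x < ord s) ∧ T.inf id ≤ x
    obtain ⟨T, hTP, hmin⟩ : ∃ T, P T ∧ ∀ T', T' ⊂ T → ¬ P T' := by
      have hne : ∃ T, P T := ⟨_, Finset.Subset.refl _, hle⟩
      obtain ⟨T, hT⟩ := WellFounded.has_min (wellFounded_lt (α := Finset (Hyp d))) {T | P T} hne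
      exact ⟨T, hT.1, fun T' h1 h2 => hT.2 T' h2 h1⟩
    obtain ⟨hTs, hTx⟩ := hTP
    have hTS : T ⊆ S := hTs.trans (Finset.filter_subset _ _)
    have hxT : x ∉ T := fun h => by
      have := (Finset.mem_filter.1 (hTs h)).2
      omega
    have hT' : ∀ H ∈ T, IsLinHyp d H := fun H hH => hS' H (hTS hH)
    refine hb T hTS ⟨x, hx, hxT, ⟨?_, ?_⟩, fun H hH => (Finset.mem_filter.1 (hTs hH)).2⟩
    · rw [indep_insert hT' (hhyp x hx) hxT]
      exact fun h => h.2 hTx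
    · intro H hH
      rcases Finset.mem_insert.1 hH with rfl | hH
      · rw [Finset.erase_insert hxT]
        exact indep_subset hS' hTS hi
      · have hne : x ≠ H := fun e => hxT (e ▸ hH)
        rw [Finset.erase_insert_of_ne hne]
        have hsub := Finset.erase_subset H T
        rw [indep_insert (fun y hy => hT' y (hsub hy)) (hhyp x hx) (fun h => hxT (hsub h))]
        refine ⟨indep_subset hS' (hsub.trans hTS) hi, fun h => ?_⟩
        exact hmin _ (Finset.erase_ssubset hH) ⟨hsub.trans hTs, h⟩
  · rintro ⟨hSA, hc⟩
    have hS' : ∀ H ∈ S, IsLinHyp d H := fun H hH => hhyp H (hSA H hH)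
    have hi : ∀ T : Finset (Hyp d), T ⊆ S → ArrIndep d T := by
      intro T
      induction T using Finset.induction_on_min_value ord with
      | empty => intro _; rw [indep_iff, Finset.inf_empty, finrank_top]; simp
      | insert a s ha hmin ih =>
        intro hsub
        have haS := hsub (Finset.mem_insert_self _ _)
        have hsS : s ⊆ S := fun x hx => hsub (Finset.mem_insert_of_mem hx)
        rw [indep_insert (fun y hy => hS' y (hsS hy)) (hS' a haS) ha]
        refine ⟨ih hsS, fun h => hc a (hSA a haS) ((Finset.inf_mono ?_).trans h)⟩
        intro x hx
        refine Finset.mem_filter.2 ⟨hsS hx, lt_of_le_of_ne (hmin x hx) fun e => ?_⟩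
        have := hord (hSA a haS) (hSA x (hsS hx)) e
        exact ha (this ▸ hx)
    refine ⟨fun s hs => hSA s hs, hi S (Finset.Subset.refl _), ?_⟩
    rintro B hBS ⟨H, hHA, hHB, ⟨hc1, hc2⟩, hlt⟩
    rw [indep_insert (fun y hy => hS' y (hBS hy)) (hhyp H hHA) hHB] at hc1
    have hle : B.inf id ≤ H := by
      by_contra h
      exact hc1 ⟨hi B hBS, h⟩
    refine hc H hHA ((Finset.inf_mono ?_).trans hle)
    intro x hx
    exact Finset.mem_filter.2 ⟨hBS hx, hlt x hx⟩

end

end ArrFin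

/-! ### Chambers -/

namespace ArrFin

noncomputable section

variable {d : ℕ}

/-- sign vector -/
def sgn (L : List (Hyp d)) (x : Fin d → ℝ) : List Bool := L.map (fun H => decide (0 < fn H x))

/-- realized sign vectors -/
def SV (L : List (Hyp d)) (K : Hyp d) : Set (List Bool) :=
  sgn L '' {x | x ∈ K ∧ ∀ H ∈ L, fn H x ≠ 0}

lemma perturb (L : List (Hyp d)) (x w : Fin d → ℝ) (hx : ∀ H ∈ L, fn H x ≠ 0) :
    ∃ ε > 0, ∀ t : ℝ, |t| ≤ ε → (∀ H ∈ L, fn H (x + t • w) ≠ 0) ∧ sgn L (x + t • w) = sgn L x := by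
  induction L with
  | nil => exact ⟨1, one_pos, fun t _ => ⟨by simp, rfl⟩⟩
  | cons α L ih =>
    obtain ⟨ε, he, h⟩ := ih (fun H hH => hx H (List.mem_cons_of_mem _ hH))
    have ha := hx α List.mem_cons_self
    have hpos : 0 < |fn α x| := abs_pos.2 ha
    have hw : 0 ≤ |fn α w| := abs_nonneg _
    refine ⟨min ε (|fn α x| / (2 * (|fn α w| + 1))), by positivity, fun t ht => ?_⟩
    obtain ⟨h1, h2⟩ := h t (ht.trans (min_le_left _ _))
    have h3 := ht.trans (min_le_right _ _)
    have h4 : |t * fn α w| < |fn α x| := by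
      rw [abs_mul]
      rw [le_div_iff₀ (by positivity)] at h3
      nlinarith [abs_nonneg t]
    have h5 : fn α (x + t • w) = fn α x + t * fn α w := by simp
    have h6 := abs_lt.1 h4
    have h7 : fn α (x + t • w) ≠ 0 ∧ (0 < fn α (x + t • w) ↔ 0 < fn α x) := by
      rw [h5]
      rcases lt_or_gt_of_ne ha with hn | hp
      · rw [abs_of_neg hn] at h6
        refine ⟨by linarith [h6.2] |> ne_of_lt, ⟨fun _ => by linarith, fun _ => by linarith⟩⟩
      · rw [abs_of_pos hp] at h6
        refine ⟨by linarith [h6.1] |> ne_of_gt, ⟨fun _ => by linarith, fun _ => by linarith⟩⟩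
    refine ⟨?_, ?_⟩
    · intro H hH
      rcases List.mem_cons.1 hH with rfl | hH
      · exact h7.1
      · exact h1 H hH
    · unfold sgn at h2 ⊢
      rw [List.map_cons, List.map_cons, h2]
      simp only [h7.2]

lemma sgn_iff {L : List (Hyp d)} {x y : Fin d → ℝ} :
    sgn L x = sgn L y ↔ ∀ H ∈ L, (0 < fn H x ↔ 0 < fn H y) := by
  unfold sgn
  simp

lemma combine {L : List (Hyp d)} {x y : Fin d → ℝ} (hx : ∀ H ∈ L, fn H x ≠ 0)
    (hy : ∀ H ∈ L, fn H y ≠ 0) (h : sgn L x = sgn L y) {a b : ℝ} (ha : 0 ≤ a) (hb : 0 ≤ b)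
    (hab : 0 < a + b) :
    (∀ H ∈ L, fn H (a • x + b • y) ≠ 0) ∧ sgn L (a • x + b • y) = sgn L x := by
  rw [sgn_iff] at h ⊢
  rw [← forall₂_and]
  intro H hH
  have h1 := h H hH
  have hx := hx H hH
  have hy := hy H hH
  simp only [map_add, map_smul, smul_eq_mul]
  have hab' : 0 < a ∨ 0 < b := by
    by_contra hc
    push Not at hc
    linarith
  rcases lt_or_gt_of_ne hx with hn | hp
  · have hyn : fn H y < 0 := lt_of_le_of_ne (not_lt.1 fun h2 => by linarith [h1.2 h2]) hy
    have : a * fn H x + b * fn H y < 0 := by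
      rcases hab' with h0 | h0
      · nlinarith [mul_pos h0 (neg_pos.2 hn), mul_nonneg hb (neg_pos.2 hyn).le]
      · nlinarith [mul_pos h0 (neg_pos.2 hyn), mul_nonneg ha (neg_pos.2 hn).le]
    exact ⟨this.ne, ⟨fun _ => by linarith, fun _ => by linarith⟩⟩
  · have hyp := h1.1 hp
    have : 0 < a * fn H x + b * fn H y := by
      rcases hab' with h0 | h0
      · nlinarith [mul_pos h0 hp, mul_nonneg hb hyp.le]
      · nlinarith [mul_pos h0 hyp, mul_nonneg ha hp.le]
    exact ⟨this.ne', ⟨fun _ => hp, fun _ => this⟩⟩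

/-- sign vectors with given first sign -/
def SB (b : Bool) (α : Hyp d) (L : List (Hyp d)) (K : Hyp d) : Set (List Bool) :=
  sgn L '' {x | (x ∈ K ∧ ∀ H ∈ L, fn H x ≠ 0) ∧ fn α x ≠ 0 ∧ decide (0 < fn α x) = b}

lemma SV_fin (L : List (Hyp d)) (K : Hyp d) : (SV L K).Finite := by
  refine (List.finite_length_eq Bool L.length).subset ?_
  rintro _ ⟨x, _, rfl⟩
  simp [sgn]

lemma SB_sub (b : Bool) (α : Hyp d) (L : List (Hyp d)) (K : Hyp d) : SB b α L K ⊆ SV L K := by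
  rintro _ ⟨x, hx, rfl⟩
  exact ⟨x, hx.1, rfl⟩

lemma SV_cons (α : Hyp d) (L : List (Hyp d)) (K : Hyp d) :
    SV (α :: L) K = List.cons true '' SB true α L K ∪ List.cons false '' SB false α L K := by
  ext σ
  constructor
  · rintro ⟨x, ⟨hK, hx⟩, rfl⟩
    have h1 := hx α List.mem_cons_self
    have h2 : ∀ H ∈ L, fn H x ≠ 0 := fun H hH => hx H (List.mem_cons_of_mem _ hH)
    by_cases hp : 0 < fn α x
    · left
      exact ⟨_, ⟨x, ⟨⟨hK, h2⟩, h1, by simp [hp]⟩, rfl⟩, by simp [sgn, hp]⟩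
    · right
      exact ⟨_, ⟨x, ⟨⟨hK, h2⟩, h1, by simp [hp]⟩, rfl⟩, by simp [sgn, hp]⟩
  · rintro (⟨_, ⟨x, ⟨⟨hK, h2⟩, h1, hb⟩, rfl⟩, rfl⟩ | ⟨_, ⟨x, ⟨⟨hK, h2⟩, h1, hb⟩, rfl⟩, rfl⟩)
    all_goals
      refine ⟨x, ⟨hK, ?_⟩, ?_⟩
      · intro H hH
        rcases List.mem_cons.1 hH with rfl | hH
        · exact h1
        · exact h2 H hH
      · simp only [sgn, List.map_cons, hb]

lemma SB_union {α : Hyp d} {L : List (Hyp d)} {K : Hyp d} {w : Fin d → ℝ} (hw : w ∈ K)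
    (hα : 0 < fn α w) : SB true α L K ∪ SB false α L K = SV L K := by
  apply Set.Subset.antisymm (Set.union_subset (SB_sub _ _ _ _) (SB_sub _ _ _ _))
  rintro _ ⟨x, ⟨hK, hx⟩, rfl⟩
  have key : ∀ y, y ∈ K → (∀ H ∈ L, fn H y ≠ 0) → fn α y ≠ 0 →
      sgn L y ∈ SB true α L K ∪ SB false α L K := by
    intro y h1 h2 h3
    by_cases hp : 0 < fn α y
    · exact Or.inl ⟨y, ⟨⟨h1, h2⟩, h3, by simp [hp]⟩, rfl⟩
    · exact Or.inr ⟨y, ⟨⟨h1, h2⟩, h3, by simp [hp]⟩, rfl⟩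
  by_cases h : fn α x = 0
  · obtain ⟨ε, he, hh⟩ := perturb L x w hx
    obtain ⟨h1, h2⟩ := hh ε (by rw [abs_of_pos he])
    rw [← h2]
    refine key _ (K.add_mem hK (K.smul_mem _ hw)) h1 ?_
    simp [h, he.ne', hα.ne']
  · exact key x hK hx h

lemma SB_inter {α : Hyp d} (hα' : IsLinHyp d α) {L : List (Hyp d)} {K : Hyp d} {w : Fin d → ℝ}
    (hw : w ∈ K) (hα : 0 < fn α w) : SB true α L K ∩ SB false α L K = SV L (K ⊓ α) := by
  ext σ
  constructor
  · rintro ⟨⟨x, ⟨⟨hxK, hx⟩, hxa, hxb⟩, rfl⟩, ⟨y, ⟨⟨hyK, hy⟩, hya, hyb⟩, hxy⟩⟩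
    have h1 : 0 < fn α x := by simpa using hxb
    have h2 : fn α y < 0 := lt_of_le_of_ne (by simpa using hyb) hya
    obtain ⟨h3, h4⟩ := combine hx hy hxy.symm (a := - fn α y) (b := fn α x) (by linarith) h1.le
      (by linarith)
    refine ⟨_, ⟨⟨K.add_mem (K.smul_mem _ hxK) (K.smul_mem _ hyK), ?_⟩, h3⟩, h4⟩
    change _ ∈ α
    rw [← fn_eq_zero hα']
    simp
    ring
  · rintro ⟨x, ⟨⟨hxK, hxa⟩, hx⟩, rfl⟩
    have h0 := (fn_eq_zero hα' x).2 hxa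
    obtain ⟨ε, he, hh⟩ := perturb L x w hx
    obtain ⟨h1, h2⟩ := hh ε (by rw [abs_of_pos he])
    obtain ⟨h3, h4⟩ := hh (-ε) (by rw [abs_neg, abs_of_pos he])
    have hm : 0 < ε * fn α w := mul_pos he hα
    refine ⟨⟨_, ⟨⟨K.add_mem hxK (K.smul_mem _ hw), h1⟩, ?_, ?_⟩, h2⟩,
      ⟨_, ⟨⟨K.add_mem hxK (K.smul_mem _ hw), h3⟩, ?_, ?_⟩, h4⟩⟩
    · simp [h0, he.ne', hα.ne']
    · simp [h0]; exact hm
    · simp [h0, he.ne', hα.ne']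
    · simp [h0]; exact hm.le

lemma chamber_count (L : List (Hyp d)) (hL : ∀ H ∈ L, IsLinHyp d H) :
    ∀ K : Hyp d, (SV L K).ncard = fcount L K := by
  induction L with
  | nil =>
    intro K
    have : SV [] K = {[]} := by
      ext σ
      constructor
      · rintro ⟨x, _, rfl⟩; rfl
      · rintro rfl; exact ⟨0, ⟨K.zero_mem, by simp⟩, rfl⟩
    rw [this, Set.ncard_singleton]; rfl
  | cons α L ih =>
    intro K
    have hα := hL α List.mem_cons_self
    have hL' : ∀ H ∈ L, IsLinHyp d H := fun H hH => hL H (List.mem_cons_of_mem _ hH)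
    unfold fcount
    split_ifs with hK
    · have : SV (α :: L) K = ∅ := by
        apply Set.eq_empty_of_forall_notMem
        rintro _ ⟨x, ⟨hx, h⟩, rfl⟩
        exact h α List.mem_cons_self ((fn_eq_zero hα x).2 (hK hx))
      rw [this, Set.ncard_empty]
    · obtain ⟨w, hw, hwα⟩ : ∃ w ∈ K, 0 < fn α w := by
        obtain ⟨w, hw, hwa⟩ := Set.not_subset.1 hK
        have h0 : fn α w ≠ 0 := fun h => hwa ((fn_eq_zero hα w).1 h)
        rcases lt_or_gt_of_ne h0 with h | h
        · exact ⟨-w, K.neg_mem hw, by simpa using h⟩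
        · exact ⟨w, hw, h⟩
      have f1 := (SV_fin L K).subset (SB_sub true α L K)
      have f2 := (SV_fin L K).subset (SB_sub false α L K)
      rw [SV_cons, Set.ncard_union_eq ?_ (f1.image _) (f2.image _),
        Set.ncard_image_of_injective _ (List.cons_injective),
        Set.ncard_image_of_injective _ (List.cons_injective),
        ← Set.ncard_union_add_ncard_inter _ _ f1 f2, SB_union hw hwα, SB_inter hα hw hwα,
        ih hL', ih hL']
      rw [Set.disjoint_left]
      rintro _ ⟨a, _, rfl⟩ ⟨b, _, h⟩
      simp at h

lemma fn_cont (H : Hyp d) : Continuous (fn H) := LinearMap.continuous_of_finiteDimensional _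

lemma numChambers_eq (A : Finset (Hyp d)) (hhyp : ∀ H ∈ A, IsLinHyp d H) (L : List (Hyp d))
    (hL : ∀ x, x ∈ L ↔ x ∈ A) : numChambers d A = (SV L ⊤).ncard := by
  have hmem : ∀ x, x ∈ arrComplement d A ↔ ∀ H ∈ L, fn H x ≠ 0 := by
    intro x
    unfold arrComplement
    constructor
    · intro h H hH h0
      exact h H ((hL H).1 hH) ((fn_eq_zero (hhyp H ((hL H).1 hH)) x).1 h0)
    · intro h H hH h0
      exact h H ((hL H).2 hH) ((fn_eq_zero (hhyp H hH) x).2 h0)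
  let X := arrComplement d A
  let s : X → List Bool := fun x => sgn L x.1
  have hiff : ∀ x y : X, connectedComponent x = connectedComponent y ↔ s x = s y := by
    intro x y
    constructor
    · intro h
      refine sgn_iff.2 fun H hH => ?_
      have hcl : IsClopen {z : X | 0 < fn H z.1} := by
        refine ⟨?_, isOpen_lt continuous_const ((fn_cont H).comp continuous_subtype_val)⟩
        have : {z : X | 0 < fn H z.1} = {z : X | 0 ≤ fn H z.1} := by
          ext z
          have := (hmem z.1).1 z.2 H hH
          exact ⟨fun h => le_of_lt (show 0 < fn H z.1 from h),
            fun h => lt_of_le_of_ne (show 0 ≤ fn H z.1 from h) this.symm⟩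
        rw [this]
        exact isClosed_le continuous_const ((fn_cont H).comp continuous_subtype_val)
      constructor
      · intro hx
        have := hcl.connectedComponent_subset (x := x) hx
        exact this (h ▸ mem_connectedComponent)
      · intro hy
        have := hcl.connectedComponent_subset (x := y) hy
        exact this (h ▸ mem_connectedComponent)
    · intro h
      let U : Set (Fin d → ℝ) := {z | (∀ H ∈ L, fn H z ≠ 0) ∧ sgn L z = sgn L x.1}
      have hU : Convex ℝ U := by
        intro a ha b hb p q hp hq hpq
        obtain ⟨h1, h2⟩ := combine ha.1 hb.1 (ha.2.trans hb.2.symm) hp hq (by linarith)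
        exact ⟨h1, h2.trans ha.2⟩
      have hpre : _root_.IsPreconnected ((Subtype.val : X → _) ⁻¹' U) := by
        rw [← Topology.IsInducing.subtypeVal.isPreconnected_image, Subtype.image_preimage_coe,
          Set.inter_eq_self_of_subset_right]
        · exact hU.isPreconnected
        · exact fun z hz => (hmem z).2 hz.1
      refine connectedComponent_eq ?_
      exact hpre.subset_connectedComponent (x := x) ⟨(hmem x.1).1 x.2, rfl⟩ ⟨(hmem y.1).1 y.2, h.symm⟩
  have hset : connectedComponentSetoid X = Setoid.ker s := by
    ext x y
    exact hiff x y
  have hran : SV L ⊤ = Set.range s := by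
    ext σ
    constructor
    · rintro ⟨x, ⟨_, hx⟩, rfl⟩
      exact ⟨⟨x, (hmem x).2 hx⟩, rfl⟩
    · rintro ⟨x, rfl⟩
      exact ⟨x.1, ⟨Submodule.mem_top, (hmem x.1).1 x.2⟩, rfl⟩
  rw [hran, ← Nat.card_coe_set_eq]
  unfold numChambers
  refine Nat.card_congr ?_
  change Quotient (connectedComponentSetoid X) ≃ _
  rw [hset]
  exact Setoid.quotientKerEquivRange s

end

end ArrFin

/-! ### Complexification and assembly -/

namespace ArrFin

noncomputable section

variable {d : ℕ}

/-- real part -/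
def rp (z : Fin d → ℂ) : Fin d → ℝ := fun i => (z i).re

/-- imaginary part -/
def ip (z : Fin d → ℂ) : Fin d → ℝ := fun i => (z i).im

/-- complexified subspace -/
def KC (K : Hyp d) : Submodule ℂ (Fin d → ℂ) where
  carrier := {z | rp z ∈ K ∧ ip z ∈ K}
  add_mem' := by
    rintro a b ⟨h1, h2⟩ ⟨h3, h4⟩
    exact ⟨K.add_mem h1 h3, K.add_mem h2 h4⟩
  zero_mem' := ⟨K.zero_mem, K.zero_mem⟩
  smul_mem' := by
    rintro c z ⟨h1, h2⟩
    refine ⟨?_, ?_⟩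
    · have : rp (c • z) = c.re • rp z - c.im • ip z := by
        ext i; simp [rp, ip]
      rw [this]
      exact K.sub_mem (K.smul_mem _ h1) (K.smul_mem _ h2)
    · have : ip (c • z) = c.re • ip z + c.im • rp z := by
        ext i; simp [rp, ip]
      rw [this]
      exact K.add_mem (K.smul_mem _ h2) (K.smul_mem _ h1)

lemma mem_KC {K : Hyp d} {z : Fin d → ℂ} : z ∈ KC K ↔ rp z ∈ K ∧ ip z ∈ K := Iff.rfl

/-- complexified functional -/
def cf (H : Hyp d) : (Fin d → ℂ) →L[ℂ] ℂ :=
  ∑ i, (fn H (fun j => if i = j then 1 else 0) : ℂ) • ContinuousLinearMap.proj (R := ℂ) i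

lemma cf_apply (H : Hyp d) (z : Fin d → ℂ) : cf H z = ⟨fn H (rp z), fn H (ip z)⟩ := by
  rw [LinearMap.pi_apply_eq_sum_univ (fn H) (rp z), LinearMap.pi_apply_eq_sum_univ (fn H) (ip z)]
  unfold cf
  apply Complex.ext
  · simp [rp, mul_comm]
  · simp [ip, mul_comm]

lemma cf_eq_zero {H : Hyp d} (h : IsLinHyp d H) (z : Fin d → ℂ) : cf H z = 0 ↔ z ∈ KC H := by
  rw [cf_apply, mem_KC, ← fn_eq_zero h, ← fn_eq_zero h, Complex.ext_iff]
  rfl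

lemma complexify_eq (H : Hyp d) : complexify d H = KC H := by
  apply le_antisymm
  · unfold complexify
    rw [Submodule.span_le]
    rintro _ ⟨x, hx, rfl⟩
    refine ⟨?_, ?_⟩
    · have : rp (fun i => (x i : ℂ)) = x := by ext i; simp [rp]
      rw [this]; exact hx
    · have : ip (fun i => (x i : ℂ)) = 0 := by ext i; simp [ip]
      rw [this]; exact H.zero_mem
  · rintro z ⟨h1, h2⟩
    have : z = (fun i => (rp z i : ℂ)) + Complex.I • (fun i => (ip z i : ℂ)) := by
      ext i
      simp only [rp, ip, Pi.add_apply, Pi.smul_apply, smul_eq_mul]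
      rw [mul_comm, Complex.re_add_im]
    rw [this]
    exact Submodule.add_mem _ (Submodule.subset_span ⟨_, h1, rfl⟩)
      (Submodule.smul_mem _ _ (Submodule.subset_span ⟨_, h2, rfl⟩))

lemma kr_KC {H : Hyp d} (h : IsLinHyp d H) (K : Hyp d) :
    ArrTop.kr (KC K) (cf H) = KC (K ⊓ H) := by
  ext z
  have h1 : z ∈ ArrTop.kr (KC K) (cf H) ↔ z ∈ KC K ∧ cf H z = 0 := Iff.rfl
  rw [h1, cf_eq_zero h]
  simp only [mem_KC, Submodule.mem_inf]
  tauto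

lemma KC_nonzero {H : Hyp d} (h : IsLinHyp d H) (K : Hyp d) (hK : ¬ K ≤ H) :
    ∃ w ∈ KC K, cf H w ≠ 0 := by
  obtain ⟨w, hw, hwa⟩ := Set.not_subset.1 hK
  have hr : rp (fun i => (w i : ℂ)) = w := by ext i; simp [rp]
  have hi : ip (fun i => (w i : ℂ)) = 0 := by ext i; simp [ip]
  refine ⟨fun i => (w i : ℂ), ?_, ?_⟩
  · rw [mem_KC, hr, hi]; exact ⟨hw, K.zero_mem⟩
  · rw [Ne, cf_eq_zero h, mem_KC, hr]
    exact fun h => hwa h.1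

lemma betti_count (L : List (Hyp d)) (hL : ∀ H ∈ L, IsLinHyp d H) :
    ∀ K : Hyp d, ∑ k ∈ Finset.range (finrank ℝ K + 1), ArrTop.bt (ArrTop.M (KC K) (L.map cf)) k =
      fcount L K := by
  induction L with
  | nil =>
    intro K
    rw [Finset.sum_range_succ', List.map_nil, ArrTop.bt_nil_zero,
      Finset.sum_eq_zero (fun k _ => ArrTop.bt_nil_succ _ k)]
    rfl
  | cons α L ih =>
    intro K
    have hα := hL α List.mem_cons_self
    have hL' : ∀ H ∈ L, IsLinHyp d H := fun H hH => hL H (List.mem_cons_of_mem _ hH)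
    unfold fcount
    rw [List.map_cons]
    split_ifs with hK
    · refine Finset.sum_eq_zero fun k _ => ArrTop.bt_cons_empty _ ?_ k
      intro w hw
      rw [cf_eq_zero hα]
      exact ⟨hK hw.1, hK hw.2⟩
    · have hr := finrank_inf hα K hK
      rw [← ih hL' K, ← ih hL' (K ⊓ α), ← hr, ArrTop.bsum_cons _ (KC_nonzero hα K hK), kr_KC hα]

lemma cx_eq (A : Finset (Hyp d)) (hhyp : ∀ H ∈ A, IsLinHyp d H) (L : List (Hyp d))
    (hL : ∀ x, x ∈ L ↔ x ∈ A) : cxComplement d A = ArrTop.M (KC (⊤ : Hyp d)) (L.map cf) := by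
  ext z
  constructor
  · intro h
    refine ⟨⟨trivial, trivial⟩, ?_⟩
    intro β hβ h0
    obtain ⟨H, hH, rfl⟩ := List.mem_map.1 hβ
    have hA := (hL H).1 hH
    refine h H hA ?_
    rw [complexify_eq]
    exact (cf_eq_zero (hhyp H hA) z).1 h0
  · rintro ⟨_, h⟩ H hH h0
    rw [complexify_eq] at h0
    exact h _ (List.mem_map.2 ⟨H, (hL H).2 hH, rfl⟩) ((cf_eq_zero (hhyp H hH) z).2 h0)

lemma exists_list (A : Finset (Hyp d)) (ord : Hyp d → ℕ)
    (hord : Set.InjOn ord (A : Set (Hyp d))) :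
    ∃ L : List (Hyp d), (∀ x, x ∈ L ↔ x ∈ A) ∧ L.Pairwise (fun a b => ord b < ord a) := by
  induction A using Finset.induction_on_max_value ord with
  | empty => exact ⟨[], by simp, List.Pairwise.nil⟩
  | insert a s ha hmax ih =>
    obtain ⟨L, h1, h2⟩ := ih (hord.mono (by simp))
    refine ⟨a :: L, by simp [h1], List.pairwise_cons.2 ⟨fun b hb => ?_, h2⟩⟩
    have hb' := (h1 b).1 hb
    refine lt_of_le_of_ne (hmax b hb') fun e => ha ?_
    have := hord (Finset.mem_coe.2 (Finset.mem_insert_of_mem hb'))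
      (Finset.mem_coe.2 (Finset.mem_insert_self _ _)) e
    exact this ▸ hb'

end

end ArrFin

/-- For a central essential arrangement in ℝ^d, the number of chambers
equals the sum of the Betti numbers of the complexified complement, which equals
the number of nbc-sets. -/
theorem stmt0 (d : ℕ) (A : Finset (Hyp d)) (ord : Hyp d → ℕ)
    (hhyp : ∀ H ∈ A, IsLinHyp d H)
    (hess : arrRank d A = d)
    (hord : Set.InjOn ord (A : Set (Hyp d))) :
    numChambers d A = ∑ k ∈ Finset.range (d + 1), betti (cxComplement d A) k ∧
    (∑ k ∈ Finset.range (d + 1), betti (cxComplement d A) k) =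
      Nat.card {S : Finset (Hyp d) // IsNBC d A ord S} := by
  obtain ⟨L, hL, hp⟩ := ArrFin.exists_list A ord hord
  have hLl : ∀ H ∈ L, IsLinHyp d H := fun H hH => hhyp H ((hL H).1 hH)
  have h1 : numChambers d A = ArrFin.fcount L ⊤ := by
    rw [ArrFin.numChambers_eq A hhyp L hL, ArrFin.chamber_count L hLl]
  have h2 : ∑ k ∈ Finset.range (d + 1), betti (cxComplement d A) k = ArrFin.fcount L ⊤ := by
    rw [← ArrFin.betti_count L hLl, ArrFin.cx_eq A hhyp L hL, finrank_top, Module.finrank_fin_fun]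
    exact Finset.sum_congr rfl fun k _ => ArrTop.betti_eq _ k
  have h3 : Nat.card {S : Finset (Hyp d) // IsNBC d A ord S} = ArrFin.fcount L ⊤ := by
    rw [← ArrFin.nbc_count ord L hp, ← Nat.card_coe_set_eq]
    exact Nat.card_congr (Equiv.subtypeEquivRight (ArrFin.nbc_iff A ord hhyp hord L hL))
  exact ⟨h1.trans h2.symm, h2.trans h3.symm⟩
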